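/- Let 1 ≤ n ≤ 5 and (λ,μ,ν) ∈ (Par_n)^3. Then N_{λ,μ,ν} ≠ 0 if and only if |λ| + |μ| + |ν| is even and there exists a positive integer t such that N_{tλ,tμ,tν} ≠ 0. -/

import Mathlib

/-- `f : ℕ → ℕ` is a partition: weakly decreasing and eventually zero
(the parts are `f 0 ≥ f 1 ≥ …`, 0-indexed). -/
def IsPartition (f : ℕ → ℕ) : Prop :=
  (∀ i j, i ≤ j → f j ≤ f i) ∧ ∃ N, ∀ i, N ≤ i → f i = 0

/-- The cell in row `i`, column `j` (0-indexed) lies in the skew shape `ν/λ`. -/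
def InSkew (lam nu : ℕ → ℕ) (i j : ℕ) : Prop :=
  lam i ≤ j ∧ j < nu i

/-- `p` is read weakly before `q` in the row reading word of a (skew) tableau:
right to left along rows, top to bottom. -/
def ReadBefore (p q : ℕ × ℕ) : Prop :=
  p.1 < q.1 ∨ (p.1 = q.1 ∧ q.2 ≤ p.2)

/-- `T` is a Littlewood–Richardson witness for `c^ν_{λ,μ}`: a semistandard skew
tableau of shape `ν/λ` (entries `≥ 1` on the shape, `0` off the shape) with
content `μ`, whose (reverse) row reading word is ballot.  The conditions that
`λ, μ, ν` are partitions with `λ ⊆ ν` are built in, so that the associated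
count vanishes on non-partitions. -/
def IsLRTableau (lam mu nu : ℕ → ℕ) (T : ℕ → ℕ → ℕ) : Prop :=
  IsPartition lam ∧ IsPartition mu ∧ IsPartition nu ∧
  (∀ i, lam i ≤ nu i) ∧
  (∀ i j, ¬ InSkew lam nu i j → T i j = 0) ∧
  (∀ i j, InSkew lam nu i j → 1 ≤ T i j) ∧
  (∀ i j j', InSkew lam nu i j → InSkew lam nu i j' → j ≤ j' → T i j ≤ T i j') ∧
  (∀ i i' j, InSkew lam nu i j → InSkew lam nu i' j → i < i' → T i j < T i' j) ∧
  (∀ k, {p : ℕ × ℕ | InSkew lam nu p.1 p.2 ∧ T p.1 p.2 = k + 1}.ncard = mu k) ∧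
  (∀ k, ∀ q : ℕ × ℕ, InSkew lam nu q.1 q.2 → T q.1 q.2 = k + 2 →
    {p : ℕ × ℕ | InSkew lam nu p.1 p.2 ∧ T p.1 p.2 = k + 2 ∧ ReadBefore p q}.ncard ≤
      {p : ℕ × ℕ | InSkew lam nu p.1 p.2 ∧ T p.1 p.2 = k + 1 ∧ ReadBefore p q}.ncard)

/-- The Littlewood–Richardson coefficient `c^ν_{λ,μ}` (inner shape `λ`,
content `μ`, outer shape `ν`). -/
noncomputable def lrCoeff (lam mu nu : ℕ → ℕ) : ℕ :=
  Nat.card {T : ℕ → ℕ → ℕ // IsLRTableau lam mu nu T}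

/-- The Newell–Littlewood number `N_{λ,μ,ν} = ∑ c^λ_{α,β} c^μ_{β,γ} c^ν_{γ,α}`. -/
noncomputable def NL (lam mu nu : ℕ → ℕ) : ℕ :=
  ∑ᶠ (a : ℕ → ℕ) (b : ℕ → ℕ) (c : ℕ → ℕ),
    lrCoeff a b lam * lrCoeff b c mu * lrCoeff c a nu

/-- Membership in `Par_n`: a partition with at most `n` parts. -/
def MemParN (n : ℕ) (f : ℕ → ℕ) : Prop :=
  IsPartition f ∧ ∀ i, n ≤ i → f i = 0

/-- `|λ_A| = ∑_{i ∈ A} λ_i` for `A ⊆ [n] = {1,…,n}` (1-indexed subset,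
0-indexed parts). -/
def sumParts (f : ℕ → ℕ) (A : Finset ℕ) : ℕ := ∑ i ∈ A, f (i - 1)

/-- `|λ| = ∑ λ_i`. -/
noncomputable def sizeP (f : ℕ → ℕ) : ℕ := ∑ᶠ i, f i


section
namespace NLS

/-- hive inequalities on the triangle `0 ≤ k ≤ i ≤ n` -/
structure IsHive {R : Type*} [CommRing R] [LinearOrder R] (n : ℕ) (H : ℕ → ℕ → R) : Prop where
  s1 : ∀ i k, k < i → i < n → H i (k+1) + H (i+1) k ≤ H (i+1) (k+1) + H i k
  s2 : ∀ i k, k < i → i < n → H i k + H (i+1) (k+2) ≤ H i (k+1) + H (i+1) (k+1)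
  s3 : ∀ i k, k ≤ i → i + 1 < n → H i k + H (i+2) (k+1) ≤ H (i+1) k + H (i+1) (k+1)

/-- Three hives glued along their `AB` and `BC` sides -/
structure IsMH {R : Type*} [CommRing R] [LinearOrder R] (n : ℕ) (L : Fin 3 → ℕ → R)
    (H : Fin 3 → ℕ → ℕ → R) : Prop where
  hive : ∀ s, IsHive n (H s)
  seam : ∀ s k, k ≤ n → H s n k = H s n 0 + H (s+1) k 0
  bd : ∀ s i, i ≤ n → H s i i = ∑ j ∈ Finset.range i, L s j
  ab : ∀ s i, i < n → H s i 0 ≤ H s (i+1) 0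

def MH {R : Type*} [CommRing R] [LinearOrder R] (n : ℕ) (L : Fin 3 → ℕ → R) : Prop :=
  ∃ H, IsMH n L H

theorem grid {R : Type*} [CommRing R] [LinearOrder R] [IsStrictOrderedRing R] (F : ℕ → ℕ → R)
    (l m : ℕ) (h : ∀ a b, a < l → b < m → F a b + F (a+1) (b+1) ≤ F (a+1) b + F a (b+1)) :
    F 0 0 + F l m ≤ F l 0 + F 0 m := by
  have h1 : ∀ a, a < l → ∀ b, b ≤ m → F a 0 + F (a+1) b ≤ F (a+1) 0 + F a b := by
    intro a ha b
    induction b with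
    | zero => intro _; linarith
    | succ b ih => intro hb; linarith [ih (by omega), h a b ha (by omega)]
  have h2 : ∀ a, a ≤ l → F 0 0 + F a m ≤ F a 0 + F 0 m := by
    intro a
    induction a with
    | zero => intro _; linarith
    | succ a ih => intro hb; linarith [ih (by omega), h1 a (by omega) m le_rfl]
  exact h2 l le_rfl

theorem sum_div_range {R : Type*} [CommRing R] (f : ℕ → R) (t : ℕ) (ht : 0 < t) (i : ℕ) :
    ∑ j ∈ Finset.range (t*i), f (j/t) = t * ∑ j ∈ Finset.range i, f j := by
  induction i with
  | zero => simp
  | succ i ih =>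
    rw [mul_add, mul_one, Finset.sum_range_add, ih, Finset.sum_range_succ, mul_add]
    congr 1
    rw [Finset.sum_congr rfl (g := fun _ => f i)]
    · simp
    · intro x hx
      rw [Finset.mem_range] at hx
      congr 1
      rw [Nat.mul_add_div ht, Nat.div_eq_of_lt hx, add_zero]

/-- P3: coarsening -/
theorem coarsen (n t : ℕ) (ht : 0 < t) (L : Fin 3 → ℕ → ℕ)
    (h : MH (R := ℤ) (t*n) (fun s i => (L s (i/t) : ℤ))) :
    MH (R := ℝ) n (fun s i => (L s i : ℝ)) := by
  obtain ⟨H, hH⟩ := h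
  have ht' : (0:ℝ) < t := by exact_mod_cast ht
  refine ⟨fun s i k => (H s (t*i) (t*k) : ℝ) / t, ?_, ?_, ?_, ?_⟩
  · intro s
    have hv := hH.hive s
    refine ⟨?_, ?_, ?_⟩
    · intro i k hk hi
      have e1 : t * (k+1) ≤ t * i := Nat.mul_le_mul_left _ hk
      have e2 : t * (i+1) ≤ t * n := Nat.mul_le_mul_left _ hi
      rw [mul_add, mul_one] at e1 e2
      have := grid (fun a b => - H s (t*i+a) (t*k+b)) t t (by
        intro a b ha hb
        have := hv.s1 (t*i+a) (t*k+b) (by omega) (by omega)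
        simp only [← add_assoc]; linarith)
      simp only [add_zero, ← mul_add_one] at this
      rw [← add_div, ← add_div]
      rw [div_le_div_iff_of_pos_right ht']; norm_cast; linarith
    · intro i k hk hi
      have e1 : t * (k+1) ≤ t * i := Nat.mul_le_mul_left _ hk
      have e2 : t * (i+1) ≤ t * n := Nat.mul_le_mul_left _ hi
      rw [mul_add, mul_one] at e1 e2
      have := grid (fun a b => H s (t*i+b) (t*k+a+b)) t t (by
        intro a b ha hb
        have := hv.s2 (t*i+b) (t*k+a+b) (by omega) (by omega)
        have e : t*k+(a+1)+b = t*k+a+b+1 := by omega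
        have e' : t*k+(a+1)+(b+1) = t*k+a+b+2 := by omega
        beta_reduce; rw [e, e']; simp only [← add_assoc]; linarith)
      simp only [add_zero, ← mul_add_one] at this
      rw [← add_div, ← add_div]
      rw [div_le_div_iff_of_pos_right ht']; exact_mod_cast this
    · intro i k hk hi
      have e1 : t * k ≤ t * i := Nat.mul_le_mul_left _ hk
      have e2 : t * (i+1+1) ≤ t * n := Nat.mul_le_mul_left _ hi
      rw [mul_add, mul_add, mul_one] at e2
      have := grid (fun a b => H s (t*i+a+b) (t*k+b)) t t (by
        intro a b ha hb
        have := hv.s3 (t*i+a+b) (t*k+b) (by omega) (by omega)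
        have e : t*i+(a+1)+b = t*i+a+b+1 := by omega
        have e' : t*i+(a+1)+(b+1) = t*i+a+b+2 := by omega
        beta_reduce; rw [e, e']; simp only [← add_assoc]; linarith)
      simp only [add_zero, ← mul_add_one] at this
      rw [← add_div, ← add_div]
      rw [div_le_div_iff_of_pos_right ht']; exact_mod_cast this
  · intro s k hk
    have := hH.seam s (t*k) (Nat.mul_le_mul_left _ hk)
    simp only [mul_zero]
    rw [← add_div, this]; push_cast; rfl
  · intro s i hi
    have := hH.bd s (t*i) (Nat.mul_le_mul_left _ hi)
    rw [sum_div_range (fun i => (L s i:ℤ)) t ht i] at this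
    simp only [this]; push_cast
    field_simp
  · intro s i hi
    have e2 : t * (i+1) ≤ t * n := Nat.mul_le_mul_left _ hi
    rw [mul_add, mul_one] at e2
    have : ∀ a, a ≤ t → H s (t*i) 0 ≤ H s (t*i+a) 0 := by
      intro a
      induction a with
      | zero => simp
      | succ a ih => intro ha; exact (ih (by omega)).trans (hH.ab s (t*i+a) (by omega))
    have := this t le_rfl
    simp only [mul_zero]
    rw [← mul_add_one] at this
    gcongr

/-- reconstruct a potential from edge labels -/
def pot {A : Type*} [AddCommGroup A] (x q : ℕ → ℕ → A) (i k : ℕ) : A :=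
  ∑ r ∈ Finset.range i, x r 0 + ∑ l ∈ Finset.range k, q i l

theorem pot_q {A : Type*} [AddCommGroup A] (x q : ℕ → ℕ → A) (i k : ℕ) :
    pot x q i (k+1) = pot x q i k + q i k := by
  simp [pot, Finset.sum_range_succ, add_assoc]

theorem pot_x {A : Type*} [AddCommGroup A] (n : ℕ) (x q z : ℕ → ℕ → A)
    (hu : ∀ i k, k ≤ i → i < n → x i k + q (i+1) k = z i k)
    (hd : ∀ i k, k < i → i < n → q i k + x i (k+1) = z i k) (i k : ℕ) (hk : k ≤ i) (hi : i < n) :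
    pot x q (i+1) k = pot x q i k + x i k := by
  induction k with
  | zero => simp [pot, Finset.sum_range_succ]
  | succ k ih =>
    rw [pot_q, pot_q, ih (by omega), add_assoc, hu i k (by omega) hi, add_assoc, hd i k (by omega) hi]

theorem pot_z {A : Type*} [AddCommGroup A] (n : ℕ) (x q z : ℕ → ℕ → A)
    (hu : ∀ i k, k ≤ i → i < n → x i k + q (i+1) k = z i k)
    (hd : ∀ i k, k < i → i < n → q i k + x i (k+1) = z i k) (i k : ℕ) (hk : k ≤ i) (hi : i < n) :
    pot x q (i+1) (k+1) = pot x q i k + z i k := by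
  rw [pot_q, pot_x n x q z hu hd i k hk hi, add_assoc, hu i k hk hi]

end NLS
end

section
namespace NLS

theorem ncard_rows (n : ℕ) (a b : ℕ → ℕ) :
    {p : ℕ × ℕ | p.1 < n ∧ a p.1 ≤ p.2 ∧ p.2 < b p.1}.Finite ∧
    {p : ℕ × ℕ | p.1 < n ∧ a p.1 ≤ p.2 ∧ p.2 < b p.1}.ncard
      = ∑ i ∈ Finset.range n, (b i - a i) := by
  have : {p : ℕ × ℕ | p.1 < n ∧ a p.1 ≤ p.2 ∧ p.2 < b p.1} =
      (((Finset.range n).sigma (fun i => Finset.Ico (a i) (b i))).map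
        (Equiv.sigmaEquivProd ℕ ℕ).toEmbedding : Finset (ℕ × ℕ)) := by
    ext ⟨i, j⟩
    simp [Equiv.sigmaEquivProd]
  rw [this]
  refine ⟨Finset.finite_toSet _, ?_⟩
  rw [Set.ncard_coe_finset, Finset.card_map, Finset.card_sigma]
  simp

theorem tab_of_P (n : ℕ) (P : ℕ → ℕ → ℕ) (lam mu nu : ℕ → ℕ)
    (hl : IsPartition lam) (hm : IsPartition mu) (hn : IsPartition nu)
    (hnz : ∀ i, n ≤ i → nu i = 0)
    (h0 : ∀ i, P i 0 = lam i) (hmono : ∀ i, Monotone (P i)) (htop : ∀ i k, i < k → P i k = nu i)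
    (hcol : ∀ i k, P (i+1) (k+1) ≤ P i k)
    (hcont : ∀ k, ∑ i ∈ Finset.range n, (P i (k+1) - P i k) = mu k)
    (hbal : ∀ i k, ∑ r ∈ Finset.range (i+1), (P r (k+2) - P r (k+1)) ≤
      ∑ r ∈ Finset.range i, (P r (k+1) - P r k)) :
    ∃ T, IsLRTableau lam mu nu T := by
  classical
  have hle : ∀ i k, P i k ≤ nu i := by
    intro i k
    rw [← htop i (i+1+k) (by omega)]
    exact hmono i (by omega)
  let T : ℕ → ℕ → ℕ := fun i c => if InSkew lam nu i c then sInf {k | c < P i k} else 0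
  have hT : ∀ i c k, InSkew lam nu i c → (T i c ≤ k ↔ c < P i k) := by
    intro i c k h
    have hne : {k | c < P i k}.Nonempty := ⟨i+1, by
      show c < P i (i+1)
      rw [htop i (i+1) (by omega)]; exact h.2⟩
    simp only [T, if_pos h]
    constructor
    · intro h2
      have h3 : c < P i (sInf {k | c < P i k}) := Nat.sInf_mem hne
      exact lt_of_lt_of_le h3 (hmono i h2)
    · intro h2
      exact Nat.sInf_le h2
  have hT1 : ∀ i c k, (InSkew lam nu i c ∧ T i c = k + 1) ↔ (P i k ≤ c ∧ c < P i (k+1)) := by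
    intro i c k
    constructor
    · rintro ⟨h1, h2⟩
      have a1 := hT i c k h1
      have a2 := hT i c (k+1) h1
      omega
    · rintro ⟨h1, h2⟩
      have hs : InSkew lam nu i c := ⟨(h0 i ▸ hmono i (Nat.zero_le k)).trans h1,
        lt_of_lt_of_le h2 (hle _ _)⟩
      have a1 := hT i c k hs
      have a2 := hT i c (k+1) hs
      exact ⟨hs, by omega⟩
  have hdrop : ∀ i d m, P (i+d) m ≤ P i m := by
    intro i d m
    induction d with
    | zero => exact le_rfl
    | succ d ih =>
      cases m with
      | zero => simp only [h0]; exact hl.1 _ _ (by omega)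
      | succ m => exact ((hcol (i+d) m).trans (hmono _ (by omega))).trans ih
  have hset : ∀ k, {p : ℕ × ℕ | InSkew lam nu p.1 p.2 ∧ T p.1 p.2 = k + 1} =
      {p : ℕ × ℕ | p.1 < n ∧ P p.1 k ≤ p.2 ∧ p.2 < P p.1 (k+1)} := by
    intro k
    ext p
    simp only [Set.mem_ofPred_eq, hT1]
    constructor
    · intro h
      refine ⟨?_, h⟩
      by_contra hc
      have := hle p.1 (k+1)
      rw [hnz p.1 (by omega)] at this
      omega
    · exact fun h => h.2
  refine ⟨T, hl, hm, hn, ?_, ?_, ?_, ?_, ?_, ?_, ?_⟩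
  · intro i; rw [← h0 i]; exact hle i 0
  · intro i j h; simp only [T, if_neg h]
  · intro i j h
    have := hT i j 0 h
    rw [h0] at this
    have h1 := h.1
    omega
  · intro i j j' h h' hj
    rw [hT i j _ h]
    exact lt_of_le_of_lt hj ((hT i j' _ h').1 le_rfl)
  · intro i i' j h h' hi
    obtain ⟨d, rfl⟩ : ∃ d, i' = i + d + 1 := ⟨i' - i - 1, by omega⟩
    have h1 := (hT _ j _ h').1 le_rfl
    have hpos : T (i+d+1) j ≠ 0 := by
      intro hz
      rw [hz, h0] at h1
      exact absurd h'.1 (by omega)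
    obtain ⟨m, hm⟩ := Nat.exists_eq_succ_of_ne_zero hpos
    rw [hm] at h1 ⊢
    have : T i j ≤ m := by
      rw [hT i j m h]
      exact lt_of_lt_of_le h1 ((hcol (i+d) m).trans (hdrop i d m))
    omega
  · intro k
    rw [hset, (ncard_rows n (fun i => P i k) (fun i => P i (k+1))).2, hcont]
  · intro k q hq hTq
    calc _ ≤ {p : ℕ × ℕ | p.1 < q.1+1 ∧ P p.1 (k+1) ≤ p.2 ∧ p.2 < P p.1 (k+2)}.ncard := by
          apply Set.ncard_le_ncard _ (ncard_rows (q.1+1) (fun i => P i (k+1)) (fun i => P i (k+2))).1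
          rintro p ⟨h1, h2, h3⟩
          refine ⟨?_, (hT1 _ _ (k+1)).1 ⟨h1, h2⟩⟩
          rcases h3 with h3 | h3 <;> omega
      _ = _ := (ncard_rows (q.1+1) (fun i => P i (k+1)) (fun i => P i (k+2))).2
      _ ≤ _ := hbal q.1 k
      _ = _ := (ncard_rows (q.1) (fun i => P i k) (fun i => P i (k+1))).2.symm
      _ ≤ _ := by
          apply Set.ncard_le_ncard
          · rintro p ⟨h1, h2⟩
            have := (hT1 p.1 p.2 k).2 h2
            exact ⟨this.1, this.2, Or.inl h1⟩
          · apply ((ncard_rows (q.1+1) (fun i => P i k) (fun i => P i (k+1))).1).subset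
            rintro p ⟨h1, h2, h3⟩
            refine ⟨?_, (hT1 _ _ k).1 ⟨h1, h2⟩⟩
            rcases h3 with h3 | h3 <;> omega

theorem part_of_dec (n : ℕ) (f : ℕ → ℕ) (hz : ∀ i, n ≤ i → f i = 0)
    (hd : ∀ i, i + 1 < n → f (i+1) ≤ f i) : IsPartition f := by
  refine ⟨fun i j hij => antitone_nat_of_succ_le (f := f) ?_ hij, n, hz⟩
  intro i
  by_cases h : i + 1 < n
  · exact hd i h
  · rw [hz (i+1) (by omega)]; exact Nat.zero_le _

theorem tab_of_hive (n : ℕ) (H : ℕ → ℕ → ℤ) (hH : IsHive n H) (lam mu nu : ℕ → ℕ)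
    (zl : ∀ i, n ≤ i → lam i = 0) (zm : ∀ i, n ≤ i → mu i = 0) (zn : ∀ i, n ≤ i → nu i = 0)
    (el : ∀ i, i < n → H (i+1) 0 = H i 0 + lam i)
    (em : ∀ i, i < n → H n (i+1) = H n i + mu i)
    (en : ∀ i, i < n → H (i+1) (i+1) = H i i + nu i) :
    ∃ T, IsLRTableau lam mu nu T := by
  -- horizontal labels are nonnegative
  have hq' : ∀ d i k, i + d = n → k < i → H i k ≤ H i (k+1) := by
    intro d
    induction d with
    | zero =>
      intro i k hi hk
      simp only [add_zero] at hi
      subst hi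
      have := em k (by omega)
      omega
    | succ d ih =>
      intro i k hi hk
      have h1 := hH.s2 i k hk (by omega)
      have h2 := ih (i+1) (k+1) (by omega) (by omega)
      simp only [add_assoc] at h2
      norm_num at h2
      omega
  have hq : ∀ i k, k < i → i ≤ n → H i k ≤ H i (k+1) := fun i k hk hi =>
    hq' (n - i) i k (by omega) hk
  have hp1 : ∀ i k, k < i → i < n → H (i+1) k - H i k ≤ H (i+1) (k+1) - H i (k+1) := by
    intro i k hk hi
    have := hH.s1 i k hk hi
    omega
  have hp0 : ∀ i k, k ≤ i → i < n → 0 ≤ H (i+1) k - H i k := by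
    intro i k
    induction k with
    | zero => intro _ hi; have := el i hi; omega
    | succ k ih => intro hk hi; exact (ih (by omega) hi).trans (hp1 i k (by omega) hi)
  have hpn : ∀ i, i < n → H (i+1) i - H i i ≤ nu i := by
    intro i hi
    have := hq (i+1) i (by omega) hi
    have := en i hi
    omega
  let p : ℕ → ℕ → ℤ := fun i k => if i < n then if k ≤ i then H (i+1) k - H i k else nu i else 0
  have ppos : ∀ i k, 0 ≤ p i k := by
    intro i k
    simp only [p]
    split_ifs with h1 h2
    · exact hp0 i k h2 h1
    · positivity
    · exact le_rfl
  let P : ℕ → ℕ → ℕ := fun i k => (p i k).toNat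
  have hP : ∀ i k, (P i k : ℤ) = p i k := fun i k => Int.toNat_of_nonneg (ppos i k)
  have hmono : ∀ i, Monotone (P i) := by
    intro i
    apply monotone_nat_of_le_succ
    intro k
    zify
    rw [hP, hP]
    simp only [p]
    by_cases h1 : i < n
    · simp only [if_pos h1]
      rcases lt_trichotomy k i with h | h | h
      · rw [if_pos h.le, if_pos (by omega)]; exact hp1 i k h h1
      · subst h; rw [if_pos le_rfl, if_neg (by omega)]; exact hpn k h1
      · rw [if_neg (by omega), if_neg (by omega)]
    · simp only [if_neg h1]; exact le_rfl
  let Q : ℕ → ℕ → ℤ := fun i k => if k < i then H i (k+1) - H i k else 0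
  have hQ : ∀ i k, i < n → ((P i (k+1) - P i k : ℕ) : ℤ) = Q (i+1) k - Q i k := by
    intro i k hi
    rw [Nat.cast_sub (hmono i (by omega)), hP, hP]
    simp only [p, Q, if_pos hi]
    rcases lt_trichotomy k i with h | h | h
    · rw [if_pos h.le, if_pos (by omega), if_pos (by omega), if_pos h]; ring
    · subst h
      rw [if_pos le_rfl, if_neg (by omega), if_pos (by omega), if_neg (by omega)]
      have := en k hi
      omega
    · rw [if_neg (by omega), if_neg (by omega), if_neg (by omega), if_neg (by omega)]; ring
  have hsum : ∀ i k, i ≤ n → ((∑ r ∈ Finset.range i, (P r (k+1) - P r k) : ℕ) : ℤ) = Q i k := by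
    intro i k hi
    induction i with
    | zero => simp [Q]
    | succ i ih =>
      rw [Finset.sum_range_succ, Nat.cast_add, ih (by omega), hQ i k (by omega)]; ring
  have hz : ∀ i k, n ≤ i → P i k = 0 := by
    intro i k hi
    zify; rw [hP]; simp only [p, if_neg (show ¬ i < n by omega)]
  have pl : IsPartition lam := by
    apply part_of_dec n lam zl
    intro i hi
    have h1 := hH.s1 (i+1) 0 (by omega) (by omega)
    have h2 := hH.s3 i 0 (by omega) (by omega)
    have h3 := el i (by omega)
    have h4 := el (i+1) (by omega)
    simp only [zero_add, add_assoc] at *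
    norm_num at *
    omega
  have pm : IsPartition mu := by
    apply part_of_dec n mu zm
    intro i hi
    obtain ⟨m, rfl⟩ : ∃ m, n = m + 1 := ⟨n-1, by omega⟩
    have h1 := hH.s1 m i (by omega) (by omega)
    have h2 := hH.s2 m i (by omega) (by omega)
    have h3 := em i (by omega)
    have h4 := em (i+1) (by omega)
    simp only [add_assoc] at *
    norm_num at *
    omega
  have pn : IsPartition nu := by
    apply part_of_dec n nu zn
    intro i hi
    have h1 := hH.s2 (i+1) i (by omega) (by omega)
    have h2 := hH.s3 i i (by omega) (by omega)
    have h3 := en i (by omega)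
    have h4 := en (i+1) (by omega)
    simp only [add_assoc] at *
    norm_num at *
    omega
  apply tab_of_P n P lam mu nu pl pm pn zn
  · intro i
    zify; rw [hP]; simp only [p, Nat.zero_le, if_true]
    split_ifs with h
    · have := el i h; omega
    · rw [zl i (by omega)]; rfl
  · exact hmono
  · intro i k hk
    zify; rw [hP]; simp only [p]
    rw [if_neg (show ¬ k ≤ i by omega)]
    split_ifs with h
    · rfl
    · rw [zn i (by omega)]; rfl
  · intro i k
    by_cases h : i + 1 < n
    · zify; rw [hP, hP]; simp only [p]
      rw [if_pos h, if_pos (show i < n by omega)]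
      by_cases hk : k ≤ i
      · rw [if_pos hk, if_pos (by omega)]
        have := hH.s3 i k hk h
        simp only [add_assoc] at *
        norm_num at *
        omega
      · rw [if_neg hk, if_neg (by omega)]
        exact_mod_cast pn.1 i (i+1) (by omega)
    · rw [hz (i+1) _ (by omega)]; exact Nat.zero_le _
  · intro k
    zify
    have := hsum n k le_rfl
    push_cast at this
    rw [this]
    simp only [Q]
    split_ifs with h
    · have := em k h; omega
    · rw [zm k (by omega)]; rfl
  · intro i k
    have key : ∀ i, i < n → ∑ r ∈ Finset.range (i+1), (P r (k+2) - P r (k+1)) ≤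
      ∑ r ∈ Finset.range i, (P r (k+1) - P r k) := by
      intro i h
      have h1 := hsum (i+1) (k+1) h
      have h2 := hsum i k h.le
      have : Q (i+1) (k+1) ≤ Q i k := by
        simp only [Q]
        by_cases hk : k < i
        · rw [if_pos hk, if_pos (by omega)]
          have := hH.s2 i k hk h
          simp only [add_assoc] at *
          norm_num at *
          omega
        · rw [if_neg hk, if_neg (by omega)]
      zify at *
      rw [h1, h2]; exact this
    by_cases h : i < n
    · exact key i h
    · rcases Nat.eq_zero_or_pos n with h0 | h0
      · rw [Finset.sum_eq_zero]
        · exact Nat.zero_le _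
        · intro r _; rw [hz r _ (by omega)]; simp
      · have e1 : ∀ (k i : ℕ), n ≤ i → ∑ r ∈ Finset.range i, (P r (k+1) - P r k) =
            ∑ r ∈ Finset.range n, (P r (k+1) - P r k) := by
          intro k i hi
          symm
          apply Finset.sum_subset (by simpa using hi)
          intro r _ hr
          rw [hz r _ (by simpa using hr)]; simp
        rw [e1 (k+1) (i+1) (by omega), e1 k i (by omega)]
        have h1 := key (n-1) (by omega)
        rw [show n - 1 + 1 = n by omega] at h1
        refine h1.trans ?_
        apply Finset.sum_le_sum_of_subset
        simp

end NLS
end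

section
namespace NLS

theorem fin_bdd {ι : Type*} (g : ι → ℕ) (S : Finset ι) (hS : ∀ x, x ∉ S → g x = 0) :
    {f : ι → ℕ | ∀ x, f x ≤ g x}.Finite := by
  rw [← Set.finite_coe_iff]
  apply Finite.of_injective (β := (x : S) → Fin (g x + 1))
    (fun f x => ⟨f.1 x, Nat.lt_succ_of_le (f.2 x)⟩)
  intro f f' h
  apply Subtype.ext
  funext x
  by_cases hx : x ∈ S
  · have := congrFun h ⟨x, hx⟩
    simpa using this
  · have h1 := f.2 x
    have h2 := f'.2 x
    rw [hS x hx] at h1 h2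
    omega

theorem fin_part (lam : ℕ → ℕ) (h : IsPartition lam) : {f : ℕ → ℕ | ∀ x, f x ≤ lam x}.Finite := by
  obtain ⟨N, hN⟩ := h.2
  exact fin_bdd lam (Finset.range N) (fun x hx => hN x (by simpa using hx))

theorem fin_tab (lam mu nu : ℕ → ℕ) : Finite {T // IsLRTableau lam mu nu T} := by
  by_cases hne : Nonempty {T // IsLRTableau lam mu nu T}
  swap
  · rw [not_nonempty_iff] at hne; infer_instance
  obtain ⟨T0, hT0⟩ := hne
  obtain ⟨M, hM⟩ := hT0.2.1.2
  obtain ⟨N, hN⟩ := hT0.2.2.1.2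
  have hle := hT0.2.2.1.1
  have hsub : ∀ i j, j < nu i → i < N ∧ j < nu 0 := by
    intro i j h
    refine ⟨?_, lt_of_lt_of_le h (hle 0 i (Nat.zero_le _))⟩
    by_contra hc
    rw [hN i (by omega)] at h
    omega
  have hf := fin_bdd (fun p : ℕ × ℕ => if p.1 < N ∧ p.2 < nu 0 then M + 1 else 0)
    (Finset.range N ×ˢ Finset.range (nu 0)) (by
      rintro ⟨i, j⟩ hx
      simp only [Finset.mem_product, Finset.mem_range] at hx
      simp [hx])
  have := Set.finite_coe_iff.2 hf
  refine Finite.of_injective (β := {f : ℕ × ℕ → ℕ | ∀ x, f x ≤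
    (if x.1 < N ∧ x.2 < nu 0 then M + 1 else 0)})
    (fun T => ⟨fun p => T.1 p.1 p.2, ?_⟩) ?_
  · rintro ⟨i, j⟩
    obtain ⟨T, hT⟩ := T
    by_cases hs : InSkew lam nu i j
    · simp only [if_pos (hsub i j hs.2)]
      by_contra hc
      obtain ⟨k, hk⟩ : ∃ k, T i j = k + 1 := ⟨T i j - 1, by omega⟩
      have h1 := hT.2.2.2.2.2.2.2.2.1 k
      rw [hM k (by omega)] at h1
      have hfi : {p : ℕ × ℕ | InSkew lam nu p.1 p.2 ∧ T p.1 p.2 = k + 1}.Finite := by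
        apply (Finset.finite_toSet (Finset.range N ×ˢ Finset.range (nu 0))).subset
        rintro ⟨a, b⟩ ⟨h, _⟩
        simpa using hsub a b h.2
      rw [Set.ncard_eq_zero hfi] at h1
      · have : (i, j) ∈ {p : ℕ × ℕ | InSkew lam nu p.1 p.2 ∧ T p.1 p.2 = k + 1} := ⟨hs, hk⟩
        rw [h1] at this
        exact this
    · simp only [hT.2.2.2.2.1 i j hs]
      exact Nat.zero_le _
  · intro T T' h
    apply Subtype.ext
    funext i j
    have := congrFun (congrArg Subtype.val h) (i, j)
    exact this

theorem lr_ne_zero {lam mu nu : ℕ → ℕ} : lrCoeff lam mu nu ≠ 0 ↔ ∃ T, IsLRTableau lam mu nu T := by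
  have := fin_tab lam mu nu
  unfold lrCoeff
  rw [Nat.card_ne_zero]
  simp [this, nonempty_subtype]

theorem lr_le {lam mu nu : ℕ → ℕ} (h : lrCoeff lam mu nu ≠ 0) :
    IsPartition nu ∧ ∀ i, lam i ≤ nu i := by
  obtain ⟨T, hT⟩ := lr_ne_zero.1 h
  exact ⟨hT.2.2.1, hT.2.2.2.1⟩

theorem ex_of_finsum {α : Type*} {f : α → ℕ} (h : ∑ᶠ x, f x ≠ 0) : ∃ x, f x ≠ 0 := by
  by_contra hc
  push Not at hc
  exact h (by simp [hc])

theorem exists_of_NL {lam mu nu : ℕ → ℕ} (h : NL lam mu nu ≠ 0) :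
    ∃ a b c, lrCoeff a b lam ≠ 0 ∧ lrCoeff b c mu ≠ 0 ∧ lrCoeff c a nu ≠ 0 := by
  unfold NL at h
  obtain ⟨a, ha⟩ := ex_of_finsum h
  obtain ⟨b, hb⟩ := ex_of_finsum ha
  obtain ⟨c, hc⟩ := ex_of_finsum hb
  refine ⟨a, b, c, ?_, ?_, ?_⟩ <;> intro h0 <;> simp [h0] at hc

theorem finsum_ne_zero_of {α : Type*} (f : α → ℕ) (S : Set α) (hS : S.Finite)
    (hf : ∀ x, f x ≠ 0 → x ∈ S) (x : α) (hx : f x ≠ 0) : ∑ᶠ x, f x ≠ 0 := by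
  have h1 : (Function.support f).Finite := hS.subset (fun x hx => hf x hx)
  rw [finsum_eq_sum f h1]
  intro h2
  rw [Finset.sum_eq_zero_iff] at h2
  exact hx (h2 x (by simpa using hx))

theorem NL_of_exists {lam mu nu a b c : ℕ → ℕ} (h1 : lrCoeff a b lam ≠ 0)
    (h2 : lrCoeff b c mu ≠ 0) (h3 : lrCoeff c a nu ≠ 0) : NL lam mu nu ≠ 0 := by
  unfold NL
  apply finsum_ne_zero_of _ {f | ∀ x, f x ≤ lam x} (fin_part _ (lr_le h1).1) _ a
  · apply finsum_ne_zero_of _ {f | ∀ x, f x ≤ mu x} (fin_part _ (lr_le h2).1) _ b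
    · apply finsum_ne_zero_of _ {f | ∀ x, f x ≤ nu x} (fin_part _ (lr_le h3).1) _ c
      · exact mul_ne_zero (mul_ne_zero h1 h2) h3
      · intro c h
        have : lrCoeff c a nu ≠ 0 := right_ne_zero_of_mul h
        exact (lr_le this).2
    · intro b h
      obtain ⟨c, hc⟩ := ex_of_finsum h
      have : lrCoeff b c mu ≠ 0 := right_ne_zero_of_mul (left_ne_zero_of_mul hc)
      exact (lr_le this).2
  · intro a h
    obtain ⟨b, hb⟩ := ex_of_finsum h
    obtain ⟨c, hc⟩ := ex_of_finsum hb
    have : lrCoeff a b lam ≠ 0 := left_ne_zero_of_mul (left_ne_zero_of_mul hc)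
    exact (lr_le this).2

theorem NL_of_MH (n : ℕ) (L : Fin 3 → ℕ → ℕ) (hz : ∀ s i, n ≤ i → L s i = 0)
    (h : MH (R := ℤ) n (fun s i => (L s i : ℤ))) : NL (L 0) (L 1) (L 2) ≠ 0 := by
  obtain ⟨H, hH⟩ := h
  let xi : Fin 3 → ℕ → ℕ := fun s i => if i < n then (H s (i+1) 0 - H s i 0).toNat else 0
  have hxi : ∀ s i, i < n → (xi s i : ℤ) = H s (i+1) 0 - H s i 0 := by
    intro s i hi
    simp only [xi, if_pos hi]
    have := hH.ab s i hi
    omega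
  have key : ∀ s, lrCoeff (xi s) (xi (s+1)) (L s) ≠ 0 := by
    intro s
    rw [lr_ne_zero]
    apply tab_of_hive n (H s) (hH.hive s)
    · intro i hi; simp only [xi, if_neg (show ¬ i < n by omega)]
    · intro i hi; simp only [xi, if_neg (show ¬ i < n by omega)]
    · exact hz s
    · intro i hi; rw [hxi s i hi]; ring
    · intro i hi
      rw [hxi (s+1) i hi, hH.seam s (i+1) hi, hH.seam s i hi.le]; ring
    · intro i hi
      rw [hH.bd s (i+1) hi, hH.bd s i hi.le, Finset.sum_range_succ]
  exact NL_of_exists (key 0) (key 1) (key 2)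

end NLS
end

section
namespace NLS
open Classical in
noncomputable def conj (B : ℕ) (f : ℕ → ℕ) (v : ℕ) : ℕ := ((Finset.range B).filter (fun i => v < f i)).card

theorem last_read (S : Finset (ℕ × ℕ)) (hS : S.Nonempty) : ∃ q ∈ S, ∀ p ∈ S, ReadBefore p q := by
  obtain ⟨q, hq, h⟩ := S.exists_max_image (fun p => toLex (p.1, OrderDual.toDual p.2)) hS
  refine ⟨q, hq, fun p hp => ?_⟩
  have := h p hp
  rw [Prod.Lex.le_iff] at this
  exact this

section
variable {lam mu nu : ℕ → ℕ} {T : ℕ → ℕ → ℕ}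

theorem skew_mono {i r y c : ℕ} (hT : IsLRTableau lam mu nu T)
    (h1 : InSkew lam nu r y) (h2 : InSkew lam nu i c) (hr : r ≤ i) (hy : y ≤ c) :
    InSkew lam nu r c := ⟨h1.1.trans hy, lt_of_lt_of_le h2.2 (hT.2.2.1.1 r i hr)⟩

/-- cells carrying the letter `K+1` -/
def IsL (lam nu : ℕ → ℕ) (T : ℕ → ℕ → ℕ) (K : ℕ) (p : ℕ × ℕ) : Prop :=
  InSkew lam nu p.1 p.2 ∧ T p.1 p.2 = K + 1

open Classical in
theorem ballot' (hT : IsLRTableau lam mu nu T) (R : Finset (ℕ × ℕ))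
    (hR : ∀ i j, InSkew lam nu i j → (i, j) ∈ R) (K : ℕ) (q : ℕ × ℕ) (hq : IsL lam nu T (K+1) q) :
    (R.filter (fun p => IsL lam nu T (K+1) p ∧ ReadBefore p q)).card ≤
    (R.filter (fun p => IsL lam nu T K p ∧ ReadBefore p q)).card := by
  have := hT.2.2.2.2.2.2.2.2.2 K q hq.1 hq.2
  rw [← Set.ncard_coe_finset, ← Set.ncard_coe_finset]
  convert this using 2 <;> ext p <;> rw [Finset.mem_coe, Finset.mem_filter] <;> constructor
  · rintro ⟨_, ⟨h1, h2⟩, h3⟩; exact ⟨h1, h2, h3⟩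
  · rintro ⟨h1, h2, h3⟩; exact ⟨hR _ _ h1, ⟨h1, h2⟩, h3⟩
  · rintro ⟨_, ⟨h1, h2⟩, h3⟩; exact ⟨h1, h2, h3⟩
  · rintro ⟨h1, h2, h3⟩; exact ⟨hR _ _ h1, ⟨h1, h2⟩, h3⟩

open Classical in
theorem ballot_rows (hT : IsLRTableau lam mu nu T) (R : Finset (ℕ × ℕ))
    (hR : ∀ i j, InSkew lam nu i j → (i, j) ∈ R) (K i : ℕ) :
    (R.filter (fun p => IsL lam nu T (K+1) p ∧ p.1 < i + 1)).card ≤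
    (R.filter (fun p => IsL lam nu T K p ∧ p.1 < i)).card := by
  rcases (R.filter (fun p => IsL lam nu T (K+1) p ∧ p.1 < i + 1)).eq_empty_or_nonempty with h | h
  · rw [h]; simp
  · obtain ⟨q, hq, hl⟩ := last_read _ h
    rw [Finset.mem_filter] at hq
    refine le_trans (Finset.card_le_card ?_) ((ballot' hT R hR K q hq.2.1).trans (Finset.card_le_card ?_))
    · intro p hp
      have := hl p hp
      rw [Finset.mem_filter] at hp ⊢
      exact ⟨hp.1, hp.2.1, this⟩
    · intro p hp
      rw [Finset.mem_filter] at hp ⊢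
      refine ⟨hp.1, hp.2.1, ?_⟩
      rcases hp.2.2 with h3 | ⟨h3, h4⟩
      · omega
      · have h5 := hT.2.2.2.2.2.2.1 q.1 q.2 p.2 hq.2.1.1 (h3 ▸ hp.2.1.1) h4
        rw [hq.2.1.2, ← h3, hp.2.1.2] at h5
        omega

open Classical in
theorem col_ballot (hT : IsLRTableau lam mu nu T) (R : Finset (ℕ × ℕ))
    (hR : ∀ i j, InSkew lam nu i j → (i, j) ∈ R) (K j : ℕ) :
    (R.filter (fun p => IsL lam nu T (K+1) p ∧ j ≤ p.2)).card ≤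
    (R.filter (fun p => IsL lam nu T K p ∧ j ≤ p.2)).card := by
  have hrow := hT.2.2.2.2.2.2.1
  have hcol := hT.2.2.2.2.2.2.2.1
  rcases (R.filter (fun p => IsL lam nu T (K+1) p ∧ j ≤ p.2)).eq_empty_or_nonempty with h | h
  · rw [h]; simp
  obtain ⟨⟨i, c⟩, hq, hl⟩ := last_read _ h
  rw [Finset.mem_filter] at hq
  obtain ⟨-, hqL, hjc⟩ := hq
  simp only at hjc
  have hqT : T i c = K + 2 := hqL.2
  have hqS : InSkew lam nu i c := hqL.1
  by_cases hX : ∃ r y, y < j ∧ r < i ∧ IsL lam nu T K (r, y)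
  · -- every such cell lies in row i - 1
    have hr : ∀ r y, y < j → r < i → IsL lam nu T K (r, y) → r + 1 = i := by
      intro r y hy hri hL
      by_contra hne
      have a1 := skew_mono hT hL.1 hqS hri.le (by simp only; omega)
      have a2 : InSkew lam nu (r+1) c := ⟨(hT.1.1 r (r+1) (by omega)).trans a1.1,
        lt_of_lt_of_le hqS.2 (hT.2.2.1.1 (r+1) i (by omega))⟩
      have b1 := hrow r y c hL.1 a1 (by omega)
      have b2 := hcol r (r+1) c a1 a2 (by omega)
      have b3 := hcol (r+1) i c a2 hqS (by omega)
      have b4 : T r y = K + 1 := hL.2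
      omega
    obtain ⟨r, y, hy, hri, hL⟩ := hX
    have e := hr r y hy hri hL
    subst e
    have hLT : T r y = K + 1 := hL.2
    have hA : (R.filter (fun p => IsL lam nu T (K+1) p ∧ j ≤ p.2)).card ≤
        (R.filter (fun p => IsL lam nu T (K+1) p ∧ p.1 < r + 1)).card +
        (R.filter (fun p => IsL lam nu T (K+1) p ∧ p.1 = r + 1 ∧ c ≤ p.2)).card := by
      refine le_trans (Finset.card_le_card ?_) (Finset.card_union_le _ _)
      intro p hp
      have h1 := hl p hp
      simp only [Finset.mem_filter, Finset.mem_union] at hp ⊢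
      rcases h1 with h1 | h1
      · left; exact ⟨hp.1, hp.2.1, h1⟩
      · right; exact ⟨hp.1, hp.2.1, h1⟩
    have hB : (R.filter (fun p => IsL lam nu T (K+1) p ∧ p.1 = r + 1 ∧ c ≤ p.2)).card ≤
        (R.filter (fun p => IsL lam nu T K p ∧ p.1 = r ∧ j ≤ p.2)).card := by
      apply Finset.card_le_card_of_injOn (fun p => (r, p.2))
      · rintro ⟨a, b⟩ hp
        simp only [Finset.coe_filter] at hp ⊢
        obtain ⟨-, ⟨h1, h2⟩, h3, h4⟩ := hp
        simp only at h1 h2 h3 h4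
        subst h3
        have a1 := skew_mono hT hL.1 h1 (by simp) (by simp only; omega)
        have b1 := hrow r y b hL.1 a1 (by omega)
        have b2 := hcol r (r+1) b a1 h1 (by omega)
        exact ⟨hR _ _ a1, ⟨a1, by simp only; omega⟩, rfl, by simp only; omega⟩
      · rintro ⟨a, b⟩ hp ⟨a', b'⟩ hp' hh
        simp only [Finset.coe_filter] at hp hp'
        have h1 := hp.2.2.1
        have h2 := hp'.2.2.1
        simp at hh h1 h2
        simp [h1, h2, hh]
    have hC : (R.filter (fun p => IsL lam nu T K p ∧ p.1 < r)).card +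
        (R.filter (fun p => IsL lam nu T K p ∧ p.1 = r ∧ j ≤ p.2)).card ≤
        (R.filter (fun p => IsL lam nu T K p ∧ j ≤ p.2)).card := by
      rw [← Finset.card_union_of_disjoint]
      · apply Finset.card_le_card
        intro p hp
        simp only [Finset.mem_filter, Finset.mem_union] at hp ⊢
        rcases hp with hp | hp
        · refine ⟨hp.1, hp.2.1, ?_⟩
          by_contra hc
          have := hr p.1 p.2 (by omega) (by omega) hp.2.1
          omega
        · exact ⟨hp.1, hp.2.1, hp.2.2.2⟩
      · rw [Finset.disjoint_left]
        intro p hp hp'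
        simp only [Finset.mem_filter] at hp hp'
        omega
    have hD := ballot_rows hT R hR K r
    omega
  · push Not at hX
    refine le_trans (Finset.card_le_card ?_) ((ballot' hT R hR K (i, c) hqL).trans (Finset.card_le_card ?_))
    · intro p hp
      have := hl p hp
      rw [Finset.mem_filter] at hp ⊢
      exact ⟨hp.1, hp.2.1, this⟩
    · intro p hp
      rw [Finset.mem_filter] at hp ⊢
      refine ⟨hp.1, hp.2.1, ?_⟩
      by_contra hc
      rcases hp.2.2 with h3 | ⟨h3, h4⟩
      · exact hX p.1 p.2 (by omega) h3 hp.2.1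
      · simp only at h4; omega
end

end NLS
end

section
namespace NLS

open Classical in
theorem hive_of_tab {lam mu nu : ℕ → ℕ} {T : ℕ → ℕ → ℕ} (B N : ℕ) (hT : IsLRTableau lam mu nu T)
    (zm : ∀ i, B ≤ i → mu i = 0) (zn : ∀ i, B ≤ i → nu i = 0) (hN : nu 0 ≤ N) :
    ∃ H : ℕ → ℕ → ℤ, IsHive N H ∧ H 0 0 = 0 ∧
      (∀ i, i < N → H (i+1) 0 = H i 0 + conj B mu i) ∧
      (∀ i, i < N → H N (i+1) = H N i + conj B lam i) ∧
      (∀ i, i < N → H (i+1) (i+1) = H i i + conj B nu i) := by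
  have hrow := hT.2.2.2.2.2.2.1
  have hcol := hT.2.2.2.2.2.2.2.1
  have hpos := hT.2.2.2.2.2.1
  have hcont := hT.2.2.2.2.2.2.2.2.1
  set R : Finset (ℕ × ℕ) := Finset.range B ×ˢ Finset.range N with hRdef
  have hSB : ∀ i j, InSkew lam nu i j → i < B ∧ j < N := by
    intro i j h
    constructor
    · by_contra hc
      have := h.2
      rw [zn i (by omega)] at this
      omega
    · exact lt_of_lt_of_le h.2 ((hT.2.2.1.1 0 i (Nat.zero_le _)).trans hN)
  have hR : ∀ i j, InSkew lam nu i j → (i, j) ∈ R := by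
    intro i j h
    simpa [hRdef] using hSB i j h
  let m : ℕ → ℕ → ℕ := fun l j => (R.filter (fun p => IsL lam nu T l p ∧ j ≤ p.2)).card
  let o : ℕ → ℕ → ℕ := fun l j => (R.filter (fun p => IsL lam nu T l p ∧ p.2 = j)).card
  have hm0 : ∀ l, m l 0 = mu l := by
    intro l
    simp only [m]
    rw [← hcont l, ← Set.ncard_coe_finset]
    congr 1
    ext p
    rw [Finset.mem_coe, Finset.mem_filter]
    exact ⟨fun h => h.2.1, fun h => ⟨hR _ _ h.1, h, Nat.zero_le _⟩⟩
  have hmo : ∀ l j, m l j = m l (j+1) + o l j := by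
    intro l j
    simp only [m, o]
    rw [← Finset.card_union_of_disjoint]
    · congr 1
      ext p
      simp only [Finset.mem_union, Finset.mem_filter]
      constructor
      · rintro ⟨h1, h2, h3⟩
        rcases h3.lt_or_eq with h | h
        · exact Or.inl ⟨h1, h2, h⟩
        · exact Or.inr ⟨h1, h2, h.symm⟩
      · rintro (⟨h1, h2, h3⟩ | ⟨h1, h2, h3⟩)
        · exact ⟨h1, h2, by omega⟩
        · exact ⟨h1, h2, by omega⟩
    · rw [Finset.disjoint_left]
      intro p hp hp'
      simp only [Finset.mem_filter] at hp hp'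
      omega
  have ho1 : ∀ l j, o l j ≤ 1 := by
    intro l j
    apply Finset.card_le_one.2
    rintro ⟨a, b⟩ hp ⟨a', b'⟩ hp'
    rw [Finset.mem_filter] at hp hp'
    obtain ⟨-, ⟨h1, h2⟩, h3⟩ := hp
    obtain ⟨-, ⟨h1', h2'⟩, h3'⟩ := hp'
    simp only at h1 h2 h3 h1' h2' h3'
    subst h3 h3'
    rcases lt_trichotomy a a' with h | h | h
    · have := hcol _ _ _ h1 h1' h; omega
    · rw [h]
    · have := hcol _ _ _ h1' h1 h; omega
  have hlB : ∀ i j, InSkew lam nu i j → T i j - 1 < B := by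
    intro i j h
    by_contra hc
    have h1 := hpos i j h
    have h2 : m (T i j - 1) 0 ≠ 0 := by
      apply Finset.card_ne_zero_of_mem (a := (i, j))
      rw [Finset.mem_filter]
      exact ⟨hR _ _ h, ⟨h, by simp only; omega⟩, Nat.zero_le _⟩
    rw [hm0, zm _ (by omega)] at h2
    exact h2 rfl
  have hsum : ∀ (Q : ℕ → Prop) [DecidablePred Q] (c : ℕ), ∑ l ∈ (Finset.range B).filter Q, o l c =
      ((Finset.range B).filter (fun i => InSkew lam nu i c ∧ Q (T i c - 1))).card := by
    intro Q _ c
    rw [Finset.card_eq_sum_card_fiberwise (f := fun i => T i c - 1)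
      (t := (Finset.range B).filter Q)]
    · apply Finset.sum_congr rfl
      intro l hl
      rw [Finset.mem_filter] at hl
      refine Finset.card_bij' (fun p _ => p.1) (fun i _ => (i, c)) ?_ ?_ ?_ ?_
      · rintro ⟨a, b⟩ hp
        rw [Finset.mem_filter] at hp
        obtain ⟨-, ⟨h1, h2⟩, h3⟩ := hp
        simp only at h1 h2 h3
        subst h3
        simp only [Finset.mem_filter, Finset.mem_range]
        rw [h2]
        exact ⟨⟨(hSB _ _ h1).1, h1, hl.2⟩, rfl⟩
      · intro i hi
        simp only [Finset.mem_filter, Finset.mem_range] at hi ⊢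
        have := hpos i c hi.1.2.1
        exact ⟨hR _ _ hi.1.2.1, ⟨hi.1.2.1, by simp only; omega⟩, trivial⟩
      · rintro ⟨a, b⟩ hp
        rw [Finset.mem_filter] at hp
        have := hp.2.2
        simp only at this
        simp [this]
      · intro i hi; rfl
    · intro i hi
      simp only [Finset.coe_filter, Finset.mem_range] at hi ⊢
      exact ⟨hlB _ _ hi.2.1, hi.2.2⟩
  have hconj : ∀ c, ∑ l ∈ Finset.range B, o l c + conj B lam c = conj B nu c := by
    intro c
    have := hsum (fun _ => True) c
    rw [Finset.filter_true] at this
    rw [this, conj, conj, ← Finset.card_union_of_disjoint]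
    · congr 1
      ext i
      simp only [Finset.mem_union, Finset.mem_filter, Finset.mem_range]
      simp only [InSkew]
      have := hT.2.2.2.1 i
      constructor
      · rintro (⟨h1, h2⟩ | ⟨h1, h2⟩)
        · exact ⟨h1, by omega⟩
        · exact ⟨h1, by omega⟩
      · rintro ⟨h1, h2⟩
        by_cases h : lam i ≤ c
        · exact Or.inl ⟨h1, by simp [h, h2]⟩
        · exact Or.inr ⟨h1, by omega⟩
    · rw [Finset.disjoint_left]
      intro p hp hp'
      simp only [Finset.mem_filter] at hp hp'
      simp only [InSkew] at hp hp'
      omega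
  have hmN' : ∀ d l k, k + d = N → m l k ≤ d := by
    intro d
    induction d with
    | zero =>
      intro l k hk
      have : m l k = 0 := by
        apply Finset.card_eq_zero.2
        apply Finset.filter_eq_empty_iff.2
        rintro ⟨a, b⟩ - ⟨h1, h2⟩
        have := (hSB _ _ h1.1).2
        simp only at h2 this
        omega
      omega
    | succ d ih =>
      intro l k hk
      have h1 := hmo l k
      have h2 := ho1 l k
      have h3 := ih l (k+1) (by omega)
      omega
  have hanti : ∀ j, Antitone (fun l => m l j) := fun j =>
    antitone_nat_of_succ_le (fun l => col_ballot hT R hR l j)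
  let S : ℕ → ℕ → ℤ := fun k d => ∑ l ∈ Finset.range B, (min (m l k) d : ℤ)
  let D : ℕ → ℤ := fun k => ∑ c ∈ Finset.range k, (conj B nu c : ℤ)
  have hD : ∀ k, D (k+1) = D k + conj B nu k := fun k => Finset.sum_range_succ _ _
  refine ⟨fun i k => S k (i-k) + D k, ⟨?_, ?_, ?_⟩, ?_, ?_, ?_, ?_⟩
  · intro i k hk hi
    obtain ⟨d, rfl⟩ : ∃ d, i = k + (d + 1) := ⟨i - k - 1, by omega⟩
    have e1 : k + (d+1) - (k+1) = d := by omega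
    have e2 : k + (d+1) + 1 - k = d + 2 := by omega
    have e3 : k + (d+1) + 1 - (k + 1) = d + 1 := by omega
    have e4 : k + (d+1) - k = d + 1 := by omega
    simp only [e1, e2, e3, e4]
    have : S (k+1) d + S k (d+2) ≤ S (k+1) (d+1) + S k (d+1) := by
      simp only [S]
      rw [← Finset.sum_add_distrib, ← Finset.sum_add_distrib]
      apply Finset.sum_le_sum
      intro l _
      have h1 := hmo l k
      have h2 := ho1 l k
      omega
    linarith
  · intro i k hk hi
    obtain ⟨d, rfl⟩ : ∃ d, i = k + (d + 1) := ⟨i - k - 1, by omega⟩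
    have e1 : k + (d+1) - k = d + 1 := by omega
    have e2 : k + (d+1) + 1 - (k + 2) = d := by omega
    have e3 : k + (d+1) - (k + 1) = d := by omega
    have e4 : k + (d+1) + 1 - (k+1) = d + 1 := by omega
    simp only [e1, e2, e3, e4]
    have hd := hD k
    have hd' : D (k+2) = D (k+1) + conj B nu (k+1) := hD (k+1)
    have hs : ∀ k d, S k d = S (k+1) d +
        (((Finset.range B).filter (fun i => InSkew lam nu i k ∧ m (T i k - 1) k ≤ d)).card : ℤ) := by
      intro k d
      rw [← hsum (fun l => m l k ≤ d) k, Finset.sum_filter]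
      push_cast
      simp only [S]
      rw [← Finset.sum_add_distrib]
      apply Finset.sum_congr rfl
      intro l _
      have h1 := hmo l k
      have h2 := ho1 l k
      split_ifs <;> omega
    have h1 := hs k (d+1)
    have h2 := hs (k+1) d
    have key : ((Finset.range B).filter
        (fun i => InSkew lam nu i k ∧ m (T i k - 1) k ≤ d+1)).card + conj B nu (k+1) ≤
        ((Finset.range B).filter
        (fun i => InSkew lam nu i (k+1) ∧ m (T i (k+1) - 1) (k+1) ≤ d)).card + conj B nu k := by
      have c1 : conj B nu k = conj B nu (k+1) +
          ((Finset.range B).filter (fun i => nu i = k + 1)).card := by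
        rw [conj, conj, ← Finset.card_union_of_disjoint]
        · congr 1
          ext i
          simp only [Finset.mem_union, Finset.mem_filter]
          constructor
          · rintro ⟨a, b⟩
            rcases (show k + 1 ≤ nu i from b).lt_or_eq with h | h
            · exact Or.inl ⟨a, h⟩
            · exact Or.inr ⟨a, h.symm⟩
          · rintro (⟨a, b⟩ | ⟨a, b⟩)
            · exact ⟨a, by omega⟩
            · exact ⟨a, by omega⟩
        · rw [Finset.disjoint_left]
          intro p hp hp'
          simp only [Finset.mem_filter] at hp hp'
          omega
      have c2 : ((Finset.range B).filter
        (fun i => InSkew lam nu i k ∧ m (T i k - 1) k ≤ d+1)).card ≤ ((Finset.range B).filter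
        (fun i => InSkew lam nu i (k+1) ∧ m (T i (k+1) - 1) (k+1) ≤ d)).card +
          ((Finset.range B).filter (fun i => nu i = k + 1)).card := by
        refine le_trans (Finset.card_le_card ?_) (Finset.card_union_le _ _)
        intro i hi
        simp only [Finset.mem_union, Finset.mem_filter] at hi ⊢
        obtain ⟨g1, g2, g3⟩ := hi
        rcases (show k + 1 ≤ nu i from g2.2).lt_or_eq with h | h
        · left
          have hs' : InSkew lam nu i (k+1) := ⟨g2.1.trans (by omega), h⟩
          refine ⟨g1, hs', ?_⟩
          have r1 := hrow i k (k+1) g2 hs' (by omega)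
          have r2 : m (T i (k+1) - 1) (k+1) ≤ m (T i k - 1) (k+1) := hanti (k+1) (by omega)
          have r3 := hmo (T i k - 1) k
          have r4 : o (T i k - 1) k ≠ 0 := by
            apply Finset.card_ne_zero_of_mem (a := (i, k))
            rw [Finset.mem_filter]
            have := hpos i k g2
            exact ⟨hR _ _ g2, ⟨g2, by simp only; omega⟩, rfl⟩
          omega
        · right; exact ⟨g1, h.symm⟩
      omega
    rw [show k + 1 + 1 = k + 2 from rfl] at h2
    omega
  · intro i k hk hi
    obtain ⟨d, rfl⟩ : ∃ d, i = k + d := ⟨i - k, by omega⟩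
    have e1 : k + d - k = d := by omega
    have e2 : k + d + 2 - (k + 1) = d + 1 := by omega
    have e3 : k + d + 1 - k = d + 1 := by omega
    have e4 : k + d + 1 - (k+1) = d := by omega
    simp only [e1, e2, e3, e4]
    have : S k d + S (k+1) (d+1) ≤ S k (d+1) + S (k+1) d := by
      simp only [S]
      rw [← Finset.sum_add_distrib, ← Finset.sum_add_distrib]
      apply Finset.sum_le_sum
      intro l _
      have h1 := hmo l k
      omega
    linarith
  · simp [S, D]
  · intro i hi
    simp only [S, D, Nat.sub_zero, Finset.range_zero, Finset.sum_empty, add_zero]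
    rw [conj, Finset.card_filter]
    push_cast
    rw [← Finset.sum_add_distrib]
    apply Finset.sum_congr rfl
    intro l _
    rw [hm0]
    split_ifs <;> omega
  · intro i hi
    have h1 : ∀ k, k ≤ N → S k (N-k) = ∑ l ∈ Finset.range B, (m l k : ℤ) := by
      intro k hk
      simp only [S]
      apply Finset.sum_congr rfl
      intro l _
      have := hmN' (N-k) l k (by omega)
      omega
    simp only
    rw [h1 _ (by omega), h1 _ (by omega), hD, ← hconj]
    simp_rw [fun l => hmo l i]
    push_cast
    rw [Finset.sum_add_distrib]
    ring
  · intro i hi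
    simp only [Nat.sub_self, hD]
    have : ∀ k, S k 0 = 0 := by
      intro k
      simp [S]
    simp only [this]; ring
end NLS
end

section
namespace NLS

theorem MH_of_NL (B N : ℕ) (lam mu nu : ℕ → ℕ) (zl : ∀ i, B ≤ i → lam i = 0)
    (zm : ∀ i, B ≤ i → mu i = 0) (zn : ∀ i, B ≤ i → nu i = 0)
    (hl : lam 0 ≤ N) (hm : mu 0 ≤ N) (hn : nu 0 ≤ N) (h : NL lam mu nu ≠ 0) :
    MH (R := ℤ) N (fun s i => (conj B ((![lam, nu, mu] : Fin 3 → ℕ → ℕ) s) i : ℤ)) := by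
  obtain ⟨a, b, c, h1, h2, h3⟩ := exists_of_NL h
  have za : ∀ i, B ≤ i → a i = 0 := fun i hi =>
    Nat.le_zero.1 (((lr_le h1).2 i).trans (zl i hi).le)
  have zb : ∀ i, B ≤ i → b i = 0 := fun i hi =>
    Nat.le_zero.1 (((lr_le h2).2 i).trans (zm i hi).le)
  have zc : ∀ i, B ≤ i → c i = 0 := fun i hi =>
    Nat.le_zero.1 (((lr_le h3).2 i).trans (zn i hi).le)
  obtain ⟨T1, h1⟩ := lr_ne_zero.1 h1
  obtain ⟨T2, h2⟩ := lr_ne_zero.1 h2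
  obtain ⟨T3, h3⟩ := lr_ne_zero.1 h3
  have key : ∀ s : Fin 3, ∃ H : ℕ → ℕ → ℤ, IsHive N H ∧ H 0 0 = 0 ∧
      (∀ i, i < N → H (i+1) 0 = H i 0 + conj B ((![b, a, c] : Fin 3 → ℕ → ℕ) s) i) ∧
      (∀ i, i < N → H N (i+1) = H N i + conj B ((![b, a, c] : Fin 3 → ℕ → ℕ) (s+1)) i) ∧
      (∀ i, i < N → H (i+1) (i+1) = H i i + conj B ((![lam, nu, mu] : Fin 3 → ℕ → ℕ) s) i) := by
    intro s
    fin_cases s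
    · exact hive_of_tab B N h1 zb zl hl
    · exact hive_of_tab B N h3 za zn hn
    · exact hive_of_tab B N h2 zc zm hm
  choose H hH h0 hA hB hC using key
  refine ⟨H, hH, ?_, ?_, ?_⟩
  · intro s k
    induction k with
    | zero => intro _; rw [h0]; ring
    | succ k ih =>
      intro hk
      rw [hB s k hk, ih (by omega), hA (s+1) k hk]; ring
  · intro s k
    induction k with
    | zero => intro _; rw [h0]; simp
    | succ k ih =>
      intro hk
      rw [hC s k hk, ih (by omega), Finset.sum_range_succ]
  · intro s i hi
    rw [hA s i hi]
    simp

theorem conj_gt (B : ℕ) (f : ℕ → ℕ) (hf : Antitone f) (hz : ∀ i, B ≤ i → f i = 0) (i v : ℕ) :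
    i < conj B f v ↔ v < f i := by
  unfold conj
  constructor
  · intro h
    by_contra hc
    have : (Finset.range B).filter (fun j => v < f j) ⊆ Finset.range i := by
      intro j hj
      rw [Finset.mem_filter] at hj
      rw [Finset.mem_range]
      by_contra hji
      have := hf (show i ≤ j by omega)
      omega
    have := Finset.card_le_card this
    rw [Finset.card_range] at this
    refine absurd h ?_
    rw [not_lt]
    convert this
  · intro h
    have : Finset.range (i+1) ⊆ (Finset.range B).filter (fun j => v < f j) := by
      intro j hj
      rw [Finset.mem_range] at hj
      rw [Finset.mem_filter, Finset.mem_range]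
      have := hf (show j ≤ i by omega)
      refine ⟨?_, by omega⟩
      by_contra hc
      have := hz j (by omega)
      omega
    have := Finset.card_le_card this
    rw [Finset.card_range] at this
    refine lt_of_lt_of_le (Nat.lt_succ_self i) ?_
    convert this

theorem conj_le (B : ℕ) (f : ℕ → ℕ) (v : ℕ) : conj B f v ≤ B := by
  unfold conj
  exact (Finset.card_filter_le _ _).trans (by simp)

theorem conj_anti (B : ℕ) (f : ℕ → ℕ) : Antitone (conj B f) := by
  intro v w hvw
  unfold conj
  apply Finset.card_le_card
  intro i hi
  rw [Finset.mem_filter] at hi ⊢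
  exact ⟨hi.1, by omega⟩

theorem conj_zero (B N : ℕ) (f : ℕ → ℕ) (hf : Antitone f) (h : f 0 ≤ N) (v : ℕ) (hv : N ≤ v) :
    conj B f v = 0 := by
  unfold conj
  rw [Finset.card_eq_zero, Finset.filter_eq_empty_iff]
  intro i _
  have := hf (Nat.zero_le i)
  omega

theorem conj_conj (B N : ℕ) (f : ℕ → ℕ) (hf : Antitone f) (hz : ∀ i, B ≤ i → f i = 0)
    (h : f 0 ≤ N) (i : ℕ) : conj N (conj B f) i = f i := by
  have hi := hf (Nat.zero_le i)
  rw [conj]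
  simp only [conj_gt B f hf hz]
  have : (Finset.range N).filter (fun v => v < f i) = Finset.range (f i) := by
    ext v
    simp only [Finset.mem_filter, Finset.mem_range]
    omega
  calc _ = ((Finset.range N).filter (fun v => v < f i)).card := by congr!
    _ = _ := by rw [this, Finset.card_range]

theorem conj_mul (B t : ℕ) (ht : 0 < t) (f : ℕ → ℕ) (v : ℕ) :
    conj B (fun i => t * f i) v = conj B f (v / t) := by
  unfold conj
  congr 1
  ext i
  simp only [Finset.mem_filter, Nat.div_lt_iff_lt_mul ht, mul_comm]

theorem sum_conj (B N : ℕ) (f : ℕ → ℕ) (h : ∀ i, f i ≤ N) :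
    ∑ v ∈ Finset.range N, conj B f v = ∑ i ∈ Finset.range B, f i := by
  unfold conj
  simp_rw [Finset.card_filter]
  rw [Finset.sum_comm]
  apply Finset.sum_congr rfl
  intro i _
  rw [← Finset.card_filter]
  have : (Finset.range N).filter (fun v => v < f i) = Finset.range (f i) := by
    ext v
    have := h i
    simp only [Finset.mem_filter, Finset.mem_range]
    omega
  calc _ = ((Finset.range N).filter (fun v => v < f i)).card := by congr!
    _ = _ := by rw [this, Finset.card_range]

theorem MH_even (n : ℕ) (L : Fin 3 → ℕ → ℤ) (h : MH n L) :
    Even (∑ s, ∑ i ∈ Finset.range n, L s i) := by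
  obtain ⟨H, hH⟩ := h
  have : ∀ s, ∑ i ∈ Finset.range n, L s i = H s n 0 + H (s+1) n 0 := by
    intro s
    rw [← hH.bd s n le_rfl, hH.seam s n le_rfl]
  simp only [this, Fin.sum_univ_three]
  refine ⟨H 0 n 0 + H 1 n 0 + H 2 n 0, ?_⟩
  have e1 : (0 : Fin 3) + 1 = 1 := rfl
  have e2 : (1 : Fin 3) + 1 = 2 := rfl
  have e3 : (2 : Fin 3) + 1 = 0 := rfl
  rw [e1, e2, e3]; ring

theorem sizeP_eq (n : ℕ) (f : ℕ → ℕ) (h : ∀ i, n ≤ i → f i = 0) :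
    sizeP f = ∑ i ∈ Finset.range n, f i := by
  unfold sizeP
  apply finsum_eq_sum_of_support_subset
  intro i hi
  simp only [Function.mem_support] at hi
  simp only [Finset.coe_range, Set.mem_Iio]
  by_contra hc
  exact hi (h i (by omega))

theorem assemble
    (P4 : ∀ (N : ℕ) (L : Fin 3 → ℕ → ℕ), (∀ s, Antitone (L s)) →
      MH (R := ℝ) N (fun s i => (L s i : ℝ)) →
      ∃ k : ℕ, MH (R := ℤ) N (fun s i => ((2^k * L s i : ℕ) : ℤ)))
    (P5 : ∀ (N : ℕ) (L : Fin 3 → ℕ → ℤ), Even (∑ s, ∑ i ∈ Finset.range N, L s i) →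
      MH (2*N) (fun s i => L s (i/2)) → MH N L)
    (n : ℕ) (lam mu nu : ℕ → ℕ)
    (hl : MemParN n lam) (hm : MemParN n mu) (hv : MemParN n nu) :
    NL lam mu nu ≠ 0 ↔
      Even (sizeP lam + sizeP mu + sizeP nu) ∧
      ∃ t : ℕ, 0 < t ∧
        NL (fun i => t * lam i) (fun i => t * mu i) (fun i => t * nu i) ≠ 0 := by
  have al : Antitone lam := fun i j h => hl.1.1 i j h
  have am : Antitone mu := fun i j h => hm.1.1 i j h
  have av : Antitone nu := fun i j h => hv.1.1 i j h
  obtain ⟨N, nl, nm, nv⟩ : ∃ N, lam 0 ≤ N ∧ mu 0 ≤ N ∧ nu 0 ≤ N :=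
    ⟨lam 0 + mu 0 + nu 0, by omega, by omega, by omega⟩
  rw [sizeP_eq n lam hl.2, sizeP_eq n mu hm.2, sizeP_eq n nu hv.2]
  constructor
  · intro h
    refine ⟨?_, 1, one_pos, by simpa using h⟩
    have h1 := MH_even _ _ (MH_of_NL n N lam mu nu hl.2 hm.2 hv.2 nl nm nv h)
    have e : ∀ f : ℕ → ℕ, Antitone f → f 0 ≤ N →
        ∑ i ∈ Finset.range N, (conj n f i : ℤ) = ((∑ i ∈ Finset.range n, f i : ℕ) : ℤ) := by
      intro f hf h0
      rw [← sum_conj n N f (fun i => (hf (Nat.zero_le i)).trans h0)]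
      push_cast; rfl
    simp only [Fin.sum_univ_three, Matrix.cons_val_zero, Matrix.cons_val_one, Matrix.cons_val] at h1
    rw [e _ al nl, e _ am nm, e _ av nv] at h1
    have h2 : Even ((∑ i ∈ Finset.range n, lam i) + (∑ i ∈ Finset.range n, nu i) +
      (∑ i ∈ Finset.range n, mu i)) := by exact_mod_cast h1
    rw [show ∀ a b c : ℕ, a + b + c = a + c + b by intros; ring]
    exact h2
  · rintro ⟨hev, t, ht, h⟩
    have h1 := MH_of_NL n (t*N) (fun i => t * lam i) (fun i => t * mu i) (fun i => t * nu i) (fun i hi => by simp [hl.2 i hi])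
      (fun i hi => by simp [hm.2 i hi]) (fun i hi => by simp [hv.2 i hi])
      (Nat.mul_le_mul_left _ nl) (Nat.mul_le_mul_left _ nm) (Nat.mul_le_mul_left _ nv) h
    let L : Fin 3 → ℕ → ℕ := ![conj n lam, conj n nu, conj n mu]
    have h2 : MH (R := ℤ) (t*N) (fun s i => (L s (i/t) : ℤ)) := by
      convert h1 using 3 with s i
      fin_cases s
      · exact congrArg (Nat.cast : ℕ → ℤ) (conj_mul n t ht lam i).symm
      · exact congrArg (Nat.cast : ℕ → ℤ) (conj_mul n t ht nu i).symm
      · exact congrArg (Nat.cast : ℕ → ℤ) (conj_mul n t ht mu i).symm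
    have h3 := coarsen N t ht L h2
    obtain ⟨k, h4⟩ := P4 N L (by
      intro s; fin_cases s <;> exact conj_anti _ _) h3
    have hp : 0 < 2^k := by positivity
    have h5 := NL_of_MH N (fun s i => 2^k * L s i) (by
      intro s i hi
      have : L s i = 0 := by
        fin_cases s
        · exact conj_zero n N lam al nl i hi
        · exact conj_zero n N nu av nv i hi
        · exact conj_zero n N mu am nm i hi
      simp [this]) h4
    have hLN : ∀ s i, N ≤ i → L s i = 0 := by
      intro s i hi
      fin_cases s
      · exact conj_zero n N lam al nl i hi
      · exact conj_zero n N nu av nv i hi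
      · exact conj_zero n N mu am nm i hi
    have hLn : ∀ s i, L s i ≤ n := by
      intro s i
      fin_cases s <;> exact conj_le n _ i
    have h6 := MH_of_NL N (2^k*n) (fun i => 2^k * L 0 i) (fun i => 2^k * L 1 i) (fun i => 2^k * L 2 i) (fun i hi => by simp [hLN _ i hi])
      (fun i hi => by simp [hLN _ i hi]) (fun i hi => by simp [hLN _ i hi])
      (Nat.mul_le_mul_left _ (hLn _ _)) (Nat.mul_le_mul_left _ (hLn _ _))
      (Nat.mul_le_mul_left _ (hLn _ _)) h5
    let F : Fin 3 → ℕ → ℤ := fun s i => ((![lam, mu, nu] : Fin 3 → ℕ → ℕ) s i : ℤ)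
    have h7 : MH (R := ℤ) (2^k*n) (fun s i => F s (i/2^k)) := by
      convert h6 using 3 with s i
      fin_cases s
      · show _ = ((conj N (fun i => 2^k * conj n lam i) i : ℕ) : ℤ)
        rw [conj_mul N _ hp, conj_conj n N lam al hl.2 nl]; rfl
      · show _ = ((conj N (fun i => 2^k * conj n mu i) i : ℕ) : ℤ)
        rw [conj_mul N _ hp, conj_conj n N mu am hm.2 nm]; rfl
      · show _ = ((conj N (fun i => 2^k * conj n nu i) i : ℕ) : ℤ)
        rw [conj_mul N _ hp, conj_conj n N nu av hv.2 nv]; rfl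
    have hevF : Even (∑ s, ∑ i ∈ Finset.range n, F s i) := by
      simp only [F, Fin.sum_univ_three, Matrix.cons_val_zero, Matrix.cons_val_one, Matrix.cons_val]
      exact_mod_cast hev
    have h8 : ∀ k, MH (R := ℤ) (2^k*n) (fun s i => F s (i/2^k)) → MH (R := ℤ) n F := by
      intro k
      induction k with
      | zero => intro h; simpa using h
      | succ k ih =>
        intro h
        apply ih
        apply P5
        · rcases Nat.eq_zero_or_pos k with h0 | h0
          · subst h0; simpa using hevF
          · have : ∀ s, ∑ i ∈ Finset.range (2^k*n), F s (i/2^k) =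
                ((2^k : ℕ) : ℤ) * ∑ i ∈ Finset.range n, F s i := fun s =>
              sum_div_range (F s) (2^k) (by positivity) n
            simp only [this]
            rw [← Finset.mul_sum]
            apply Even.mul_right
            obtain ⟨m, rfl⟩ : ∃ m, k = m + 1 := ⟨k-1, by omega⟩
            rw [pow_succ]; push_cast
            exact ⟨2^m, by ring⟩
        · have e : 2*(2^k*n) = 2^(k+1)*n := by ring
          have e' : (fun (s : Fin 3) (i : ℕ) => F s (i/2/2^k)) = fun s i => F s (i/2^(k+1)) := by
            funext s i
            rw [Nat.div_div_eq_div_mul, pow_succ, mul_comm]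
          rw [e, e']
          exact h
    have h9 := h8 k h7
    exact NL_of_MH n (![lam, mu, nu] : Fin 3 → ℕ → ℕ) (by
      intro s i hi
      fin_cases s
      · exact hl.2 i hi
      · exact hm.2 i hi
      · exact hv.2 i hi) h9

end NLS
end

section
namespace NLS

theorem elim {ρ γ A : Type*} [AddCommGroup A] (hA : ∀ a : A, (2:ℤ) • a = 0 → a = 0)
    [DecidableEq ρ] [DecidableEq γ] (C : Finset γ) :
    ∀ (R : Finset ρ) (M : ρ → γ → ℤ), (∀ c ∈ C, ∑ r ∈ R, |M r c| ≤ 2) →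
    (∀ x : γ → ℝ, (∀ r ∈ R, ∑ c ∈ C, (M r c : ℝ) * x c = 0) → ∀ c ∈ C, x c = 0) →
    ∀ x : γ → A, (∀ r ∈ R, ∑ c ∈ C, M r c • x c = 0) → ∀ c ∈ C, x c = 0 := by
  induction C using Finset.induction_on with
  | empty => intro R M _ _ x _ c hc; simp at hc
  | insert c C hc ih =>
    intro R M hM hinj x hx
    obtain ⟨r, hr, hrc⟩ : ∃ r ∈ R, M r c ≠ 0 := by
      by_contra hcon
      push Not at hcon
      have := hinj (fun d => if d = c then 1 else 0) (by
        intro r hr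
        rw [Finset.sum_insert hc]
        simp only [hcon r hr]
        rw [Finset.sum_eq_zero]
        · simp
        · intro d hd
          rw [if_neg]; · simp
          rintro rfl; exact hc hd) c (Finset.mem_insert_self _ _)
      simp at this
    have hMc := hM c (Finset.mem_insert_self _ _)
    rw [← Finset.add_sum_erase _ _ hr] at hMc
    have h1 : 1 ≤ |M r c| := Int.one_le_abs hrc
    have hnn : ∀ d, 0 ≤ ∑ r' ∈ R.erase r, |M r' d| := fun d => Finset.sum_nonneg (fun _ _ => abs_nonneg _)
    -- multipliers
    obtain ⟨q, hq, hqs⟩ : ∃ q : ρ → ℤ, (∀ r' ∈ R.erase r, M r' c = q r' * M r c) ∧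
        ∑ r' ∈ R.erase r, |q r'| ≤ 1 := by
      rcases h1.lt_or_eq with h | h
      · have h0 : ∑ r' ∈ R.erase r, |M r' c| = 0 := by linarith [hnn c]
        rw [Finset.sum_eq_zero_iff_of_nonneg (fun _ _ => abs_nonneg _)] at h0
        refine ⟨fun _ => 0, fun r' hr' => ?_, by simp⟩
        have := h0 r' hr'
        rw [abs_eq_zero] at this
        rw [this, zero_mul]
      · refine ⟨fun r' => M r' c * M r c, fun r' _ => ?_, ?_⟩
        · have : M r c * M r c = 1 := by rw [← abs_mul_abs_self, ← h]; rfl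
          rw [mul_assoc, this, mul_one]
        · simp only [abs_mul, ← h, mul_one]
          linarith
    have key := ih (R.erase r) (fun r' d => M r' d - q r' * M r d) (by
      intro d hd
      have h2 := hM d (Finset.mem_insert_of_mem hd)
      rw [← Finset.add_sum_erase _ _ hr] at h2
      calc _ ≤ ∑ r' ∈ R.erase r, (|M r' d| + |q r'| * |M r d|) := by
            apply Finset.sum_le_sum
            intro r' _
            rw [← abs_mul]; exact abs_sub _ _
        _ = ∑ r' ∈ R.erase r, |M r' d| + (∑ r' ∈ R.erase r, |q r'|) * |M r d| := by
            rw [Finset.sum_add_distrib, Finset.sum_mul]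
        _ ≤ _ := by nlinarith [abs_nonneg (M r d)]) (by
      intro y hy
      have hrc' : (M r c : ℝ) ≠ 0 := by exact_mod_cast hrc
      let S := ∑ d ∈ C, (M r d : ℝ) * y d
      let z : γ → ℝ := fun d => if d = c then - S / M r c else y d
      have hzC : ∀ d ∈ C, z d = y d := by
        intro d hd
        simp only [z]
        rw [if_neg]; rintro rfl; exact hc hd
      have hzc : z c = - S / M r c := by simp [z]
      have hsum : ∀ r', ∑ d ∈ C, (M r' d : ℝ) * z d = ∑ d ∈ C, (M r' d : ℝ) * y d := fun r' =>
        Finset.sum_congr rfl (fun d hd => by rw [hzC d hd])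
      have := hinj z (by
        intro r' hr'
        rw [Finset.sum_insert hc, hsum, hzc]
        by_cases h : r' = r
        · subst h
          field_simp
          simp [S]
        · have h2 := hy r' (Finset.mem_erase.2 ⟨h, hr'⟩)
          have h3 := hq r' (Finset.mem_erase.2 ⟨h, hr'⟩)
          rw [h3]
          push_cast at h2 ⊢
          simp only [sub_mul, Finset.sum_sub_distrib, mul_assoc] at h2
          rw [← Finset.mul_sum] at h2
          field_simp
          simp only [S]
          linarith)
      intro d hd
      rw [← hzC d hd]
      exact this d (Finset.mem_insert_of_mem hd)) x (by
      intro r' hr'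
      have h2 := hx r' (Finset.mem_of_mem_erase hr')
      have h3 := hx r hr
      rw [Finset.sum_insert hc] at h2 h3
      rw [hq r' hr'] at h2
      simp only [sub_smul, Finset.sum_sub_distrib, mul_smul] at h2 ⊢
      rw [← Finset.smul_sum]
      have h4 : q r' • (M r c • x c + ∑ d ∈ C, M r d • x d) = 0 := by rw [h3, smul_zero]
      rw [smul_add] at h4
      rw [← sub_eq_zero.2 (h2.trans h4.symm)]
      abel)
    intro d hd
    rw [Finset.mem_insert] at hd
    rcases hd with rfl | hd
    · have h3 := hx r hr
      rw [Finset.sum_insert hc, Finset.sum_eq_zero (fun e he => by rw [key e he, smul_zero]),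
        add_zero] at h3
      have h4 : |M r d| ≤ 2 := by linarith [hnn d]
      have h5 : M r d = 1 ∨ M r d = -1 ∨ M r d = 2 ∨ M r d = -2 := by
        rw [abs_le] at h4
        omega
      rcases h5 with h | h | h | h <;> rw [h] at h3
      · simpa using h3
      · simpa using h3
      · exact hA _ h3
      · exact hA _ (by rw [neg_smul] at h3; exact neg_eq_zero.1 h3)
    · exact key d hd

end NLS
end

section
namespace NLS

theorem elim2 {φ ρ γ : Type*} {A : Type} [AddCommGroup A] (hA : ∀ a : A, (2:ℤ) • a = 0 → a = 0)
    [DecidableEq ρ] [DecidableEq γ] (F : Finset φ) (R : Finset ρ) (C : Finset γ)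
    (own : φ → ρ) (ed : φ → γ) (sg : φ → ℤ) (hsg : ∀ f, |sg f| ≤ 1)
    (hcnt : ∀ e ∈ C, (F.filter (fun f => ed f = e)).card ≤ 2)
    (hinj : ∀ x : γ → ℝ, (∀ e, e ∉ C → x e = 0) →
      (∀ r ∈ R, ∑ f ∈ F with own f = r, sg f • x (ed f) = 0) → ∀ e ∈ C, x e = 0)
    (x : γ → A) (hx0 : ∀ e, e ∉ C → x e = 0)
    (hx : ∀ r ∈ R, ∑ f ∈ F with own f = r, sg f • x (ed f) = 0) : ∀ e ∈ C, x e = 0 := by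
  have key : ∀ {B : Type} [AddCommGroup B] (y : γ → B), ∀ r,
      ∑ c ∈ C, (∑ f ∈ F with own f = r, if ed f = c then sg f else 0) • y c
        = ∑ f ∈ F with own f = r, sg f • (if ed f ∈ C then y (ed f) else 0) := by
    intro B _ y r
    simp only [Finset.sum_smul]
    rw [Finset.sum_comm]
    refine Finset.sum_congr rfl fun f _ => ?_
    simp only [ite_smul, zero_smul]
    rw [Finset.sum_ite_eq]
    split <;> simp
  refine elim hA C R (fun r c => ∑ f ∈ F with own f = r, if ed f = c then sg f else 0) ?_ ?_ x ?_
  · intro c hc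
    calc _ ≤ ∑ r ∈ R, ∑ f ∈ F with own f = r, (if ed f = c then (1:ℤ) else 0) := by
          refine Finset.sum_le_sum fun r _ => (Finset.abs_sum_le_sum_abs _ _).trans ?_
          refine Finset.sum_le_sum fun f _ => ?_
          split
          · exact hsg f
          · simp
      _ ≤ ∑ f ∈ F, (if ed f = c then (1:ℤ) else 0) := by
          simp only [Finset.sum_filter]
          rw [Finset.sum_comm]
          refine Finset.sum_le_sum fun f _ => ?_
          rw [Finset.sum_ite_eq]
          split
          · exact le_rfl
          · split <;> simp
      _ ≤ 2 := by
          rw [← Finset.sum_filter]; simp; exact_mod_cast hcnt c hc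
  · intro y hy
    have := hinj (fun e => if e ∈ C then y e else 0) (fun e he => if_neg he) (by
      intro r hr
      rw [← key y r, ← hy r hr]
      refine Finset.sum_congr rfl fun c _ => ?_
      rw [zsmul_eq_mul])
    intro c hc
    simpa [hc] using this c hc
  · intro r hr
    rw [key x r]
    refine Eq.trans ?_ (hx r hr)
    refine Finset.sum_congr rfl fun f _ => ?_
    split
    · rfl
    · next h => rw [hx0 _ h]

structure Sol {Tri E A : Type*} [AddCommGroup A] (R : Finset Tri) (edge : Tri → Fin 3 → E)
    (pin : E → Prop) (isM : Tri → Prop) (mate : Tri → Tri) (l : E → A) : Prop where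
  pin : ∀ e, pin e → l e = 0
  tri : ∀ t ∈ R, ∀ c, l (edge t c) + l (edge t (c+1)) + l (edge t (c+2)) = 0
  mt : ∀ t ∈ R, isM t → ∀ c, l (edge t c) = l (edge (mate t) c)

open Classical in
theorem surf {Tri E : Type*} {A : Type} [AddCommGroup A] (hA : ∀ a : A, (2:ℤ) • a = 0 → a = 0)
    (R : Finset Tri) (edge : Tri → Fin 3 → E)
    (pin : E → Prop) (isM : Tri → Prop) (mate : Tri → Tri) (ty a : Tri → Fin 3)
    (ha : ∀ t, a t = 1 ∨ a t = 2)
    (h1 : ∀ t ∈ R, isM t → mate t ∈ R)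
    (h2 : ∀ t ∈ R, isM t → isM (mate t))
    (h3 : ∀ t ∈ R, isM t → mate (mate t) = t)
    (h4 : ∀ t ∈ R, isM t → ty (mate t) = ty t)
    (h5 : ∀ t ∈ R, isM t → a (mate t) ≠ a t)
    (h6 : ∀ t ∈ R, isM t → edge t (ty t) = edge (mate t) (ty t))
    (h7 : ∀ t ∈ R, isM t → ¬ pin (edge t (ty t)))
    (hcnt : ∀ p q r : Tri × Fin 3, p.1 ∈ R → q.1 ∈ R → r.1 ∈ R → ¬ pin (edge p.1 p.2) →
      edge p.1 p.2 = edge q.1 q.2 → edge p.1 p.2 = edge r.1 r.2 → p = q ∨ p = r ∨ q = r)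
    (hR : ∀ l : E → ℝ, Sol R edge pin isM mate l → ∀ t ∈ R, ∀ c, l (edge t c) = 0)
    (l : E → A) (hl : Sol R edge pin isM mate l) : ∀ t ∈ R, ∀ c, l (edge t c) = 0 := by
  set F : Finset (Tri × Fin 3) :=
    (R ×ˢ Finset.univ).filter (fun f => ¬ (isM f.1 ∧ f.2 = ty f.1)) with hF
  set C : Finset E := (F.image (fun f => edge f.1 f.2)).filter (fun e => ¬ pin e) with hC
  have hFm : ∀ t c, (t, c) ∈ F ↔ t ∈ R ∧ ¬ (isM t ∧ c = ty t) := by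
    intro t c; simp [hF]
  have hCm : ∀ t c, (t, c) ∈ F → ¬ pin (edge t c) → edge t c ∈ C := by
    intro t c h hp
    rw [hC, Finset.mem_filter, Finset.mem_image]
    exact ⟨⟨(t, c), h, rfl⟩, hp⟩
  have hne : ∀ t ∈ R, isM t → mate t ≠ t := by
    intro t ht hm h
    have := h5 t ht hm
    rw [h] at this; exact this rfl
  have hdiag : ∀ t ∈ R, isM t → ∀ p : Tri × Fin 3, p.1 ∈ R → edge p.1 p.2 = edge t (ty t) →
      p = (t, ty t) ∨ p = (mate t, ty t) := by
    intro t ht hm p hp he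
    have := hcnt (t, ty t) (mate t, ty t) p ht (h1 t ht hm) hp (h7 t ht hm) (h6 t ht hm) he.symm
    rcases this with h | h | h
    · exact absurd (congrArg Prod.fst h).symm (hne t ht hm)
    · exact Or.inl h.symm
    · exact Or.inr h.symm
  have hdC : ∀ t ∈ R, isM t → edge t (ty t) ∉ C := by
    intro t ht hm hc
    rw [hC, Finset.mem_filter, Finset.mem_image] at hc
    obtain ⟨⟨⟨u, c⟩, hu, he⟩, _⟩ := hc
    rw [hFm] at hu
    rcases hdiag t ht hm (u, c) hu.1 he with h | h
    · rw [Prod.mk.injEq] at h; obtain ⟨rfl, rfl⟩ := h; exact hu.2 ⟨hm, rfl⟩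
    · rw [Prod.mk.injEq] at h; obtain ⟨rfl, rfl⟩ := h
      exact hu.2 ⟨h2 t ht hm, (h4 t ht hm).symm⟩
  set own : Tri × Fin 3 → Tri := fun f => if isM f.1 ∧ f.2 ≠ ty f.1 + a f.1 then mate f.1 else f.1
    with hown
  set sg : Tri × Fin 3 → ℤ := fun f => if isM f.1 ∧ f.2 ≠ ty f.1 + a f.1 then -1 else 1 with hsg
  have hfin : ∀ c d : Fin 3, c ≠ d → c ≠ d + 1 → c = d + 2 := by decide
  have hfin' : ∀ d : Fin 3, d + 1 ≠ d ∧ d + 2 ≠ d ∧ d + 1 ≠ d + 2 := by decide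
  -- rows
  have rowU : ∀ {B : Type} [AddCommGroup B] (y : E → B), ∀ t ∈ R, ¬ isM t →
      ∑ f ∈ F with own f = t, sg f • y (edge f.1 f.2) =
        y (edge t 0) + y (edge t 1) + y (edge t 2) := by
    intro B _ y t ht hm
    have : F.filter (fun f => own f = t) = Finset.univ.image (fun c : Fin 3 => (t, c)) := by
      ext ⟨u, c⟩
      rw [Finset.mem_filter, hFm]
      simp only [Finset.mem_image, Finset.mem_univ, true_and, Prod.mk.injEq, hown]
      constructor
      · rintro ⟨⟨hu, hc⟩, h⟩
        split at h
        · next hh => exact absurd (h ▸ h2 u hu hh.1) hm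
        · exact ⟨c, h.symm, rfl⟩
      · rintro ⟨d, rfl, rfl⟩
        simp [ht, hm]
    rw [this, Finset.sum_image (by intro c _ d _ h; exact (Prod.mk.injEq _ _ _ _ ▸ h).2),
      Fin.sum_univ_three]
    simp [hsg, hm]
  have rowM : ∀ {B : Type} [AddCommGroup B] (y : E → B), ∀ t ∈ R, isM t →
      ∑ f ∈ F with own f = t, sg f • y (edge f.1 f.2) =
        y (edge t (ty t + a t)) - y (edge (mate t) (ty t + a t)) := by
    intro B _ y t ht hm
    have hat : ty t + a t ≠ ty t := by
      rcases ha t with h | h <;> rw [h]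
      · exact (hfin' _).1
      · exact (hfin' _).2.1
    have hat' : ty t + a t ≠ ty t + a (mate t) := by
      intro h; exact h5 t ht hm (add_left_cancel h).symm
    have : F.filter (fun f => own f = t) = {(t, ty t + a t), (mate t, ty t + a t)} := by
      ext ⟨u, c⟩
      rw [Finset.mem_filter, hFm]
      simp only [Finset.mem_insert, Finset.mem_singleton, Prod.mk.injEq, hown]
      constructor
      · rintro ⟨⟨hu, hc⟩, h⟩
        split at h
        · next hh =>
          right
          have hmu : mate t = u := by rw [← h, h3 u hu hh.1]
          refine ⟨hmu.symm, ?_⟩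
          have e1 : ty u = ty t := by rw [← hmu, h4 t ht hm]
          have hc' : c ≠ ty t := fun h' => hc ⟨hh.1, by rw [h', e1]⟩
          have hh2 := hh.2
          rw [e1, ← hmu] at hh2
          rcases ha t with e | e <;> rcases ha (mate t) with e' | e' <;> rw [e] <;> rw [e'] at hh2
          · exact absurd (e'.trans e.symm) (h5 t ht hm)
          · by_contra h'
            exact hh2 (hfin _ _ hc' h')
          · exact hfin _ _ hc' hh2
          · exact absurd (e'.trans e.symm) (h5 t ht hm)
        · next hh =>
          left
          refine ⟨h, ?_⟩
          rw [h] at hh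
          by_contra h'
          exact hh ⟨hm, h'⟩
      · rintro (⟨rfl, rfl⟩ | ⟨rfl, rfl⟩)
        · simp [ht, hat]
        · have := h4 t ht hm
          simp only [h1 t ht hm, this, h2 t ht hm, true_and]
          exact ⟨hat, by rw [if_pos hat', h3 t ht hm]⟩
    have hne' := hne t ht hm
    rw [this, Finset.sum_pair (by intro h; exact hne' (congrArg Prod.fst h).symm)]
    simp only [hsg, h2 t ht hm, h4 t ht hm, true_and, hm]
    rw [if_neg (by simp), if_pos hat']
    simp [sub_eq_add_neg]
  have main : ∀ e ∈ C, l e = 0 := by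
    have := elim2 hA F R C own (fun f => edge f.1 f.2) sg
      (by intro f; simp only [hsg]; split <;> simp) ?_ ?_ (fun e => if e ∈ C then l e else 0)
      (fun e he => if_neg he) ?_
    · intro e he; simpa [he] using this e he
    · intro e he
      by_contra hcon
      push Not at hcon
      obtain ⟨p, hp, q, hq, r, hr, hpq, hpr, hqr⟩ := Finset.two_lt_card.1 hcon
      rw [Finset.mem_filter] at hp hq hr
      have hpF := (hFm p.1 p.2).1 hp.1
      have hqF := (hFm q.1 q.2).1 hq.1
      have hrF := (hFm r.1 r.2).1 hr.1
      rw [hC, Finset.mem_filter] at he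
      rcases hcnt p q r hpF.1 hqF.1 hrF.1 (hp.2 ▸ he.2) (hp.2.trans hq.2.symm)
        (hp.2.trans hr.2.symm) with h | h | h
      · exact hpq h
      · exact hpr h
      · exact hqr h
    · intro x hx0 hrow
      -- build solution
      set y : E → ℝ := fun e => if h : ∃ t, t ∈ R ∧ isM t ∧ e = edge t (ty t) then
        -(x (edge h.choose (ty h.choose + 1)) + x (edge h.choose (ty h.choose + 2))) else x e with hy
      have hy1 : ∀ t ∈ R, ∀ c, ¬ (isM t ∧ c = ty t) → y (edge t c) = x (edge t c) := by
        intro t ht c hc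
        simp only [hy]
        rw [dif_neg]
        rintro ⟨u, hu, hmu, he⟩
        rcases hdiag u hu hmu (t, c) ht he with h | h
        · rw [Prod.mk.injEq] at h; obtain ⟨rfl, rfl⟩ := h; exact hc ⟨hmu, rfl⟩
        · rw [Prod.mk.injEq] at h; obtain ⟨rfl, rfl⟩ := h
          exact hc ⟨h2 u hu hmu, (h4 u hu hmu).symm⟩
      have hxm0 : ∀ t ∈ R, isM t → x (edge t (ty t + a t)) = x (edge (mate t) (ty t + a t)) := by
        intro t ht hm
        have := hrow t ht
        rw [rowM x t ht hm] at this
        linarith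
      have hxm : ∀ t ∈ R, isM t → x (edge t (ty t + 1)) = x (edge (mate t) (ty t + 1)) ∧
          x (edge t (ty t + 2)) = x (edge (mate t) (ty t + 2)) := by
        intro t ht hm
        have e1 := hxm0 t ht hm
        have e2 := hxm0 _ (h1 t ht hm) (h2 t ht hm)
        rw [h3 t ht hm, h4 t ht hm] at e2
        have := h5 t ht hm
        rcases ha t with e | e <;> rcases ha (mate t) with e' | e' <;> rw [e] at e1 <;>
          rw [e'] at e2
        · exact absurd (e'.trans e.symm) this
        · exact ⟨e1, e2.symm⟩
        · exact ⟨e2.symm, e1⟩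
        · exact absurd (e'.trans e.symm) this
      have hy2 : ∀ t ∈ R, isM t → y (edge t (ty t)) =
          -(x (edge t (ty t + 1)) + x (edge t (ty t + 2))) := by
        intro t ht hm
        have hex : ∃ t', t' ∈ R ∧ isM t' ∧ edge t (ty t) = edge t' (ty t') := ⟨t, ht, hm, rfl⟩
        simp only [hy]
        rw [dif_pos hex]
        obtain ⟨hu, hmu, he⟩ := hex.choose_spec
        rcases hdiag t ht hm (hex.choose, ty hex.choose) hu he.symm with h | h
        · rw [Prod.mk.injEq] at h; rw [h.1]
        · rw [Prod.mk.injEq] at h; rw [h.1, h4 t ht hm, (hxm t ht hm).1, (hxm t ht hm).2]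
      have hyS : Sol R edge pin isM mate y := by
        refine ⟨?_, ?_, ?_⟩
        · intro e he
          simp only [hy]
          rw [dif_neg]
          · apply hx0; intro h; rw [hC, Finset.mem_filter] at h; exact h.2 he
          · rintro ⟨u, hu, hmu, rfl⟩; exact h7 u hu hmu he
        · intro t ht c
          have hs : y (edge t c) + y (edge t (c+1)) + y (edge t (c+2)) =
              y (edge t (ty t)) + y (edge t (ty t+1)) + y (edge t (ty t+2)) := by
            generalize ty t = d
            have i1 : d + 1 + 1 = d + 2 := by revert d; decide
            have i2 : d + 1 + 2 = d := by revert d; decide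
            have i3 : d + 2 + 1 = d := by revert d; decide
            have i4 : d + 2 + 2 = d + 1 := by revert d; decide
            have : c = d ∨ c = d + 1 ∨ c = d + 2 := by clear i1 i2 i3 i4; revert c d; decide
            rcases this with rfl | rfl | rfl
            · rfl
            · rw [i1, i2]; ring
            · rw [i3, i4]; ring
          by_cases hm : isM t
          · rw [hs, hy2 t ht hm, hy1 t ht _ (fun h => (hfin' _).1 h.2),
              hy1 t ht _ (fun h => (hfin' _).2.1 h.2)]; ring
          · have := hrow t ht
            rw [rowU x t ht hm] at this
            have hz : ∀ c, y (edge t c) = x (edge t c) := fun c => hy1 t ht c (fun h => hm h.1)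
            simp only [hz]
            have hc : ∀ c : Fin 3, c = 0 ∨ c = 1 ∨ c = 2 := by decide
            rcases hc c with rfl | rfl | rfl
            · simpa using this
            · have : (1:Fin 3) + 1 = 2 := rfl
              have : (1:Fin 3) + 2 = 0 := rfl
              simp only [*]; linarith
            · have : (2:Fin 3) + 1 = 0 := rfl
              have : (2:Fin 3) + 2 = 1 := rfl
              simp only [*]; linarith
        · intro t ht hm c
          have hmr := h1 t ht hm
          have hmm := h2 t ht hm
          have ht4 := h4 t ht hm
          by_cases hc : c = ty t
          · rw [hc, h6 t ht hm]
          · rw [hy1 t ht c (fun h => hc h.2), hy1 _ hmr c (fun h => hc (h.2.trans ht4))]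
            by_cases hc1 : c = ty t + 1
            · rw [hc1]; exact (hxm t ht hm).1
            · rw [hfin _ _ hc hc1]; exact (hxm t ht hm).2
      have hz := hR y hyS
      intro e he
      have he' := he
      rw [hC, Finset.mem_filter, Finset.mem_image] at he
      obtain ⟨⟨⟨u, c⟩, hu, rfl⟩, _⟩ := he
      rw [hFm] at hu
      exact (hy1 u hu.1 c hu.2).symm.trans (hz u hu.1 c)
    · intro r hr
      have hxC : ∀ f ∈ F, (if edge f.1 f.2 ∈ C then l (edge f.1 f.2) else 0) = l (edge f.1 f.2) := by
        intro f hf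
        split
        · rfl
        · next h =>
          by_contra h'
          exact h (hCm f.1 f.2 hf (fun hp => h' (hl.pin _ hp).symm))
      rw [Finset.sum_congr rfl (g := fun f => sg f • l (edge f.1 f.2)) (by
        intro f hf; rw [Finset.mem_filter] at hf; rw [hxC f hf.1])]
      by_cases hm : isM r
      · rw [rowM l r hr hm, hl.mt r hr hm, sub_self]
      · rw [rowU l r hr hm]; exact hl.tri r hr 0
  have nd : ∀ t ∈ R, ∀ c, ¬ (isM t ∧ c = ty t) → l (edge t c) = 0 := by
    intro t ht c hc
    by_cases hp : pin (edge t c)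
    · exact hl.pin _ hp
    · exact main _ (hCm t c ((hFm t c).2 ⟨ht, hc⟩) hp)
  intro t ht c
  by_cases hc : isM t ∧ c = ty t
  · obtain ⟨hm, rfl⟩ := hc
    have := hl.tri t ht (ty t)
    rw [nd t ht _ (fun h => (hfin' _).1 h.2), nd t ht _ (fun h => (hfin' _).2.1 h.2)] at this
    simpa using this
  · exact nd t ht c hc

end NLS
end

section
namespace NLS

/-- slack of the rhombus of type `c` at the down triangle `(i,k)` -/
def rh {A : Type*} [AddCommGroup A] (c : Fin 3) (H : ℕ → ℕ → A) (i k : ℕ) : A :=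
  if c = 0 then H i (k+1) + H (i+1) (k+1) - H i k - H (i+1) (k+2)
  else if c = 1 then H (i+1) (k+1) + H i k - H i (k+1) - H (i+1) k
  else H i k + H i (k+1) - H (i-1) k - H (i+1) (k+1)

structure Kc {A : Type*} [AddCommGroup A] (n : ℕ) (tau : Fin 3 → Fin 3 → ℕ → ℕ → Prop)
    (tw : Fin 3 → ℕ → Prop) (f : Fin 3 → ℕ → ℕ → A) : Prop where
  seam : ∀ s k, k ≤ n → f s n k = f s n 0 + f (s+1) k 0
  bd : ∀ s i, i ≤ n → f s i i = 0
  tight : ∀ s c i k, k < i → i < n → tau s c i k → rh c (f s) i k = 0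
  wall : ∀ s i, i < n → tw s i → f s (i+1) 0 = f s i 0

abbrev Tri := Fin 3 × Bool × ℕ × ℕ
abbrev Edg := Fin 3 × ℕ × ℕ × Fin 3

def tmem (n : ℕ) : Tri → Prop
  | (_, true, i, k) => k ≤ i ∧ i < n
  | (_, false, i, k) => k < i ∧ i < n

def nb : Tri → Fin 3 → Tri
  | (s, true, i, k), c => if c = 0 then (s, false, i, k-1) else if c = 1 then (s, false, i, k)
      else (s, false, i+1, k)
  | (s, false, i, k), c => if c = 0 then (s, true, i, k+1) else if c = 1 then (s, true, i, k)
      else (s, true, i-1, k)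

def edg (n : ℕ) : Tri → Fin 3 → Edg
  | (s, true, i, k), c => if c = 2 ∧ i + 1 = n then (s+1, k, 0, 0) else (s, i, k, c)
  | (s, false, i, k), c => if c = 0 then (s, i, k+1, 0) else if c = 1 then (s, i, k, 1)
      else (s, i-1, k, 2)

def mt (n : ℕ) (tau : Fin 3 → Fin 3 → ℕ → ℕ → Prop) : Tri → Fin 3 → Prop
  | (s, false, i, k), c => k < i ∧ i < n ∧ tau s c i k
  | (s, true, i, k), c => if c = 0 then 1 ≤ k ∧ k ≤ i ∧ i < n ∧ tau s 0 i (k-1)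
      else if c = 1 then k < i ∧ i < n ∧ tau s 1 i k
      else k ≤ i ∧ i + 1 < n ∧ tau s 2 (i+1) k

theorem fin3 (c : Fin 3) : c = 0 ∨ c = 1 ∨ c = 2 := by revert c; decide

theorem mt_spec (n : ℕ) (tau : Fin 3 → Fin 3 → ℕ → ℕ → Prop) (t : Tri) (c : Fin 3)
    (h : mt n tau t c) : tmem n t ∧ tmem n (nb t c) ∧ mt n tau (nb t c) c ∧ nb (nb t c) c = t := by
  obtain ⟨s, b, i, k⟩ := t
  cases b <;> rcases fin3 c with rfl | rfl | rfl <;> simp [mt, nb, tmem] at h ⊢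
  · grind
  · grind
  · obtain ⟨h1, h2, h3⟩ := h
    obtain ⟨j, rfl⟩ : ∃ j, i = j + 1 := ⟨i - 1, by omega⟩
    simp; grind
  · grind
  · grind
  · grind

/-- class of a flag: up and not on the seam -/
def ucl (n : ℕ) (p : Tri × Fin 3) : Prop := p.1.2.1 = true ∧ ¬ (p.2 = 2 ∧ p.1.2.2.1 + 1 = n)

theorem edg_inj (n : ℕ) (p q : Tri × Fin 3) (hp : tmem n p.1) (hq : tmem n q.1)
    (he : edg n p.1 p.2 = edg n q.1 q.2) (hc : ucl n p ↔ ucl n q) : p = q := by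
  obtain ⟨⟨s, b, i, k⟩, c⟩ := p
  obtain ⟨⟨s', b', i', k'⟩, c'⟩ := q
  cases b <;> cases b' <;> rcases fin3 c with rfl | rfl | rfl <;>
    rcases fin3 c' with rfl | rfl | rfl <;> simp [edg, tmem, ucl] at * <;>
    (try split_ifs at he) <;> (try simp at *) <;> grind

theorem edg_nb (n : ℕ) (t : Tri) (c : Fin 3) (h : tmem n t) (h' : tmem n (nb t c))
    (h2 : nb (nb t c) c = t) :
    edg n t c = edg n (nb t c) c := by
  obtain ⟨s, b, i, k⟩ := t
  cases b <;> rcases fin3 c with rfl | rfl | rfl <;> simp [edg, nb, tmem] at * <;>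
    (try split_ifs) <;> (try simp at *) <;> grind

def epin (n : ℕ) (tw : Fin 3 → ℕ → Prop) : Edg → Prop
  | (s, i, k, c) => i < n ∧ ((c = 1 ∧ i = k) ∨ (c = 0 ∧ k = 0 ∧ tw s i))

/-- edge labels of a function -/
def elb {A : Type*} [AddCommGroup A] (f : Fin 3 → ℕ → ℕ → A) : Edg → A
  | (s, i, k, c) => if c = 0 then f s (i+1) k - f s i k else if c = 1 then f s i k - f s (i+1) (k+1)
      else f s (i+1) (k+1) - f s (i+1) k

open Classical in
theorem surfH {A : Type} [AddCommGroup A] (hA : ∀ a : A, (2:ℤ) • a = 0 → a = 0) (n : ℕ)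
    (tau : Fin 3 → Fin 3 → ℕ → ℕ → Prop) (tw : Fin 3 → ℕ → Prop)
    (simpD : ∀ s i k c c', k < i → i < n → tau s c i k → tau s c' i k → c = c')
    (simp01 : ∀ s i k, k + 1 < i → i < n → tau s 0 i k → tau s 1 i (k+1) → False)
    (simp12 : ∀ s i k, k < i → i + 1 < n → tau s 1 i k → tau s 2 (i+1) k → False)
    (simp02 : ∀ s i k, k < i → i + 1 < n → tau s 0 i k → tau s 2 (i+1) (k+1) → False)
    (hinj : ∀ f : Fin 3 → ℕ → ℕ → ℝ, Kc n tau tw f → ∀ s i k, k ≤ i → i ≤ n → f s i k = 0)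
    (f : Fin 3 → ℕ → ℕ → A) (hf : Kc n tau tw f) : ∀ s i k, k ≤ i → i ≤ n → f s i k = 0 := by
  have hsimp : ∀ t c c', mt n tau t c → mt n tau t c' → c = c' := by
    rintro ⟨s, b, i, k⟩ c c' h h'
    cases b
    · exact simpD s i k c c' h.1 h.2.1 h.2.2 h'.2.2
    · rcases fin3 c with rfl | rfl | rfl <;> rcases fin3 c' with rfl | rfl | rfl <;>
        simp [mt] at h h' ⊢
      · obtain ⟨j, rfl⟩ : ∃ j, k = j + 1 := ⟨k - 1, by omega⟩
        exact simp01 s i j h'.1 h.2.2.1 h.2.2.2 h'.2.2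
      · obtain ⟨j, rfl⟩ : ∃ j, k = j + 1 := ⟨k - 1, by omega⟩
        exact simp02 s i j h.2.1 h'.2.1 h.2.2.2 h'.2.2
      · obtain ⟨j, rfl⟩ : ∃ j, k = j + 1 := ⟨k - 1, by omega⟩
        exact simp01 s i j h.1 h.2.1 h'.2.2.2 h.2.2
      · exact simp12 s i k h.1 h'.2.1 h.2.2 h'.2.2
      · obtain ⟨j, rfl⟩ : ∃ j, k = j + 1 := ⟨k - 1, by omega⟩
        exact simp02 s i j h'.2.1 h.2.1 h'.2.2.2 h.2.2
      · exact simp12 s i k h'.1 h.2.1 h'.2.2 h.2.2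
  set R : Finset Tri := ((Finset.univ ×ˢ Finset.univ ×ˢ Finset.range n ×ˢ Finset.range n :
    Finset Tri)).filter (tmem n) with hR
  have hRm : ∀ t, t ∈ R ↔ tmem n t := by
    rintro ⟨s, b, i, k⟩
    simp only [hR, Finset.mem_filter, Finset.mem_product, Finset.mem_univ, true_and,
      Finset.mem_range, and_iff_right_iff_imp]
    cases b <;> simp [tmem] <;> omega
  set isM : Tri → Prop := fun t => ∃ c, mt n tau t c with hisM
  set ty : Tri → Fin 3 := fun t => if h : ∃ c, mt n tau t c then h.choose else 0 with hty
  have hty' : ∀ t c, mt n tau t c → ty t = c := by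
    intro t c h
    have hex : ∃ c, mt n tau t c := ⟨c, h⟩
    simp only [hty]
    rw [dif_pos hex]
    exact hsimp t _ _ hex.choose_spec h
  set a : Tri → Fin 3 := fun t => if t.2.1 = true then 2 else 1 with ha
  set mate : Tri → Tri := fun t => nb t (ty t) with hmate
  have hmt : ∀ {B : Type} [AddCommGroup B] (l : Edg → B), Sol R (edg n) (epin n tw) isM mate l →
      ∀ t c, mt n tau t c → ∀ c', l (edg n t c') = l (edg n (nb t c) c') := by
    intro B _ l hl t c h c'
    have := hl.mt t ((hRm t).2 (mt_spec n tau t c h).1) ⟨c, h⟩ c'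
    simp only [hmate, hty' t c h] at this
    exact this
  have hsm : ∀ s k, k < n → f s n (k+1) - f s n k = f (s+1) (k+1) 0 - f (s+1) k 0 := by
    intro s k hk
    rw [hf.seam s (k+1) hk, hf.seam s k hk.le]; abel
  have hsol : Sol R (edg n) (epin n tw) isM mate (elb f) := by
    refine ⟨?_, ?_, ?_⟩
    · rintro ⟨s, i, k, c⟩ ⟨hi, he⟩
      rcases he with ⟨rfl, rfl⟩ | ⟨rfl, rfl, he⟩
      · simp [elb, hf.bd s i hi.le, hf.bd s (i+1) hi]
      · simp [elb, hf.wall s i hi he]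
    · have ht : ∀ t ∈ R, elb f (edg n t 0) + elb f (edg n t 1) + elb f (edg n t 2) = 0 := by
        rintro ⟨s, b, i, k⟩ ht
        rw [hRm] at ht
        cases b
        · obtain ⟨hk, hi⟩ := ht
          obtain ⟨j, rfl⟩ : ∃ j, i = j + 1 := ⟨i - 1, by omega⟩
          simp [edg, elb]
        · obtain ⟨hk, hi⟩ := ht
          have e := fun h : i + 1 = n => hsm s k (by omega)
          simp only [edg]
          by_cases h : i + 1 = n
          · have e := hsm s k (by omega)
            simp [elb, h, ← e]
          · simp [elb, h]
      intro t htR c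
      have := ht t htR
      rcases fin3 c with rfl | rfl | rfl
      · exact this
      · have e1 : (1:Fin 3) + 1 = 2 := rfl
        have e2 : (1:Fin 3) + 2 = 0 := rfl
        rw [e1, e2, ← this]; abel
      · have e1 : (2:Fin 3) + 1 = 0 := rfl
        have e2 : (2:Fin 3) + 2 = 1 := rfl
        rw [e1, e2, ← this]; abel
    · have hd : ∀ s i k c, mt n tau (s, false, i, k) c → ∀ c',
          elb f (edg n (s, false, i, k) c') = elb f (edg n (nb (s, false, i, k) c) c') := by
        intro s i k c h c'
        have ht := hf.tight s c i k h.1 h.2.1 h.2.2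
        obtain ⟨hk, hi, _⟩ := h
        obtain ⟨j, rfl⟩ : ∃ j, i = j + 1 := ⟨i - 1, by omega⟩
        have e := hsm s (k+1) (by omega)
        have e' := hsm s k (by omega)
        have hadd : ∀ m : ℕ, m + 1 + 1 = m + 2 := fun _ => rfl
        rcases fin3 c with rfl | rfl | rfl <;> rcases fin3 c' with rfl | rfl | rfl <;>
          simp [rh, edg, nb, elb] at ht ⊢ <;> (try split_ifs) <;> (try simp [elb]) <;>
          (try subst n) <;> (try rw [← e]) <;> (try rw [← e']) <;>
          (simp only [hadd] at ht ⊢; rw [← sub_eq_zero];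
            first | (rw [← ht]; abel1) | (rw [← neg_eq_zero]; exact Eq.trans (by abel1) ht) | grind)
      rintro t ht ⟨c, h⟩ c'
      simp only [hmate, hty' t c h]
      obtain ⟨s, b, i, k⟩ := t
      cases b
      · exact hd s i k c h c'
      · have h' := mt_spec n tau _ c h
        have h2 := h'.2.2
        generalize hu : nb (s, true, i, k) c = u at *
        obtain ⟨s', b', i', k'⟩ := u
        have hb : b' = false := by
          rcases fin3 c with rfl | rfl | rfl <;> simp [nb] at hu <;> tauto
        subst hb
        have := hd s' i' k' c h2.1 c'
        rw [h2.2] at this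
        exact this.symm
  have hz := surf hA R (edg n) (epin n tw) isM mate ty a ?_ ?_ ?_ ?_ ?_ ?_ ?_ ?_ ?_ ?_ (elb f) hsol
  · have hx : ∀ s i k, k ≤ i → i < n → f s (i+1) k = f s i k := by
      intro s i k hk hi
      have := hz (s, true, i, k) ((hRm _).2 ⟨hk, hi⟩) 0
      simpa [edg, elb, sub_eq_zero] using this
    have h0 : ∀ s i, i ≤ n → f s i 0 = 0 := by
      intro s i
      induction i with
      | zero => intro _; exact hf.bd s 0 (by omega)
      | succ i ih => intro hi; rw [hx s i 0 (by omega) (by omega), ih (by omega)]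
    intro s i k hk hi
    obtain ⟨d, rfl⟩ : ∃ d, i = k + d := ⟨i - k, by omega⟩
    clear hk
    induction d with
    | zero => exact hf.bd s k hi
    | succ d ih => rw [← add_assoc, hx s (k+d) k (by omega) (by omega), ih (by omega)]
  · intro t; simp only [ha]; split <;> simp
  · rintro t ht ⟨c, h⟩
    simp only [hmate, hty' t c h]
    exact (hRm _).2 (mt_spec n tau t c h).2.1
  · rintro t ht ⟨c, h⟩
    simp only [hmate, hty' t c h]
    exact ⟨c, (mt_spec n tau t c h).2.2.1⟩
  · rintro t ht ⟨c, h⟩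
    have h' := (mt_spec n tau t c h).2.2
    simp only [hmate, hty' t c h, hty' _ c h'.1]
    exact h'.2
  · rintro t ht ⟨c, h⟩
    have h' := (mt_spec n tau t c h).2.2
    simp only [hmate, hty' t c h, hty' _ c h'.1]
  · rintro ⟨s, b, i, k⟩ ht ⟨c, h⟩
    simp only [hmate, hty' _ c h, ha]
    cases b <;> rcases fin3 c with rfl | rfl | rfl <;> simp [nb]
  · rintro t ht ⟨c, h⟩
    have h' := (mt_spec n tau t c h)
    simp only [hmate, hty' t c h]
    exact edg_nb n t c h'.1 h'.2.1 h'.2.2.2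
  · rintro ⟨s, b, i, k⟩ ht ⟨c, h⟩
    rw [hty' _ c h]
    cases b <;> rcases fin3 c with rfl | rfl | rfl <;> simp [edg, mt] at h ⊢ <;>
      (try split_ifs) <;> simp [epin] <;> omega
  · intro p q r hp hq hr _ e1 e2
    rw [hRm] at hp hq hr
    by_cases c1 : ucl n p ↔ ucl n q
    · exact Or.inl (edg_inj n p q hp hq e1 c1)
    · by_cases c2 : ucl n p ↔ ucl n r
      · exact Or.inr (Or.inl (edg_inj n p r hp hr e2 c2))
      · exact Or.inr (Or.inr (edg_inj n q r hq hr (e1.symm.trans e2) (by tauto)))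
  · intro l hl
    set x : Fin 3 → ℕ → ℕ → ℝ := fun s i k => l (edg n (s, true, i, k) 0) with hx
    set q : Fin 3 → ℕ → ℕ → ℝ := fun s i k => l (edg n (s, true, i-1, k) 2) with hq
    set z : Fin 3 → ℕ → ℕ → ℝ := fun s i k => - l (edg n (s, true, i, k) 1) with hz
    have hu : ∀ s i k, k ≤ i → i < n → x s i k + q s (i+1) k = z s i k := by
      intro s i k hk hi
      have := hl.tri (s, true, i, k) ((hRm _).2 ⟨hk, hi⟩) 0
      simp only [zero_add] at this
      simp only [hx, hq, hz, Nat.add_sub_cancel]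
      linarith
    have hd : ∀ s i k, k < i → i < n → q s i k + x s i (k+1) = z s i k := by
      intro s i k hk hi
      have := hl.tri (s, false, i, k) ((hRm _).2 ⟨hk, hi⟩) 0
      have h1 : ¬ i - 1 + 1 = n := by omega
      simp [edg] at this
      simp [hx, hq, hz, edg, h1]
      linarith
    set g : Fin 3 → ℕ → ℕ → ℝ := fun s => pot (x s) (q s) with hg
    have gq : ∀ s i k, g s i (k+1) = g s i k + q s i k := fun s => pot_q _ _
    have gx : ∀ s i k, k ≤ i → i < n → g s (i+1) k = g s i k + x s i k :=
      fun s => pot_x n _ _ _ (hu s) (hd s)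
    have gz : ∀ s i k, k ≤ i → i < n → g s (i+1) (k+1) = g s i k + z s i k :=
      fun s => pot_z n _ _ _ (hu s) (hd s)
    have hg0 := hinj g (by
      refine ⟨?_, ?_, ?_, ?_⟩
      · intro s k hk
        simp only [hg, pot, Finset.range_zero, Finset.sum_empty, add_zero]
        congr 1
        refine Finset.sum_congr rfl fun j hj => ?_
        have hj' := Finset.mem_range.1 hj
        have h1 : n - 1 + 1 = n := by omega
        simp [hq, hx, edg, h1]
      · intro s i
        induction i with
        | zero => intro _; simp [hg, pot]
        | succ i ih =>
          intro hi
          rw [gz s i i le_rfl (by omega), ih (by omega)]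
          have := hl.pin (edg n (s, true, i, i) 1) (by simp [edg, epin]; omega)
          simp [hz, this]
      · intro s c i k hk hi ht
        have hm := hmt l hl (s, false, i, k) c ⟨hk, hi, ht⟩
        obtain ⟨j, rfl⟩ : ∃ j, i = j + 1 := ⟨i - 1, by omega⟩
        rcases fin3 c with rfl | rfl | rfl
        · have := hm 2
          have e1 := gq s (j+1) k
          have e2 := gq s (j+1+1) (k+1)
          have h1 : ¬ j + 1 = n := by omega
          simp only [nb, edg] at this
          simp [hq, edg, h1] at e1 e2
          simp [h1] at this
          simp [rh]
          linarith
        · have := hm 0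
          have e1 := gx s (j+1) k (by omega) hi
          have e2 := gx s (j+1) (k+1) (by omega) hi
          simp [nb, edg] at this
          simp [hx, edg] at e1 e2
          simp [rh]
          linarith
        · have := hm 0
          have e1 := gx s j k (by omega) (by omega)
          have e2 := gx s (j+1) (k+1) (by omega) hi
          simp [nb, edg] at this
          simp [hx, edg] at e1 e2
          simp [rh]
          linarith
      · intro s i hi ht
        rw [gx s i 0 (by omega) hi]
        have := hl.pin (edg n (s, true, i, 0) 0) (by simp [edg, epin, ht, hi])
        simp [hx, this])
    have hup : ∀ s i k, k ≤ i → i < n → ∀ c, l (edg n (s, true, i, k) c) = 0 := by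
      intro s i k hk hi c
      have a1 := hg0 s i k hk (by omega)
      have a2 := hg0 s (i+1) k (by omega) (by omega)
      have a3 := hg0 s (i+1) (k+1) (by omega) (by omega)
      have e1 := gx s i k hk hi
      have e2 := gz s i k hk hi
      have e3 := hu s i k hk hi
      simp only [hx, hq, hz, Nat.add_sub_cancel] at e1 e2 e3
      rcases fin3 c with rfl | rfl | rfl <;> linarith
    rintro ⟨s, b, i, k⟩ ht c
    rw [hRm] at ht
    cases b
    · obtain ⟨hk, hi⟩ := ht
      have h1 : ¬ i - 1 + 1 = n := by omega
      rcases fin3 c with rfl | rfl | rfl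
      · simpa [edg] using hup s i (k+1) (by omega) hi 0
      · simpa [edg] using hup s i k (by omega) hi 1
      · simpa [edg, h1] using hup s (i-1) k (by omega) (by omega) 2
    · exact hup s i k ht.1 ht.2 c

end NLS
end

section
namespace NLS

def lin1 (n : ℕ) (H : ℕ → ℕ → ℝ) (i k : ℕ) : Prop :=
  ∃ j, i = j + 1 ∧ k ≤ j ∧ j + 1 < n ∧ H (j+2) k + H j k = 2 * H (j+1) k
def lin2 (n : ℕ) (H : ℕ → ℕ → ℝ) (i k : ℕ) : Prop :=
  ∃ m, k = m + 1 ∧ m + 1 < i ∧ i ≤ n ∧ H i (m+2) + H i m = 2 * H i (m+1)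
def lin3 (n : ℕ) (H : ℕ → ℕ → ℝ) (i k : ℕ) : Prop :=
  ∃ j m, i = j + 1 ∧ k = m + 1 ∧ m ≤ j ∧ j + 1 < n ∧ H (j+2) (m+2) + H j m = 2 * H (j+1) (m+1)

open Classical in
noncomputable def linF (n : ℕ) (H : ℕ → ℕ → ℝ) (i k : ℕ) : ℕ :=
  min 2 ((if lin1 n H i k then 1 else 0) + (if lin2 n H i k then 1 else 0) +
    (if lin3 n H i k then 1 else 0))

theorem linF_eq_zero {n H i k} (h : linF n H i k = 0) :
    ¬ lin1 n H i k ∧ ¬ lin2 n H i k ∧ ¬ lin3 n H i k := by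
  unfold linF at h
  refine ⟨?_, ?_, ?_⟩ <;> intro h' <;> simp [h'] at h

theorem linF_of {n H i k} (h : ¬ lin1 n H i k ∧ ¬ lin2 n H i k ∧ ¬ lin3 n H i k) :
    linF n H i k = 0 := by
  simp [linF, h]

theorem IsHive.rh {n : ℕ} {H : ℕ → ℕ → ℝ} (h : IsHive n H) (c : Fin 3) (i k : ℕ) (hk : k < i)
    (hi : i < n) : 0 ≤ rh c H i k := by
  rcases fin3 c with rfl | rfl | rfl
  · have := h.s2 i k hk hi; simp [NLS.rh]; linarith
  · have := h.s1 i k hk hi; simp [NLS.rh]; linarith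
  · obtain ⟨j, rfl⟩ : ∃ j, i = j + 1 := ⟨i - 1, by omega⟩
    have := h.s3 j k (by omega) hi; simp [NLS.rh]; linarith

theorem IsHive.of_rh {n : ℕ} {H : ℕ → ℕ → ℝ}
    (h : ∀ c i k, k < i → i < n → 0 ≤ NLS.rh c H i k) : IsHive n H := by
  refine ⟨?_, ?_, ?_⟩
  · intro i k hk hi; have := h 1 i k hk hi; simp [NLS.rh] at this; linarith
  · intro i k hk hi; have := h 0 i k hk hi; simp [NLS.rh] at this; linarith
  · intro i k hk hi; have := h 2 (i+1) k (by omega) hi; simp [NLS.rh] at this; linarith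

section
variable {n : ℕ} {H : ℕ → ℕ → ℝ} (h : IsHive n H)
include h

theorem conc1 (j k : ℕ) (hk : k ≤ j) (hj : j + 1 < n) : H (j+2) k + H j k ≤ 2 * H (j+1) k := by
  have a := h.s1 (j+1) k (by omega) hj
  have b := h.s3 j k hk hj
  linarith
theorem conc2 (i m : ℕ) (hk : m + 1 < i) (hi : i ≤ n) : H i (m+2) + H i m ≤ 2 * H i (m+1) := by
  obtain ⟨j, rfl⟩ : ∃ j, i = j + 1 := ⟨i - 1, by omega⟩
  have a := h.s1 j m (by omega) hi
  have b := h.s2 j m (by omega) hi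
  linarith
theorem conc3 (j m : ℕ) (hk : m ≤ j) (hj : j + 1 < n) :
    H (j+2) (m+2) + H j m ≤ 2 * H (j+1) (m+1) := by
  have a := h.s2 (j+1) m (by omega) hj
  have b := h.s3 j m hk hj
  linarith
end

theorem cnt {bu bv bw cu av : Prop} [Decidable bu] [Decidable bv] [Decidable bw]
    [Decidable cu] [Decidable av] (h1 : bu → cu) (h2 : bv → av) (h3 : bw → cu ∧ av) :
    min 2 ((if bu then 1 else 0) + (if bv then 1 else 0) + (if bw then 1 else 0)) ≤
      (if cu then 1 else 0) + (if av then 1 else 0) := by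
  by_cases bu <;> by_cases bv <;> by_cases bw <;> by_cases cu <;> by_cases av <;> simp_all

section
variable {n : ℕ} {H : ℕ → ℕ → ℝ} (h : IsHive n H)
include h

open Classical in
theorem lin_s1 (i k : ℕ) (hk : k < i) (hi : i < n)
    (ht : H i (k+1) + H (i+1) k = H (i+1) (k+1) + H i k) :
    linF n H i (k+1) + linF n H (i+1) k ≤ linF n H (i+1) (k+1) + linF n H i k := by
  have e1 : linF n H (i+1) k ≤ (if lin1 n H (i+1) (k+1) then 1 else 0) +
      (if lin2 n H i k then 1 else 0) := by
    refine cnt ?_ ?_ ?_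
    · rintro ⟨j, h1, h2, h3, h4⟩
      obtain rfl : i = j := by omega
      refine ⟨i, rfl, by omega, h3, ?_⟩
      linarith [h.s1 (i+1) k (by omega) h3, conc1 h i (k+1) (by omega) h3]
    · rintro ⟨m, rfl, h2, h3, h4⟩
      refine ⟨m, rfl, by omega, by omega, ?_⟩
      linarith [h.s1 i m (by omega) hi, conc2 h i m (by omega) hi.le]
    · rintro ⟨j, m, h1, rfl, h2, h3, h4⟩
      obtain rfl : i = j := by omega
      have a := conc1 h i (m+1+1) (by omega) h3
      have b := conc2 h i m (by omega) hi.le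
      have : m + 1 + 1 = m + 2 := rfl
      rw [this] at *
      exact ⟨⟨i, rfl, by omega, h3, by linarith⟩, ⟨m, rfl, by omega, by omega, by linarith⟩⟩
  have e2 : linF n H i (k+1) ≤ (if lin1 n H i k then 1 else 0) +
      (if lin2 n H (i+1) (k+1) then 1 else 0) := by
    refine cnt ?_ ?_ ?_
    · rintro ⟨j, rfl, h2, h3, h4⟩
      refine ⟨j, rfl, by omega, h3, ?_⟩
      linarith [h.s1 j k (by omega) (by omega), conc1 h j k (by omega) h3]
    · rintro ⟨m, h1, h2, h3, h4⟩
      obtain rfl : k = m := by omega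
      refine ⟨k, rfl, by omega, by omega, ?_⟩
      linarith [h.s1 i (k+1) (by omega) hi, conc2 h (i+1) k (by omega) hi]
    · rintro ⟨j, m, rfl, h1, h2, h3, h4⟩
      obtain rfl : k = m := by omega
      have a := conc1 h j k (by omega) h3
      have b := conc2 h (j+1+1) k (by omega) hi
      have : j + 1 + 1 = j + 2 := rfl
      rw [this] at *
      exact ⟨⟨j, rfl, by omega, h3, by linarith⟩, ⟨k, rfl, by omega, by omega, by linarith⟩⟩
  have e3 : (if lin1 n H (i+1) (k+1) then 1 else 0) + (if lin2 n H (i+1) (k+1) then 1 else 0)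
      ≤ linF n H (i+1) (k+1) := by
    unfold linF; split_ifs <;> simp
  have e4 : (if lin1 n H i k then 1 else 0) + (if lin2 n H i k then 1 else 0)
      ≤ linF n H i k := by
    unfold linF; split_ifs <;> simp
  omega

open Classical in
theorem lin_s2 (i k : ℕ) (hk : k < i) (hi : i < n)
    (ht : H i k + H (i+1) (k+2) = H i (k+1) + H (i+1) (k+1)) :
    linF n H i k + linF n H (i+1) (k+2) ≤ linF n H i (k+1) + linF n H (i+1) (k+1) := by
  have e1 : linF n H i k ≤ (if lin2 n H (i+1) (k+1) then 1 else 0) +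
      (if lin3 n H i (k+1) then 1 else 0) := by
    have := cnt (bu := lin2 n H i k) (bv := lin3 n H i k) (bw := lin1 n H i k)
      (cu := lin2 n H (i+1) (k+1)) (av := lin3 n H i (k+1)) ?_ ?_ ?_
    · unfold linF; rw [add_assoc, add_comm]; exact this
    · rintro ⟨m, rfl, h2, h3, h4⟩
      refine ⟨m+1, rfl, by omega, by omega, ?_⟩
      linarith [h.s2 i m (by omega) hi, conc2 h (i+1) (m+1) (by omega) hi]
    · rintro ⟨j, m, rfl, rfl, h2, h3, h4⟩
      refine ⟨j, m+1, rfl, rfl, by omega, h3, ?_⟩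
      linarith [h.s2 j m (by omega) (by omega), conc3 h j (m+1) (by omega) h3]
    · rintro ⟨j, rfl, h2, h3, h4⟩
      have a := conc3 h j k (by omega) h3
      have b := conc2 h (j+1+1) k (by omega) hi
      have : j + 1 + 1 = j + 2 := rfl
      rw [this] at *
      exact ⟨⟨k, rfl, by omega, by omega, by linarith⟩, ⟨j, k, rfl, rfl, by omega, h3, by linarith⟩⟩
  have e2 : linF n H (i+1) (k+2) ≤ (if lin2 n H i (k+1) then 1 else 0) +
      (if lin3 n H (i+1) (k+1) then 1 else 0) := by
    have := cnt (bu := lin2 n H (i+1) (k+2)) (bv := lin3 n H (i+1) (k+2))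
      (bw := lin1 n H (i+1) (k+2))
      (cu := lin2 n H i (k+1)) (av := lin3 n H (i+1) (k+1)) ?_ ?_ ?_
    · unfold linF; rw [add_assoc, add_comm]; exact this
    · rintro ⟨m, h1, h2, h3, h4⟩
      obtain rfl : k + 1 = m := by omega
      refine ⟨k, rfl, by omega, by omega, ?_⟩
      linarith [h.s2 i (k+1) (by omega) hi, conc2 h i k (by omega) hi.le]
    · rintro ⟨j, m, h0, h1, h2, h3, h4⟩
      obtain rfl : k + 1 = m := by omega
      obtain rfl : i = j := by omega
      refine ⟨i, k, rfl, rfl, by omega, h3, ?_⟩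
      linarith [h.s2 (i+1) (k+1) (by omega) h3, conc3 h i k (by omega) h3]
    · rintro ⟨j, h1, h2, h3, h4⟩
      obtain rfl : i = j := by omega
      have a := conc3 h i k (by omega) h3
      have b := conc2 h i k (by omega) hi.le
      exact ⟨⟨k, rfl, by omega, by omega, by linarith⟩, ⟨i, k, rfl, rfl, by omega, h3, by linarith⟩⟩
  have e3 : (if lin2 n H (i+1) (k+1) then 1 else 0) + (if lin3 n H (i+1) (k+1) then 1 else 0)
      ≤ linF n H (i+1) (k+1) := by
    unfold linF; split_ifs <;> simp
  have e4 : (if lin2 n H i (k+1) then 1 else 0) + (if lin3 n H i (k+1) then 1 else 0)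
      ≤ linF n H i (k+1) := by
    unfold linF; split_ifs <;> simp
  omega

open Classical in
theorem lin_s3 (j k : ℕ) (hk : k ≤ j) (hj : j + 1 < n)
    (ht : H j k + H (j+2) (k+1) = H (j+1) k + H (j+1) (k+1)) :
    linF n H j k + linF n H (j+2) (k+1) ≤ linF n H (j+1) k + linF n H (j+1) (k+1) := by
  have e1 : linF n H j k ≤ (if lin1 n H (j+1) (k+1) then 1 else 0) +
      (if lin3 n H (j+1) k then 1 else 0) := by
    have := cnt (bu := lin1 n H j k) (bv := lin3 n H j k) (bw := lin2 n H j k)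
      (cu := lin1 n H (j+1) (k+1)) (av := lin3 n H (j+1) k) ?_ ?_ ?_
    · unfold linF; rw [add_right_comm]; exact this
    · rintro ⟨l, rfl, h2, h3, h4⟩
      refine ⟨l+1, rfl, by omega, by omega, ?_⟩
      linarith [h.s3 l k (by omega) (by omega), conc1 h (l+1) (k+1) (by omega) hj]
    · rintro ⟨l, m, rfl, rfl, h2, h3, h4⟩
      refine ⟨l+1, m, rfl, rfl, by omega, hj, ?_⟩
      linarith [h.s3 l m (by omega) (by omega), conc3 h (l+1) m (by omega) hj]
    · rintro ⟨m, rfl, h2, h3, h4⟩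
      have a := conc1 h j (m+1+1) (by omega) hj
      have b := conc3 h j m (by omega) hj
      have : m + 1 + 1 = m + 2 := rfl
      rw [this] at *
      exact ⟨⟨j, rfl, by omega, hj, by linarith⟩, ⟨j, m, rfl, rfl, by omega, hj, by linarith⟩⟩
  have e2 : linF n H (j+2) (k+1) ≤ (if lin1 n H (j+1) k then 1 else 0) +
      (if lin3 n H (j+1) (k+1) then 1 else 0) := by
    have := cnt (bu := lin1 n H (j+2) (k+1)) (bv := lin3 n H (j+2) (k+1))
      (bw := lin2 n H (j+2) (k+1))
      (cu := lin1 n H (j+1) k) (av := lin3 n H (j+1) (k+1)) ?_ ?_ ?_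
    · unfold linF; rw [add_right_comm]; exact this
    · rintro ⟨l, h1, h2, h3, h4⟩
      obtain rfl : j + 1 = l := by omega
      refine ⟨j, rfl, by omega, by omega, ?_⟩
      linarith [h.s3 (j+1) k (by omega) h3, conc1 h j k (by omega) hj]
    · rintro ⟨l, m, h0, h1, h2, h3, h4⟩
      obtain rfl : k = m := by omega
      obtain rfl : j + 1 = l := by omega
      refine ⟨j, k, rfl, rfl, by omega, hj, ?_⟩
      linarith [h.s3 (j+1) (k+1) (by omega) h3, conc3 h j k (by omega) hj]
    · rintro ⟨m, h1, h2, h3, h4⟩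
      obtain rfl : k = m := by omega
      have a := conc1 h j k (by omega) hj
      have b := conc3 h j k (by omega) hj
      exact ⟨⟨j, rfl, by omega, hj, by linarith⟩, ⟨j, k, rfl, rfl, by omega, hj, by linarith⟩⟩
  have e3 : (if lin1 n H (j+1) (k+1) then 1 else 0) + (if lin3 n H (j+1) (k+1) then 1 else 0)
      ≤ linF n H (j+1) (k+1) := by
    unfold linF; split_ifs <;> simp
  have e4 : (if lin1 n H (j+1) k then 1 else 0) + (if lin3 n H (j+1) k then 1 else 0)
      ≤ linF n H (j+1) k := by
    unfold linF; split_ifs <;> simp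
  omega

theorem lin_rh (c : Fin 3) (i k : ℕ) (hk : k < i) (hi : i < n) (ht : rh c H i k = 0) :
    0 ≤ rh c (fun i k => (linF n H i k : ℝ)) i k := by
  rcases fin3 c with rfl | rfl | rfl
  · simp [rh] at ht ⊢
    have := lin_s2 h i k hk hi (by linarith)
    rify at this; linarith
  · simp [rh] at ht ⊢
    have := lin_s1 h i k hk hi (by linarith)
    rify at this; linarith
  · obtain ⟨j, rfl⟩ : ∃ j, i = j + 1 := ⟨i - 1, by omega⟩
    simp [rh] at ht ⊢
    have := lin_s3 h j k (by omega) hi (by linarith)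
    rify at this; linarith

end

end NLS
end

section
namespace NLS

theorem lp {V : Type*} [TopologicalSpace V] [AddCommGroup V] (C : Set V)
    (hC : IsCompact C) (hne : C.Nonempty) (W Q : V → ℝ) (hW : Continuous W) (hQ : Continuous Q)
    (hW1 : ∀ x f, W (x + f) = W x + W f)
    (hQ1 : ∀ x f, Q (x + f) + Q (x - f) = 2 * Q x + 2 * Q f) :
    ∃ x ∈ C, (∀ f, x + f ∈ C → W f ≤ 0) ∧ (∀ f, x + f ∈ C → x - f ∈ C → Q f ≤ 0) := by
  obtain ⟨x0, hx0, hm0⟩ := hC.exists_isMaxOn hne hW.continuousOn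
  have hD : IsCompact (C ∩ W ⁻¹' {W x0}) := hC.inter_right (isClosed_singleton.preimage hW)
  obtain ⟨x, hx, hm⟩ := hD.exists_isMaxOn ⟨x0, hx0, rfl⟩ hQ.continuousOn
  have hWx : W x = W x0 := hx.2
  have h1 : ∀ f, x + f ∈ C → W f ≤ 0 := by
    intro f hf
    have : W (x + f) ≤ W x0 := hm0 hf
    rw [hW1, hWx] at this; linarith
  refine ⟨x, hx.1, h1, ?_⟩
  intro f hf hf'
  have a := h1 f hf
  have e : W (x - f) + W f = W x := by rw [← hW1, sub_add_cancel]
  have b : W (x - f) ≤ W x0 := hm0 hf'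
  have hf0 : W f = 0 := by linarith
  have c1 : Q (x + f) ≤ Q x := hm ⟨hf, by
    change W (x+f) = W x0; rw [hW1]; linarith⟩
  have c2 : Q (x - f) ≤ Q x := hm ⟨hf', by
    change W (x-f) = W x0; linarith⟩
  have := hQ1 x f
  linarith

theorem small_step {ι : Type*} (J : Finset ι) (a b : ι → ℝ) (ha : ∀ j ∈ J, 0 ≤ a j)
    (hb : ∀ j ∈ J, a j = 0 → 0 ≤ b j) :
    ∃ e : ℝ, 0 < e ∧ ∀ e', 0 < e' → e' ≤ e → ∀ j ∈ J, 0 ≤ a j + e' * b j := by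
  classical
  induction J using Finset.induction_on with
  | empty => exact ⟨1, one_pos, by simp⟩
  | insert j J hj ih =>
    obtain ⟨e, he, h⟩ := ih (fun j hj => ha j (Finset.mem_insert_of_mem hj))
      (fun j hj => hb j (Finset.mem_insert_of_mem hj))
    have haj := ha j (Finset.mem_insert_self _ _)
    have hbj := hb j (Finset.mem_insert_self _ _)
    rcases haj.eq_or_lt with h0 | h0
    · refine ⟨e, he, fun e' h1 h2 j' hj' => ?_⟩
      rcases Finset.mem_insert.1 hj' with rfl | hj'
      · have := hbj h0.symm; positivity
      · exact h e' h1 h2 j' hj'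
    · refine ⟨min e (a j / (|b j| + 1)), by positivity, fun e' h1 h2 j' hj' => ?_⟩
      rcases Finset.mem_insert.1 hj' with rfl | hj'
      · have h3 : e' ≤ a j' / (|b j'| + 1) := h2.trans (min_le_right _ _)
        rw [le_div_iff₀ (by positivity)] at h3
        have := neg_abs_le (b j')
        nlinarith
      · exact h e' h1 (h2.trans (min_le_left _ _)) j' hj'

structure Fz (n : ℕ) (Λ : Fin 3 → ℕ → ℝ) (w : ℕ → ℝ) (H : Fin 3 → ℕ → ℕ → ℝ) : Prop where
  rhn : ∀ s c i k, k < i → i < n → 0 ≤ rh c (H s) i k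
  seam : ∀ s k, k ≤ n → H s n k = H s n 0 + H (s+1) k 0
  bd : ∀ s i, i ≤ n → H s i i = ∑ j ∈ Finset.range i, Λ s j
  wall : ∀ s i, i < n → w i ≤ H s (i+1) 0 - H s i 0
  out : ∀ s i k, ¬ (k ≤ i ∧ i ≤ n) → H s i k = 0

theorem rh_add {A : Type*} [AddCommGroup A] (c : Fin 3) (H G : ℕ → ℕ → A) (i k : ℕ) :
    rh c (H + G) i k = rh c H i k + rh c G i k := by
  simp only [rh, Pi.add_apply]; split_ifs <;> abel

theorem rh_smul (c : Fin 3) (e : ℝ) (G : ℕ → ℕ → ℝ) (i k : ℕ) :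
    rh c (e • G) i k = e * rh c G i k := by
  simp only [rh, Pi.smul_apply, smul_eq_mul]; split_ifs <;> ring

theorem rh_cont (s c : Fin 3) (i k : ℕ) :
    Continuous (fun H : Fin 3 → ℕ → ℕ → ℝ => rh c (H s) i k) := by
  unfold rh; split_ifs <;> fun_prop

theorem Fz.isHive {n Λ w H} (h : Fz n Λ w H) (s : Fin 3) : IsHive n (H s) :=
  IsHive.of_rh (h.rhn s)

theorem Fz.qnn {n Λ w H} (h : Fz n Λ w H) (hw : ∀ i, i < n → 0 ≤ w i) (s : Fin 3) :
    ∀ d i k, i + d = n → k < i → H s i k ≤ H s i (k+1) := by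
  intro d
  induction d with
  | zero =>
    intro i k hi hk
    obtain rfl : i = n := by omega
    rw [h.seam s k hk.le, h.seam s (k+1) hk]
    linarith [h.wall (s+1) k hk, hw k hk]
  | succ d ih =>
    intro i k hi hk
    have := ih (i+1) (k+1) (by omega) (by omega)
    have h2 := (h.isHive s).s2 i k hk (by omega)
    have : k + 1 + 1 = k + 2 := rfl
    rw [this] at *
    linarith

theorem Fz.bdd {n Λ w H} (h : Fz n Λ w H) (hw : ∀ i, i < n → 0 ≤ w i) (s : Fin 3) (i k : ℕ) :
    0 ≤ H s i k ∧ H s i k ≤ ∑ j ∈ Finset.range n, |Λ s j| := by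
  have hB : 0 ≤ ∑ j ∈ Finset.range n, |Λ s j| := Finset.sum_nonneg fun _ _ => abs_nonneg _
  by_cases hr : k ≤ i ∧ i ≤ n
  · obtain ⟨hk, hi⟩ := hr
    have h0 : ∀ i, i ≤ n → 0 ≤ H s i 0 := by
      intro i
      induction i with
      | zero => intro _; have := h.bd s 0 (by omega); simp at this; rw [this]
      | succ i ih => intro hi; linarith [h.wall s i hi, hw i hi, ih (by omega)]
    have h1 : ∀ d k, k + d ≤ i → H s i k ≤ H s i (k + d) := by
      intro d k
      induction d with
      | zero => intro _; exact le_rfl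
      | succ d ih =>
        intro hd
        exact (ih (by omega)).trans (h.qnn hw s (n - i) i (k+d) (by omega) (by omega))
    constructor
    · have := h1 k 0 (by omega)
      rw [zero_add] at this
      exact (h0 i hi).trans this
    · have := h1 (i - k) k (by omega)
      rw [show k + (i - k) = i by omega, h.bd s i hi] at this
      refine this.trans ?_
      calc _ ≤ ∑ j ∈ Finset.range i, |Λ s j| := Finset.sum_le_sum fun _ _ => le_abs_self _
        _ ≤ _ := Finset.sum_le_sum_of_subset_of_nonneg (by
            intro x; simp only [Finset.mem_range]; omega) (fun _ _ _ => abs_nonneg _)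
  · rw [h.out s i k hr]; exact ⟨le_rfl, hB⟩

theorem Fz.closed (n : ℕ) (Λ : Fin 3 → ℕ → ℝ) (w : ℕ → ℝ) : IsClosed {H | Fz n Λ w H} := by
  have : {H | Fz n Λ w H} = {H | ∀ s c i k, k < i → i < n → 0 ≤ rh c (H s) i k} ∩
      {H | ∀ s k, k ≤ n → H s n k = H s n 0 + H (s+1) k 0} ∩
      {H | ∀ s i, i ≤ n → H s i i = ∑ j ∈ Finset.range i, Λ s j} ∩
      {H | ∀ s i, i < n → w i ≤ H s (i+1) 0 - H s i 0} ∩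
      {H | ∀ s i k, ¬ (k ≤ i ∧ i ≤ n) → H s i k = 0} := by
    ext H
    constructor
    · rintro ⟨a, b, c, d, e⟩; exact ⟨⟨⟨⟨a, b⟩, c⟩, d⟩, e⟩
    · rintro ⟨⟨⟨⟨a, b⟩, c⟩, d⟩, e⟩; exact ⟨a, b, c, d, e⟩
  rw [this]
  refine IsClosed.inter (IsClosed.inter (IsClosed.inter (IsClosed.inter ?_ ?_) ?_) ?_) ?_
  · simp only [Set.ofPred_forall]
    refine isClosed_iInter fun s => isClosed_iInter fun c => isClosed_iInter fun i =>
      isClosed_iInter fun k => isClosed_iInter fun _ => isClosed_iInter fun _ => ?_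
    exact isClosed_le continuous_const (rh_cont s c i k)
  · simp only [Set.ofPred_forall]
    refine isClosed_iInter fun s => isClosed_iInter fun c => isClosed_iInter fun _ => ?_
    exact isClosed_eq (by fun_prop) (by fun_prop)
  · simp only [Set.ofPred_forall]
    refine isClosed_iInter fun s => isClosed_iInter fun c => isClosed_iInter fun _ => ?_
    exact isClosed_eq (by fun_prop) (by fun_prop)
  · simp only [Set.ofPred_forall]
    refine isClosed_iInter fun s => isClosed_iInter fun c => isClosed_iInter fun _ => ?_
    exact isClosed_le (by fun_prop) (by fun_prop)
  · simp only [Set.ofPred_forall]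
    refine isClosed_iInter fun s => isClosed_iInter fun c => isClosed_iInter fun _ =>
      isClosed_iInter fun _ => ?_
    exact isClosed_eq (by fun_prop) (by fun_prop)

theorem Fz.compact (n : ℕ) (Λ : Fin 3 → ℕ → ℝ) (w : ℕ → ℝ) (hw : ∀ i, i < n → 0 ≤ w i) :
    IsCompact {H | Fz n Λ w H} := by
  refine IsCompact.of_isClosed_subset (isCompact_Icc (a := (0 : Fin 3 → ℕ → ℕ → ℝ))
    (b := fun s _ _ => ∑ j ∈ Finset.range n, |Λ s j|)) (Fz.closed n Λ w) ?_
  intro H hH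
  exact ⟨fun s i k => (hH.bdd hw s i k).1, fun s i k => (hH.bdd hw s i k).2⟩

/-- direction space -/
structure Kd (n : ℕ) (f : Fin 3 → ℕ → ℕ → ℝ) : Prop where
  seam : ∀ s k, k ≤ n → f s n k = f s n 0 + f (s+1) k 0
  bd : ∀ s i, i ≤ n → f s i i = 0
  out : ∀ s i k, ¬ (k ≤ i ∧ i ≤ n) → f s i k = 0

theorem Fz.step {n Λ w H} (h : Fz n Λ w H) (f : Fin 3 → ℕ → ℕ → ℝ) (hf : Kd n f)
    (ht : ∀ s c i k, k < i → i < n → rh c (H s) i k = 0 → 0 ≤ rh c (f s) i k)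
    (hw : ∀ s i, i < n → H s (i+1) 0 - H s i 0 = w i → 0 ≤ f s (i+1) 0 - f s i 0) :
    ∃ e : ℝ, 0 < e ∧ ∀ e', 0 < e' → e' ≤ e → Fz n Λ w (H + e' • f) := by
  obtain ⟨e1, he1, h1⟩ := small_step
    (((Finset.univ ×ˢ Finset.univ ×ˢ Finset.range n ×ˢ Finset.range n :
      Finset (Fin 3 × Fin 3 × ℕ × ℕ))).filter (fun p => p.2.2.2 < p.2.2.1))
    (fun p => rh p.2.1 (H p.1) p.2.2.1 p.2.2.2) (fun p => rh p.2.1 (f p.1) p.2.2.1 p.2.2.2)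
    (by
      rintro ⟨s, c, i, k⟩ hp
      simp at hp
      exact h.rhn s c i k hp.2 hp.1.1)
    (by
      rintro ⟨s, c, i, k⟩ hp
      simp at hp
      exact ht s c i k hp.2 hp.1.1)
  obtain ⟨e2, he2, h2⟩ := small_step (Finset.univ ×ˢ Finset.range n : Finset (Fin 3 × ℕ))
    (fun p => H p.1 (p.2+1) 0 - H p.1 p.2 0 - w p.2) (fun p => f p.1 (p.2+1) 0 - f p.1 p.2 0)
    (by
      rintro ⟨s, i⟩ hp
      simp at hp
      have := h.wall s i hp
      simp only; linarith)
    (by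
      rintro ⟨s, i⟩ hp h0
      simp at hp
      exact hw s i hp (by simp only at h0; linarith))
  refine ⟨min e1 e2, by positivity, fun e' hp hle => ?_⟩
  refine ⟨?_, ?_, ?_, ?_, ?_⟩
  · intro s c i k hk hi
    have := h1 e' hp (hle.trans (min_le_left _ _)) (s, c, i, k) (by simp; omega)
    rw [Pi.add_apply, rh_add, Pi.smul_apply, rh_smul]
    exact this
  · intro s k hk
    simp only [Pi.add_apply, Pi.smul_apply, smul_eq_mul]
    rw [h.seam s k hk, hf.seam s k hk]; ring
  · intro s i hi
    simp only [Pi.add_apply, Pi.smul_apply, smul_eq_mul]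
    rw [h.bd s i hi, hf.bd s i hi]; ring
  · intro s i hi
    have := h2 e' hp (hle.trans (min_le_right _ _)) (s, i) (by simpa using hi)
    simp only [Pi.add_apply, Pi.smul_apply, smul_eq_mul]
    simp only at this
    linarith
  · intro s i k hk
    simp only [Pi.add_apply, Pi.smul_apply, smul_eq_mul]
    rw [h.out s i k hk, hf.out s i k hk]; ring

end NLS
end

section
namespace NLS

def tauH (H : Fin 3 → ℕ → ℕ → ℝ) : Fin 3 → Fin 3 → ℕ → ℕ → Prop := fun s c i k => rh c (H s) i k = 0
def twH (w : ℕ → ℝ) (H : Fin 3 → ℕ → ℕ → ℝ) : Fin 3 → ℕ → Prop :=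
  fun s i => H s (i+1) 0 - H s i 0 = w i

theorem extremal (n : ℕ) (Λ : Fin 3 → ℕ → ℝ) (w : ℕ → ℝ)
    (hΛ : ∀ s i, i + 1 < n → Λ s (i+1) < Λ s i) (hw : ∀ i, i < n → 0 ≤ w i)
    (hw' : ∀ i, i + 1 < n → w (i+1) < w i) (hne : ∃ H, Fz n Λ w H) :
    ∃ H, Fz n Λ w H ∧ (∀ s i k, k ≤ i → i ≤ n → linF n (H s) i k = 0) ∧
      (∀ f : Fin 3 → ℕ → ℕ → ℝ, Kc n (tauH H) (twH w H) f →
        ∀ s i k, k ≤ i → i ≤ n → f s i k = 0) := by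
  obtain ⟨H, hH, h1, h2⟩ := lp {H | Fz n Λ w H} (Fz.compact n Λ w hw) hne
    (fun H => ∑ s, ∑ i ∈ Finset.range (n+1), ∑ k ∈ Finset.range (i+1), H s i k)
    (fun H => ∑ s, ∑ i ∈ Finset.range (n+1), ∑ k ∈ Finset.range (i+1), (H s i k)^2)
    (by fun_prop) (by fun_prop)
    (by intro x f; simp only [Pi.add_apply, Finset.sum_add_distrib])
    (by
      intro x f
      simp only [Pi.add_apply, Pi.sub_apply, Finset.mul_sum, ← Finset.sum_add_distrib]
      refine Finset.sum_congr rfl fun s _ => Finset.sum_congr rfl fun i _ =>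
        Finset.sum_congr rfl fun k _ => ?_
      ring)
  change Fz n Λ w H at hH
  refine ⟨H, hH, ?_, ?_⟩
  · set F : Fin 3 → ℕ → ℕ → ℝ := fun s i k => if k ≤ i ∧ i ≤ n then (linF n (H s) i k : ℝ) else 0
      with hF
    have hFr : ∀ s i k, k ≤ i → i ≤ n → F s i k = linF n (H s) i k := by
      intro s i k hk hi; simp only [hF]; rw [if_pos ⟨hk, hi⟩]
    have hac : ∀ s i, i ≤ n → linF n (H s) i i = 0 := by
      intro s i hi
      refine linF_of ⟨?_, ?_, ?_⟩
      · rintro ⟨j, h1, h2, h3, h4⟩; omega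
      · rintro ⟨j, h1, h2, h3, h4⟩; omega
      · rintro ⟨j, m, h1, h2, h3, h4, h5⟩
        obtain rfl : j = m := by omega
        rw [hH.bd s _ h4.le, hH.bd s (j+2) h4, hH.bd s j (by omega), Finset.sum_range_succ,
          Finset.sum_range_succ] at h5
        linarith [hΛ s j h4]
    have hK : Kd n F := by
      refine ⟨?_, ?_, ?_⟩
      · intro s k hk
        rw [hFr s n k hk le_rfl, hFr s n 0 (by omega) le_rfl, hFr (s+1) k 0 (by omega) hk]
        have e0 : linF n (H s) n 0 = 0 := by
          refine linF_of ⟨?_, ?_, ?_⟩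
          · rintro ⟨j, h1, h2, h3, h4⟩; omega
          · rintro ⟨j, h1, h2, h3, h4⟩; omega
          · rintro ⟨j, m, h1, h2, h3, h4, h5⟩; omega
        have e1 : ¬ lin1 n (H s) n k := by rintro ⟨j, h1, h2, h3, h4⟩; omega
        have e2 : ¬ lin3 n (H s) n k := by rintro ⟨j, m, h1, h2, h3, h4, h5⟩; omega
        have e3 : ¬ lin2 n (H (s+1)) k 0 := by rintro ⟨j, h1, h2, h3, h4⟩; omega
        have e4 : ¬ lin3 n (H (s+1)) k 0 := by rintro ⟨j, m, h1, h2, h3, h4, h5⟩; omega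
        have e5 : lin2 n (H s) n k ↔ lin1 n (H (s+1)) k 0 := by
          constructor
          · rintro ⟨m, rfl, h2, h3, h4⟩
            refine ⟨m, rfl, by omega, h2, ?_⟩
            rw [hH.seam s (m+2) h2, hH.seam s (m+1) hk, hH.seam s m (by omega)] at h4
            linarith
          · rintro ⟨m, rfl, h2, h3, h4⟩
            refine ⟨m, rfl, h3, le_rfl, ?_⟩
            rw [hH.seam s (m+2) h3, hH.seam s (m+1) hk, hH.seam s m (by omega)]
            linarith
        rw [e0]
        by_cases hh : lin1 n (H (s+1)) k 0
        · have e6 := e5.2 hh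
          simp [linF, e1, e2, e3, e4, e6, hh]
        · have e6 : ¬ lin2 n (H s) n k := fun h => hh (e5.1 h)
          simp [linF, e1, e2, e3, e4, e6, hh]
      · intro s i hi
        rw [hFr s i i le_rfl hi, hac s i hi]; simp
      · intro s i k hk; simp only [hF]; rw [if_neg hk]
    obtain ⟨e, he, hst⟩ := hH.step F hK (by
      intro s c i k hk hi ht
      have := lin_rh (hH.isHive s) c i k hk hi ht
      refine this.trans (le_of_eq ?_)
      simp only [rh]
      rw [hFr s i k (by omega) (by omega), hFr s i (k+1) (by omega) (by omega),
        hFr s (i+1) k (by omega) (by omega), hFr s (i+1) (k+1) (by omega) (by omega),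
        hFr s (i+1) (k+2) (by omega) (by omega), hFr s (i-1) k (by omega) (by omega)]) (by
      intro s i hi ht
      rw [hFr s (i+1) 0 (by omega) (by omega), hFr s i 0 (by omega) (by omega)]
      have : linF n (H s) i 0 = 0 := by
        refine linF_of ⟨?_, ?_, ?_⟩
        · rintro ⟨j, rfl, h2, h3, h4⟩
          have := hH.wall s j (by omega)
          have := hw' j h3
          have e : j + 1 + 1 = j + 2 := rfl
          rw [e] at ht
          linarith
        · rintro ⟨j, h1, h2, h3, h4⟩; omega
        · rintro ⟨j, m, h1, h2, h3, h4, h5⟩; omega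
      rw [this]; simp)
    have hs := h1 (e • F) (hst e he le_rfl)
    simp only [Pi.smul_apply, smul_eq_mul, ← Finset.mul_sum] at hs
    have hs' : ∑ s, ∑ i ∈ Finset.range (n+1), ∑ k ∈ Finset.range (i+1), F s i k ≤ 0 := by
      by_contra hcon
      push Not at hcon
      have := mul_pos he hcon
      linarith
    have hnn : ∀ s i k, 0 ≤ F s i k := by
      intro s i k; simp only [hF]; split_ifs <;> simp
    intro s i k hk hi
    have hle : F s i k ≤ 0 := by
      refine le_trans ?_ hs'
      refine le_trans ?_ (Finset.single_le_sum (f := fun s => ∑ i ∈ Finset.range (n+1),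
        ∑ k ∈ Finset.range (i+1), F s i k) (fun s _ => Finset.sum_nonneg fun i _ =>
        Finset.sum_nonneg fun k _ => hnn s i k) (Finset.mem_univ s))
      refine le_trans ?_ (Finset.single_le_sum (f := fun i => 
        ∑ k ∈ Finset.range (i+1), F s i k) (fun i _ =>
        Finset.sum_nonneg fun k _ => hnn s i k) (Finset.mem_range.2 (show i < n+1 by omega)))
      exact Finset.single_le_sum (f := fun k => F s i k) (fun k _ => hnn s i k)
        (Finset.mem_range.2 (show k < i+1 by omega))
    rw [hFr s i k hk hi] at hle
    have : linF n (H s) i k ≤ 0 := by exact_mod_cast hle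
    omega
  · intro f hf
    set g : Fin 3 → ℕ → ℕ → ℝ := fun s i k => if k ≤ i ∧ i ≤ n then f s i k else 0 with hg
    have hgr : ∀ s i k, k ≤ i → i ≤ n → g s i k = f s i k := by
      intro s i k hk hi; simp only [hg]; rw [if_pos ⟨hk, hi⟩]
    have hK : Kd n g := by
      refine ⟨?_, ?_, ?_⟩
      · intro s k hk
        rw [hgr s n k hk le_rfl, hgr s n 0 (by omega) le_rfl, hgr (s+1) k 0 (by omega) hk]
        exact hf.seam s k hk
      · intro s i hi
        rw [hgr s i i le_rfl hi, hf.bd s i hi]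
      · intro s i k hk; simp only [hg]; rw [if_neg hk]
    have hK' : Kd n (-g) := by
      refine ⟨?_, ?_, ?_⟩
      · intro s k hk
        simp only [Pi.neg_apply]
        rw [hK.seam s k hk]; ring
      · intro s i hi
        simp only [Pi.neg_apply]
        rw [hK.bd s i hi]; ring
      · intro s i k hi
        simp only [Pi.neg_apply]
        rw [hK.out s i k hi]; ring
    have hr : ∀ s c i k, k < i → i < n → rh c (H s) i k = 0 → rh c (g s) i k = 0 := by
      intro s c i k hk hi ht
      rw [← hf.tight s c i k hk hi ht]
      simp only [rh]
      rw [hgr s i k (by omega) (by omega), hgr s i (k+1) (by omega) (by omega),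
        hgr s (i+1) k (by omega) (by omega), hgr s (i+1) (k+1) (by omega) (by omega),
        hgr s (i+1) (k+2) (by omega) (by omega), hgr s (i-1) k (by omega) (by omega)]
    have hwl : ∀ s i, i < n → H s (i+1) 0 - H s i 0 = w i → g s (i+1) 0 = g s i 0 := by
      intro s i hi ht
      rw [hgr s (i+1) 0 (by omega) (by omega), hgr s i 0 (by omega) (by omega)]
      exact hf.wall s i hi ht
    obtain ⟨e1, he1, hs1⟩ := hH.step g hK (fun s c i k hk hi ht => (hr s c i k hk hi ht).ge)
      (fun s i hi ht => by rw [hwl s i hi ht, sub_self])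
    obtain ⟨e2, he2, hs2⟩ := hH.step (-g) hK' (fun s c i k hk hi ht => by
        have := hr s c i k hk hi ht
        have e : rh c ((-g) s) i k = - rh c (g s) i k := by
          simp only [rh, Pi.neg_apply]; split_ifs <;> ring
        rw [e, this, neg_zero])
      (fun s i hi ht => by simp [hwl s i hi ht])
    have hm : 0 < min e1 e2 := lt_min he1 he2
    have := h2 (min e1 e2 • g) (hs1 _ hm (min_le_left _ _)) (by
      have := hs2 _ hm (min_le_right _ _)
      rw [smul_neg, ← sub_eq_add_neg] at this
      exact this)
    intro s i k hk hi
    have hle : (min e1 e2 * g s i k)^2 ≤ 0 := by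
      refine le_trans ?_ this
      simp only [Pi.smul_apply, smul_eq_mul]
      refine le_trans ?_ (Finset.single_le_sum (f := fun s => ∑ i ∈ Finset.range (n+1),
        ∑ k ∈ Finset.range (i+1), (min e1 e2 * g s i k)^2) (fun s _ => Finset.sum_nonneg fun i _ =>
        Finset.sum_nonneg fun k _ => sq_nonneg _) (Finset.mem_univ s))
      refine le_trans ?_ (Finset.single_le_sum (f := fun i => 
        ∑ k ∈ Finset.range (i+1), (min e1 e2 * g s i k)^2) (fun i _ =>
        Finset.sum_nonneg fun k _ => sq_nonneg _) (Finset.mem_range.2 (show i < n+1 by omega)))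
      exact Finset.single_le_sum (f := fun k => (min e1 e2 * g s i k)^2) (fun k _ => sq_nonneg _)
        (Finset.mem_range.2 (show k < i+1 by omega))
    have h0 := pow_eq_zero_iff (two_ne_zero) |>.1 (le_antisymm hle (sq_nonneg _))
    rw [← hgr s i k hk hi]
    rcases mul_eq_zero.1 h0 with h | h
    · exact absurd h hm.ne'
    · exact h

/-- simplicity from absence of linear points -/
theorem simple_of_lin {n : ℕ} {H : Fin 3 → ℕ → ℕ → ℝ}
    (h : ∀ s i k, k ≤ i → i ≤ n → linF n (H s) i k = 0) :
    (∀ s i k c c', k < i → i < n → tauH H s c i k → tauH H s c' i k → c = c') ∧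
    (∀ s i k, k + 1 < i → i < n → tauH H s 0 i k → tauH H s 1 i (k+1) → False) ∧
    (∀ s i k, k < i → i + 1 < n → tauH H s 1 i k → tauH H s 2 (i+1) k → False) ∧
    (∀ s i k, k < i → i + 1 < n → tauH H s 0 i k → tauH H s 2 (i+1) (k+1) → False) := by
  have n1 := fun s i k hk hi => (linF_eq_zero (h s i k hk hi)).1
  have n2 := fun s i k hk hi => (linF_eq_zero (h s i k hk hi)).2.1
  have n3 := fun s i k hk hi => (linF_eq_zero (h s i k hk hi)).2.2
  have e : ∀ m : ℕ, m + 1 + 1 = m + 2 := fun _ => rfl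
  refine ⟨?_, ?_, ?_, ?_⟩
  · intro s i k c c' hk hi h1 h2
    obtain ⟨j, rfl⟩ : ∃ j, i = j + 1 := ⟨i - 1, by omega⟩
    have a01 : tauH H s 0 (j+1) k → tauH H s 1 (j+1) k → False := by
      intro h1 h2
      simp [tauH, rh] at h1 h2
      refine n2 s (j+2) (k+1) (by omega) (by omega) ⟨k, rfl, by omega, by omega, ?_⟩
      simp only [e] at h1 h2
      linarith
    have a12 : tauH H s 1 (j+1) k → tauH H s 2 (j+1) k → False := by
      intro h1 h2
      simp [tauH, rh] at h1 h2
      refine n1 s (j+1) k (by omega) (by omega) ⟨j, rfl, by omega, by omega, ?_⟩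
      simp only [e] at h1 h2
      linarith
    have a02 : tauH H s 0 (j+1) k → tauH H s 2 (j+1) k → False := by
      intro h1 h2
      simp [tauH, rh] at h1 h2
      refine n3 s (j+1) (k+1) (by omega) (by omega) ⟨j, k, rfl, rfl, by omega, by omega, ?_⟩
      simp only [e] at h1 h2
      linarith
    rcases fin3 c with rfl | rfl | rfl <;> rcases fin3 c' with rfl | rfl | rfl <;>
      first | rfl | exact (a01 ‹_› ‹_›).elim | exact (a12 ‹_› ‹_›).elim | exact (a02 ‹_› ‹_›).elim
  · intro s i k hk hi h1 h2
    simp [tauH, rh] at h1 h2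
    refine n2 s i (k+1) (by omega) (by omega) ⟨k, rfl, by omega, by omega, ?_⟩
    simp only [e] at h1 h2
    linarith
  · intro s i k hk hi h1 h2
    simp [tauH, rh] at h1 h2
    refine n1 s (i+1) (k+1) (by omega) (by omega) ⟨i, rfl, by omega, by omega, ?_⟩
    simp only [e] at h1 h2
    linarith
  · intro s i k hk hi h1 h2
    simp [tauH, rh] at h1 h2
    refine n3 s (i+1) (k+1) (by omega) (by omega) ⟨i, k, rfl, rfl, by omega, by omega, ?_⟩
    simp only [e] at h1 h2
    linarith

end NLS
end

section
namespace NLS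
open Filter Topology

/-- perturbed feasibility -/
theorem pert (n : ℕ) (L : Fin 3 → ℕ → ℝ) (h : MH (R := ℝ) n L) (e : ℝ) (he : 0 ≤ e) :
    ∃ H, Fz n (fun s i => L s i + e * (3*n - 2*i - 1)) (fun i => e * (2*n-2*i-1)) H := by
  obtain ⟨H, hH⟩ := h
  set G : Fin 3 → ℕ → ℕ → ℝ := fun s i k => if k ≤ i ∧ i ≤ n then
    H s i k + e * (2*n*i+n*k+i*k-k^2-i^2) else 0 with hG
  have hGr : ∀ s i k, k ≤ i → i ≤ n → G s i k = H s i k + e * (2*n*i+n*k+i*k-k^2-i^2) := by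
    intro s i k hk hi; simp only [hG]; rw [if_pos ⟨hk, hi⟩]
  refine ⟨G, ?_, ?_, ?_, ?_, ?_⟩
  · intro s c i k hk hi
    have a := (hH.hive s).rh c i k hk hi
    obtain ⟨j, rfl⟩ : ∃ j, i = j + 1 := ⟨i - 1, by omega⟩
    have : rh c (G s) (j+1) k = rh c (H s) (j+1) k + e := by
      simp only [rh, Nat.add_sub_cancel]
      rw [hGr s (j+1) k (by omega) (by omega), hGr s (j+1) (k+1) (by omega) (by omega),
        hGr s (j+1+1) k (by omega) (by omega), hGr s (j+1+1) (k+1) (by omega) (by omega),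
        hGr s (j+1+1) (k+2) (by omega) (by omega), hGr s j k (by omega) (by omega)]
      push_cast
      split_ifs <;> ring
    rw [this]; linarith
  · intro s k hk
    rw [hGr s n k hk le_rfl, hGr s n 0 (by omega) le_rfl, hGr (s+1) k 0 (by omega) hk, hH.seam s k hk]
    push_cast; ring
  · intro s i hi
    rw [hGr s i i le_rfl hi, hH.bd s i hi, Finset.sum_add_distrib, ← Finset.mul_sum]
    congr 2
    clear hi
    induction i with
    | zero => simp
    | succ i ih => rw [Finset.sum_range_succ, ← ih]; push_cast; ring
  · intro s i hi
    rw [hGr s (i+1) 0 (by omega) (by omega), hGr s i 0 (by omega) (by omega)]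
    have := hH.ab s i hi
    push_cast
    nlinarith
  · intro s i k hk; simp only [hG]; rw [if_neg hk]

theorem limit_step (n : ℕ) (L : Fin 3 → ℕ → ℝ) (hL : ∀ s, Antitone (L s)) (h : MH (R := ℝ) n L) :
    ∃ (H : Fin 3 → ℕ → ℕ → ℝ) (tau : Fin 3 → Fin 3 → ℕ → ℕ → Prop) (tw : Fin 3 → ℕ → Prop),
      IsMH n L H ∧
      (∀ s c i k, k < i → i < n → tau s c i k → rh c (H s) i k = 0) ∧
      (∀ s i, i < n → tw s i → H s (i+1) 0 = H s i 0) ∧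
      (∀ s i k c c', k < i → i < n → tau s c i k → tau s c' i k → c = c') ∧
      (∀ s i k, k + 1 < i → i < n → tau s 0 i k → tau s 1 i (k+1) → False) ∧
      (∀ s i k, k < i → i + 1 < n → tau s 1 i k → tau s 2 (i+1) k → False) ∧
      (∀ s i k, k < i → i + 1 < n → tau s 0 i k → tau s 2 (i+1) (k+1) → False) ∧
      (∀ f : Fin 3 → ℕ → ℕ → ℝ, Kc n tau tw f → ∀ s i k, k ≤ i → i ≤ n → f s i k = 0) := by
  set e : ℕ → ℝ := fun m => 1 / ((m:ℝ) + 1) with hedef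
  have he : ∀ m, 0 < e m := fun m => by simp only [hedef]; positivity
  have he1 : ∀ m, e m ≤ 1 := fun m => by
    simp only [hedef]
    rw [div_le_one (by positivity)]
    have : (0:ℝ) ≤ m := by positivity
    linarith
  have key : ∀ m, _ := fun m => extremal n (fun s i => L s i + e m * (3*n - 2*i - 1))
    (fun i => e m * (2*n-2*i-1)) (by
      intro s i hi
      have := hL s (Nat.le_succ i)
      have := he m
      push_cast
      nlinarith) (by
      intro i hi
      have : (i:ℝ) + 1 ≤ n := by exact_mod_cast hi
      exact mul_nonneg (he m).le (by linarith)) (by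
      intro i hi
      have := he m
      push_cast
      nlinarith) (pert n L h (e m) (he m).le)
  choose Hm hFz hlin hinj using key
  set U : Ultrafilter ℕ := hyperfilter ℕ with hU
  have hlim : ∀ s i k, ∃ x, Tendsto (fun m => Hm m s i k) U (𝓝 x) := by
    intro s i k
    set B : ℝ := ∑ j ∈ Finset.range n, (|L s j| + |(3*n - 2*j - 1 : ℝ)|)
    have hb : ∀ m, Hm m s i k ∈ Set.Icc 0 B := by
      intro m
      have := (hFz m).bdd (by
        intro i hi
        have : (i:ℝ) + 1 ≤ n := by exact_mod_cast hi
        exact mul_nonneg (he m).le (by linarith)) s i k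
      refine ⟨this.1, this.2.trans (Finset.sum_le_sum fun j _ => ?_)⟩
      refine (abs_add_le _ _).trans ?_
      rw [abs_mul, abs_of_pos (he m)]
      have := mul_le_mul_of_nonneg_right (he1 m) (abs_nonneg (3*n - 2*j - 1 : ℝ))
      linarith
    obtain ⟨x, _, hx⟩ := (isCompact_Icc (a := (0:ℝ)) (b := B)).ultrafilter_le_nhds
      (U.map (fun m => Hm m s i k)) (by
        rw [le_principal_iff]
        exact Filter.mem_map.2 (Filter.Eventually.of_forall hb))
    exact ⟨x, hx⟩
  choose H hH using hlim
  have hel : Tendsto e U (𝓝 0) := tendsto_one_div_add_atTop_nhds_zero_nat.mono_left Nat.hyperfilter_le_atTop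
  have hrh : ∀ s c i k, Tendsto (fun m => rh c (Hm m s) i k) U (𝓝 (rh c (H s) i k)) := by
    intro s c i k
    simp only [rh]
    split_ifs
    · exact (((hH _ _ _).add (hH _ _ _)).sub (hH _ _ _)).sub (hH _ _ _)
    · exact (((hH _ _ _).add (hH _ _ _)).sub (hH _ _ _)).sub (hH _ _ _)
    · exact (((hH _ _ _).add (hH _ _ _)).sub (hH _ _ _)).sub (hH _ _ _)
  refine ⟨H, fun s c i k => ∀ᶠ m in (U : Filter ℕ), tauH (Hm m) s c i k,
    fun s i => ∀ᶠ m in (U : Filter ℕ), twH (fun i => e m * (2*n-2*i-1)) (Hm m) s i,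
    ⟨?_, ?_, ?_, ?_⟩, ?_, ?_, ?_, ?_, ?_, ?_, ?_⟩
  · intro s
    refine IsHive.of_rh fun c i k hk hi => ?_
    exact ge_of_tendsto' (hrh s c i k) fun m => (hFz m).rhn s c i k hk hi
  · intro s k hk
    exact tendsto_nhds_unique (hH s n k) (((hH s n 0).add (hH (s+1) k 0)).congr
      fun m => ((hFz m).seam s k hk).symm)
  · intro s i hi
    refine tendsto_nhds_unique (hH s i i) ?_
    have : Tendsto (fun m => ∑ j ∈ Finset.range i, (L s j + e m * (3*n - 2*j - 1))) U
        (𝓝 (∑ j ∈ Finset.range i, (L s j + 0 * (3*n - 2*j - 1)))) :=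
      tendsto_finset_sum _ fun j _ => tendsto_const_nhds.add (hel.mul tendsto_const_nhds)
    simp only [zero_mul, add_zero] at this
    exact this.congr fun m => ((hFz m).bd s i hi).symm
  · intro s i hi
    have a : Tendsto (fun m => e m * (2*n-2*i-1)) U (𝓝 (0 * (2*n-2*i-1))) :=
      hel.mul tendsto_const_nhds
    have := le_of_tendsto_of_tendsto' a ((hH s (i+1) 0).sub (hH s i 0))
      fun m => (hFz m).wall s i hi
    linarith
  · intro s c i k hk hi ht
    exact tendsto_nhds_unique (hrh s c i k) (tendsto_const_nhds.congr' (ht.mono fun m hm => hm.symm))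
  · intro s i hi ht
    have a : Tendsto (fun m => e m * (2*n-2*i-1)) U (𝓝 (0 * (2*n-2*i-1))) :=
      hel.mul tendsto_const_nhds
    have := tendsto_nhds_unique ((hH s (i+1) 0).sub (hH s i 0)) (a.congr'
      (ht.mono fun m hm => hm.symm))
    linarith
  · intro s i k c c' hk hi h1 h2
    obtain ⟨m, a, b⟩ := (h1.and h2).exists
    exact (simple_of_lin (hlin m)).1 s i k c c' hk hi a b
  · intro s i k hk hi h1 h2
    obtain ⟨m, a, b⟩ := (h1.and h2).exists
    exact (simple_of_lin (hlin m)).2.1 s i k hk hi a b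
  · intro s i k hk hi h1 h2
    obtain ⟨m, a, b⟩ := (h1.and h2).exists
    exact (simple_of_lin (hlin m)).2.2.1 s i k hk hi a b
  · intro s i k hk hi h1 h2
    obtain ⟨m, a, b⟩ := (h1.and h2).exists
    exact (simple_of_lin (hlin m)).2.2.2 s i k hk hi a b
  · intro f hf
    have ev : ∀ p : ℕ → Prop, ∀ᶠ m in (U : Filter ℕ), (p m → ∀ᶠ m in (U : Filter ℕ), p m) := by
      intro p
      rcases U.eventually_or.1 (Eventually.of_forall fun m => em (p m)) with h | h
      · exact Eventually.of_forall fun _ _ => h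
      · exact h.mono fun m hm hp => absurd hp hm
    have e1 : ∀ᶠ m in (U : Filter ℕ), ∀ s c, ∀ i ∈ Finset.range n, ∀ k ∈ Finset.range n,
        (tauH (Hm m) s c i k → ∀ᶠ m in (U : Filter ℕ), tauH (Hm m) s c i k) := by
      refine eventually_all.2 fun s => eventually_all.2 fun c => (Finset.eventually_all _).2
        fun i _ => (Finset.eventually_all _).2 fun k _ => ev (fun m => tauH (Hm m) s c i k)
    have e2 : ∀ᶠ m in (U : Filter ℕ), ∀ s, ∀ i ∈ Finset.range n,
        (twH (fun i => e m * (2*n-2*i-1)) (Hm m) s i →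
          ∀ᶠ m in (U : Filter ℕ), twH (fun i => e m * (2*n-2*i-1)) (Hm m) s i) := by
      refine eventually_all.2 fun s => (Finset.eventually_all _).2
        fun i _ => ev (fun m => twH (fun i => e m * (2*n-2*i-1)) (Hm m) s i)
    obtain ⟨m, a, b⟩ := (e1.and e2).exists
    refine hinj m f ⟨hf.seam, hf.bd, ?_, ?_⟩
    · intro s c i k hk hi ht
      exact hf.tight s c i k hk hi (a s c i (Finset.mem_range.2 hi) k
        (Finset.mem_range.2 (hk.trans hi)) ht)
    · intro s i hi ht
      exact hf.wall s i hi (b s i (Finset.mem_range.2 hi) ht)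

def Dy : AddSubgroup ℝ where
  carrier := {x | ∃ k : ℕ, ∃ a : ℤ, 2^k * x = a}
  zero_mem' := ⟨0, 0, by simp⟩
  add_mem' := by
    rintro x y ⟨k, a, h⟩ ⟨l, b, h'⟩
    refine ⟨k + l, 2^l * a + 2^k * b, ?_⟩
    push_cast
    rw [← h, ← h']; ring
  neg_mem' := by
    rintro x ⟨k, a, h⟩
    exact ⟨k, -a, by push_cast; rw [← h]; ring⟩

theorem mem_Dy (x : ℝ) : x ∈ Dy ↔ ∃ k : ℕ, ∃ a : ℤ, 2^k * x = a := Iff.rfl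

theorem P4thm (N : ℕ) (L : Fin 3 → ℕ → ℕ) (hL : ∀ s, Antitone (L s))
    (h : MH (R := ℝ) N (fun s i => (L s i : ℝ))) :
    ∃ k : ℕ, MH (R := ℤ) N (fun s i => ((2^k * L s i : ℕ) : ℤ)) := by
  obtain ⟨H, tau, tw, hH, h1, h2, s1, s2, s3, s4, hinj⟩ := limit_step N _
    (fun s i j hij => by exact_mod_cast hL s hij) h
  have hdy := surfH (A := ℝ ⧸ Dy) (by
    intro a
    induction a using QuotientAddGroup.induction_on with
    | H x =>
      intro hx
      rw [← QuotientAddGroup.mk_zsmul, QuotientAddGroup.eq_zero_iff] at hx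
      rw [QuotientAddGroup.eq_zero_iff]
      obtain ⟨k, a, hk⟩ := hx
      refine ⟨k+1, a, ?_⟩
      rw [← hk, pow_succ]; simp; ring) N tau tw s1 s2 s3 s4 hinj
      (fun s i k => QuotientAddGroup.mk' Dy (H s i k)) ⟨?_, ?_, ?_, ?_⟩
  · have hd : ∀ s i k, k ≤ i → i ≤ N → ∃ m : ℕ, ∃ a : ℤ, 2^m * H s i k = a := by
      intro s i k hk hi
      have := hdy s i k hk hi
      exact (QuotientAddGroup.eq_zero_iff _).1 this
    obtain ⟨M, hM⟩ : ∃ M : ℕ, ∀ s i k, k ≤ i → i ≤ N → ∃ a : ℤ, 2^M * H s i k = a := by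
      have : ∀ x : Fin 3 × Fin (N+1) × Fin (N+1), ∃ m : ℕ, ∀ M ≥ m, x.2.2.1 ≤ x.2.1.1 → ∃ a : ℤ,
          2^M * H x.1 x.2.1.1 x.2.2.1 = a := by
        intro x
        by_cases hx : x.2.2.1 ≤ x.2.1.1
        · obtain ⟨m, a, hm⟩ := hd x.1 x.2.1.1 x.2.2.1 hx (by omega)
          refine ⟨m, fun M hM _ => ⟨2^(M-m) * a, ?_⟩⟩
          push_cast
          rw [← hm, ← mul_assoc, ← pow_add, Nat.sub_add_cancel hM]
        · exact ⟨0, fun _ _ h => absurd h hx⟩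
      choose m hm using this
      refine ⟨∑ x, m x, fun s i k hk hi => ?_⟩
      exact hm (s, ⟨i, by omega⟩, ⟨k, by omega⟩) _
        (Finset.single_le_sum (fun _ _ => Nat.zero_le _) (Finset.mem_univ _)) hk
    have hM' : ∀ s i k, ∃ a : ℤ, (k ≤ i → i ≤ N → 2^M * H s i k = a) := by
      intro s i k
      by_cases hx : k ≤ i ∧ i ≤ N
      · obtain ⟨a, ha⟩ := hM s i k hx.1 hx.2
        exact ⟨a, fun _ _ => ha⟩
      · exact ⟨0, fun a b => absurd ⟨a, b⟩ hx⟩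
    choose G hG using hM'
    have hp : (0:ℝ) < 2^M := by positivity
    refine ⟨M, G, ?_, ?_, ?_, ?_⟩
    · intro s
      refine ⟨?_, ?_, ?_⟩
      · intro i k hk hi
        have := mul_le_mul_of_nonneg_left ((hH.hive s).s1 i k hk hi) hp.le
        rw [mul_add, mul_add, hG _ _ _ (by omega) (by omega), hG _ _ _ (by omega) (by omega),
          hG _ _ _ (by omega) (by omega), hG _ _ _ (by omega) (by omega)] at this
        exact_mod_cast this
      · intro i k hk hi
        have := mul_le_mul_of_nonneg_left ((hH.hive s).s2 i k hk hi) hp.le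
        rw [mul_add, mul_add, hG _ _ _ (by omega) (by omega), hG _ _ _ (by omega) (by omega),
          hG _ _ _ (by omega) (by omega), hG _ _ _ (by omega) (by omega)] at this
        exact_mod_cast this
      · intro i k hk hi
        have := mul_le_mul_of_nonneg_left ((hH.hive s).s3 i k hk hi) hp.le
        rw [mul_add, mul_add, hG _ _ _ (by omega) (by omega), hG _ _ _ (by omega) (by omega),
          hG _ _ _ (by omega) (by omega), hG _ _ _ (by omega) (by omega)] at this
        exact_mod_cast this
    · intro s k hk
      have := congrArg (fun x => 2^M * x) (hH.seam s k hk)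
      simp only [mul_add] at this
      rw [hG _ _ _ (by omega) (by omega), hG _ _ _ (by omega) (by omega),
        hG _ _ _ (by omega) (by omega)] at this
      exact_mod_cast this
    · intro s i hi
      have := congrArg (fun x => 2^M * x) (hH.bd s i hi)
      simp only [Finset.mul_sum] at this
      rw [hG _ _ _ (by omega) (by omega)] at this
      exact_mod_cast this
    · intro s i hi
      have := mul_le_mul_of_nonneg_left (hH.ab s i hi) hp.le
      rw [hG _ _ _ (by omega) (by omega), hG _ _ _ (by omega) (by omega)] at this
      exact_mod_cast this
  · intro s k hk
    rw [← map_add, hH.seam s k hk]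
  · intro s i hi
    rw [hH.bd s i hi]
    refine (QuotientAddGroup.eq_zero_iff _).2 ⟨0, ∑ j ∈ Finset.range i, (L s j : ℤ), by push_cast; ring⟩
  · intro s c i k hk hi ht
    have := congrArg (QuotientAddGroup.mk' Dy) (h1 s c i k hk hi ht)
    rw [map_zero] at this
    rw [← this]
    simp only [rh]
    split_ifs <;> simp only [map_add, map_sub]
  · intro s i hi ht
    rw [h2 s i hi ht]

end NLS
end

section
namespace NLS

set_option linter.unusedSectionVars false

section
variable {K V : Type} [Fintype K] [Fintype V] [DecidableEq K] [DecidableEq V]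

theorem z2 (a : ZMod 2) : a = 0 ∨ a = 1 := by revert a; decide
theorem z2s (a : ZMod 2) : a + a = 0 := by revert a; decide

/-- boundary operator of the 2-regular multigraph -/
def Dn (n1 n2 : K → V) (o : K → ZMod 2) (z : K → ZMod 2) (v : V) : ZMod 2 :=
  ∑ c, o c * z c * ((if n1 c = v then 1 else 0) + (if n2 c = v then 1 else 0))

theorem Dn_add (n1 n2 : K → V) (o : K → ZMod 2) (z z' : K → ZMod 2) (v : V) :
    Dn n1 n2 o (z + z') v = Dn n1 n2 o z v + Dn n1 n2 o z' v := by
  simp only [Dn, ← Finset.sum_add_distrib, Pi.add_apply]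
  exact Finset.sum_congr rfl fun _ _ => by ring

theorem Dn_sum (n1 n2 : K → V) (o : K → ZMod 2) (z : K → ZMod 2) : ∑ v, Dn n1 n2 o z v = 0 := by
  simp only [Dn]
  rw [Finset.sum_comm]
  refine Finset.sum_eq_zero fun c _ => ?_
  rw [← Finset.mul_sum, Finset.sum_add_distrib]
  simp [z2s]

def eqv (n1 n2 : K → V) (o : K → ZMod 2) (v w : V) : Prop :=
  ∃ δ, ∀ u, Dn n1 n2 o δ u = (if v = u then 1 else 0) + (if w = u then 1 else 0)

theorem eqv.refl (n1 n2 : K → V) (o : K → ZMod 2) (v : V) : eqv n1 n2 o v v :=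
  ⟨0, fun u => by rw [z2s]; simp [Dn]⟩

theorem eqv.symm {n1 n2 : K → V} {o : K → ZMod 2} {v w : V} (h : eqv n1 n2 o v w) :
    eqv n1 n2 o w v := by
  obtain ⟨d, h⟩ := h
  exact ⟨d, fun u => by rw [h, add_comm]⟩

theorem eqv.trans {n1 n2 : K → V} {o : K → ZMod 2} {v w x : V} (h : eqv n1 n2 o v w)
    (h' : eqv n1 n2 o w x) : eqv n1 n2 o v x := by
  obtain ⟨d, h⟩ := h
  obtain ⟨d', h'⟩ := h'
  refine ⟨d + d', fun u => ?_⟩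
  rw [Dn_add, h, h']
  have := z2s (if w = u then (1 : ZMod 2) else 0)
  linear_combination this

theorem eqv_cell (n1 n2 : K → V) (o : K → ZMod 2) (c : K) (hc : o c = 1) :
    eqv n1 n2 o (n1 c) (n2 c) := by
  refine ⟨Pi.single c 1, fun u => ?_⟩
  simp only [Dn]
  rw [Finset.sum_eq_single c]
  · simp [hc]
  · intro b _ hb; simp [hb]
  · simp

open Classical in
noncomputable def ind (n1 n2 : K → V) (o : K → ZMod 2) (x : V) (c : K) : ZMod 2 :=
  if eqv n1 n2 o x (n1 c) then 1 else 0

open Classical in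
noncomputable def indV (n1 n2 : K → V) (o : K → ZMod 2) (x : V) (v : V) : ZMod 2 :=
  if eqv n1 n2 o x v then 1 else 0

theorem Dn_ind (n1 n2 : K → V) (o : K → ZMod 2) (x : V) (z : K → ZMod 2) (v : V) :
    Dn n1 n2 o (ind n1 n2 o x * z) v = indV n1 n2 o x v * Dn n1 n2 o z v := by
  classical
  simp only [Dn, Finset.mul_sum]
  refine Finset.sum_congr rfl fun c _ => ?_
  rcases z2 (o c) with h | h
  · rw [h]; simp
  · have := eqv_cell n1 n2 o c h
    have e1 : n1 c = v → ind n1 n2 o x c = indV n1 n2 o x v := by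
      rintro rfl; rfl
    have e2 : n2 c = v → ind n1 n2 o x c = indV n1 n2 o x v := by
      rintro rfl
      simp only [ind, indV]
      exact if_congr ⟨fun h => h.trans this, fun h => h.trans this.symm⟩ rfl rfl
    simp only [Pi.mul_apply, h]
    by_cases h1 : n1 c = v
    · rw [e1 h1]; ring
    · by_cases h2 : n2 c = v
      · rw [e2 h2]; ring
      · simp [h1, h2]

theorem core1 (n1 n2 : K → V) (o : K → ZMod 2) (ε : V → ZMod 2) (χ : V → V)
    (hχ : ∀ v, χ (χ v) = v) (hχ' : ∀ v, χ v ≠ v) (lv : V → K) (act : V → Prop)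
    (hlv : ∀ v, act v → o (lv v) = 1 ∧ (n1 (lv v) = v ∨ n2 (lv v) = v))
    (hact : ∀ z v, ¬ act v → Dn n1 n2 o z v = 0) (hε : ∀ v, ¬ act v → ε v = 0)
    (hbal : ∀ v, Dn n1 n2 o 1 v = 0) (h0 : ∑ v, ε v = 0)
    (hcross : ∀ y1 y2 : K → ZMod 2, (∀ v, Dn n1 n2 o y1 v = 0) → (∀ v, Dn n1 n2 o y2 v = 0) →
      (∀ c, y1 c * y2 c = 0) → ∑ v, ε v * y1 (lv v) = 1 → ∑ v, ε v * y2 (lv v) = 1 →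
      ∃ v, act v ∧ act (χ v) ∧ y1 (lv v) = 1 ∧ y2 (lv (χ v)) = 1) :
    ∃ z, ∀ v, Dn n1 n2 o z v + ε v = 1 →
      Dn n1 n2 o z (χ v) + ε (χ v) = 1 ∧ z (lv v) = 0 ∧ z (lv (χ v)) = 0 := by
  classical
  set D := Dn n1 n2 o with hD
  set vi : (K → ZMod 2) → V → ZMod 2 := fun z v => D z v + ε v with hvi
  set gd : (K → ZMod 2) → V → Prop := fun z v => vi z v = 1 ∧ vi z (χ v) = 1 ∧ z (lv v) = 0 ∧
    z (lv (χ v)) = 0 with hgd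
  set VS : (K → ZMod 2) → Finset V := fun z => Finset.univ.filter (fun v => vi z v = 1) with hVS
  set BS : (K → ZMod 2) → Finset V := fun z =>
    Finset.univ.filter (fun v => vi z v = 1 ∧ ¬ gd z v) with hBS
  have hBc : ∀ z, (BS z).card ≤ Fintype.card V := fun z => Finset.card_le_univ _
  obtain ⟨z, -, hmin⟩ := Finset.exists_min_image (Finset.univ : Finset (K → ZMod 2))
    (fun z => (Fintype.card V + 1) * (VS z).card + (BS z).card) ⟨0, Finset.mem_univ _⟩
  have m1 : ∀ z', ¬ (VS z').card < (VS z).card := by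
    intro z' h
    have := hmin z' (Finset.mem_univ _)
    have := hBc z'
    have : (Fintype.card V + 1) * ((VS z').card + 1) ≤ (Fintype.card V + 1) * (VS z).card :=
      Nat.mul_le_mul_left _ h
    rw [mul_add, mul_one] at this
    omega
  have m2 : ∀ z', (VS z').card ≤ (VS z).card → ¬ (BS z').card < (BS z).card := by
    intro z' h h'
    have := hmin z' (Finset.mem_univ _)
    have : (Fintype.card V + 1) * ((VS z').card) ≤ (Fintype.card V + 1) * (VS z).card :=
      Nat.mul_le_mul_left _ h
    omega
  refine ⟨z, ?_⟩
  by_contra hcon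
  push Not at hcon
  obtain ⟨x1, hx1, hx1b⟩ := hcon
  have hb1 : ¬ gd z x1 := by
    rintro ⟨_, a, b, c⟩; exact hx1b a b c
  have hx1 : vi z x1 = 1 := hx1
  -- no two equivalent violations
  have huniq : ∀ v w, vi z v = 1 → vi z w = 1 → eqv n1 n2 o v w → v = w := by
    intro v w hv hw ⟨d, hd⟩
    by_contra hne
    apply m1 (z + d)
    apply Finset.card_lt_card
    refine ⟨?_, ?_⟩
    · intro u hu
      simp only [hVS, Finset.mem_filter, Finset.mem_univ, true_and] at hu ⊢
      simp only [hvi, hD, Dn_add, hd] at hu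
      by_cases h1 : v = u
      · rw [← h1]; exact hv
      · by_cases h2 : w = u
        · rw [← h2]; exact hw
        · rw [if_neg h1, if_neg h2] at hu
          simp only [hvi, hD]; rw [← hu]; ring
    · intro hs
      have := hs (show v ∈ VS z by simp [hVS, hv])
      simp only [hVS, Finset.mem_filter, Finset.mem_univ, true_and] at this
      simp only [hvi, hD, Dn_add, hd] at this
      rw [if_pos trivial, if_neg (Ne.symm hne)] at this
      simp only [hvi, hD] at hv
      have h2 := z2s 1
      have : (1:ZMod 2) = 0 := by linear_combination hv - this + h2
      exact absurd this (by decide)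
  have gsym : ∀ z v, gd z v → gd z (χ v) := by
    rintro z v ⟨a, b, c, d⟩
    refine ⟨b, ?_, d, ?_⟩
    · rw [hχ]; exact a
    · rw [hχ]; exact c
  -- second bad violation
  obtain ⟨x2, hx2, hb2, hne⟩ : ∃ x2, vi z x2 = 1 ∧ ¬ gd z x2 ∧ x1 ≠ x2 := by
    by_contra hno
    push Not at hno
    have s0 : ∑ v, vi z v = 0 := by
      simp only [hvi, Finset.sum_add_distrib, h0, hD, Dn_sum, add_zero]
    have sg : ∑ v, (if gd z v then (1:ZMod 2) else 0) = 0 := by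
      refine Finset.sum_involution (fun v _ => χ v) ?_ ?_ ?_ ?_
      · intro v _
        rw [if_congr (show gd z (χ v) ↔ gd z v from ⟨fun h => by
          have := gsym z _ h; rwa [hχ] at this, gsym z v⟩) rfl rfl, z2s]
      · intro v _ _; exact hχ' v
      · intro v _; exact Finset.mem_univ _
      · intro v _; exact hχ v
    have : ∑ v, (vi z v + (if gd z v then (1:ZMod 2) else 0)) = 1 := by
      rw [Finset.sum_eq_single x1]
      · rw [if_neg hb1, add_zero, hx1]
      · intro v _ hv
        by_cases hg : gd z v
        · rw [if_pos hg, hg.1]; exact z2s 1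
        · rcases z2 (vi z v) with h | h
          · rw [if_neg hg, add_zero, h]
          · exact absurd (hno v h hg).symm hv
      · simp
    rw [Finset.sum_add_distrib, s0, sg] at this
    exact absurd this (by decide)
  have hne12 : ¬ eqv n1 n2 o x1 x2 := fun h => hne (huniq _ _ hx1 hx2 h)
  have hil : ∀ x v, act v → ind n1 n2 o x (lv v) = indV n1 n2 o x v := by
    intro x v hv
    obtain ⟨a, b⟩ := hlv v hv
    have := eqv_cell n1 n2 o _ a
    rcases b with b | b
    · simp only [ind, indV, b]
    · rw [b] at this
      simp only [ind, indV]
      exact if_congr ⟨fun h => h.trans this, fun h => h.trans this.symm⟩ rfl rfl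
  have hdis : ∀ c, ind n1 n2 o x1 c * ind n1 n2 o x2 c = 0 := by
    intro c
    simp only [ind]
    by_cases h1 : eqv n1 n2 o x1 (n1 c)
    · by_cases h2 : eqv n1 n2 o x2 (n1 c)
      · exact absurd (h1.trans h2.symm) hne12
      · simp [h2]
    · simp [h1]
  have hDi : ∀ x v, D (ind n1 n2 o x) v = 0 := by
    intro x v
    have := Dn_ind n1 n2 o x 1 v
    rw [mul_one] at this
    exact this.trans (by rw [show Dn n1 n2 o 1 v = 0 from hbal v, mul_zero])
  have hodd : ∀ x, vi z x = 1 → ∑ v, ε v * ind n1 n2 o x (lv v) = 1 := by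
    intro x hx
    have e1 : ∑ v, ε v * ind n1 n2 o x (lv v) = ∑ v, indV n1 n2 o x v * vi z v := by
      have := Dn_sum n1 n2 o (ind n1 n2 o x * z)
      simp only [Dn_ind] at this
      simp only [hvi, mul_add, Finset.sum_add_distrib]
      rw [show ∑ v, indV n1 n2 o x v * D z v = 0 from this, zero_add]
      refine Finset.sum_congr rfl fun v _ => ?_
      by_cases hv : act v
      · rw [hil x v hv, mul_comm]
      · rw [hε v hv]; simp
    rw [e1, Finset.sum_eq_single x]
    · rw [hx]; simp [indV, eqv.refl]
    · intro v _ hv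
      by_cases h : eqv n1 n2 o x v
      · rcases z2 (vi z v) with h' | h'
        · rw [h', mul_zero]
        · exact absurd (huniq _ _ hx h' h).symm hv
      · simp [indV, h]
    · simp
  obtain ⟨v1, ha1, ha2, hv1, hv2⟩ := hcross _ _ (hDi x1) (hDi x2) hdis (hodd x1 hx1) (hodd x2 hx2)
  set v2 := χ v1 with hv2d
  have q1 : eqv n1 n2 o x1 v1 := by
    rw [hil _ _ ha1] at hv1
    by_contra h; simp [indV, h] at hv1
  have q2 : eqv n1 n2 o x2 v2 := by
    rw [hil _ _ ha2] at hv2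
    by_contra h; simp [indV, h] at hv2
  obtain ⟨d1, hd1⟩ := id q1
  obtain ⟨d2, hd2⟩ := id q2
  set i1 := ind n1 n2 o x1 with hi1
  set i2 := ind n1 n2 o x2 with hi2
  have hc1 : i1 (lv v2) = 0 := by
    have := hdis (lv v2); rw [hv2, mul_one] at this; exact this
  have hc2 : i2 (lv v1) = 0 := by
    have := hdis (lv v1); rw [hv1, one_mul] at this; exact this
  have hmove : ∀ x v (d : K → ZMod 2) (a : ZMod 2), eqv n1 n2 o x v →
      (∀ u, Dn n1 n2 o d u = (if x = u then 1 else 0) + (if v = u then 1 else 0)) → ∀ u,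
      Dn n1 n2 o (ind n1 n2 o x * (d + fun _ => a)) u =
        (if x = u then 1 else 0) + (if v = u then 1 else 0) := by
    intro x v d a hxv hd u
    have ha : Dn n1 n2 o (fun _ => a) u = 0 := by
      rcases z2 a with rfl | rfl
      · simp [Dn]
      · exact hbal u
    rw [Dn_ind, Dn_add, ha, add_zero, hd]
    by_cases h1 : x = u
    · subst h1; simp [indV, eqv.refl]
    · by_cases h2 : v = u
      · subst h2; simp [indV, hxv]
      · simp [h1, h2]
  set z1 : K → ZMod 2 := z + i1 * (d1 + fun _ => z (lv v1) + d1 (lv v1)) +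
    i2 * (d2 + fun _ => z (lv v2) + d2 (lv v2)) with hz1
  have hvi1 : ∀ u, vi z1 u = vi z u + ((if x1 = u then 1 else 0) + (if v1 = u then 1 else 0)) +
      ((if x2 = u then 1 else 0) + (if v2 = u then 1 else 0)) := by
    intro u
    simp only [hvi, hz1, hD, Dn_add]
    rw [hmove x1 v1 d1 _ q1 hd1, hmove x2 v2 d2 _ q2 hd2]; ring
  have hz11 : z1 (lv v1) = 0 := by
    simp only [hz1, Pi.add_apply, Pi.mul_apply, hc2, hv1]
    have := z2s (z (lv v1) + d1 (lv v1))
    linear_combination this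
  have hz12 : z1 (lv v2) = 0 := by
    simp only [hz1, Pi.add_apply, Pi.mul_apply, hc1, hv2]
    have := z2s (z (lv v2) + d2 (lv v2))
    linear_combination this
  have hoff : ∀ u, ¬ eqv n1 n2 o x1 u → ¬ eqv n1 n2 o x2 u → vi z1 u = vi z u ∧
      (act u → z1 (lv u) = z (lv u)) := by
    intro u h1 h2
    constructor
    · rw [hvi1, if_neg, if_neg, if_neg, if_neg]
      · ring
      · rintro rfl; exact h2 q2
      · rintro rfl; exact h2 (eqv.refl _ _ _ _)
      · rintro rfl; exact h1 q1
      · rintro rfl; exact h1 (eqv.refl _ _ _ _)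
    · intro hu
      simp only [hz1, Pi.add_apply, Pi.mul_apply, hi1, hi2]
      rw [hil _ _ hu, hil _ _ hu]
      simp [indV, h1, h2]
  have hon1 : ∀ u, eqv n1 n2 o x1 u → vi z1 u = 1 → u = v1 := by
    intro u h h'
    have n2' : x2 ≠ u := by rintro rfl; exact hne12 h
    have n3' : v2 ≠ u := by rintro h3; rw [← h3] at h; exact hne12 (h.trans q2.symm)
    by_contra hne'
    rw [hvi1, if_neg (Ne.symm hne'), if_neg n2', if_neg n3'] at h'
    by_cases h3 : x1 = u
    · rw [if_pos h3, ← h3, hx1] at h'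
      exact absurd h' (by decide)
    · rw [if_neg h3] at h'
      exact h3 (huniq _ _ hx1 (by simpa using h') h)
  have hon2 : ∀ u, eqv n1 n2 o x2 u → vi z1 u = 1 → u = v2 := by
    intro u h h'
    have n2' : x1 ≠ u := by rintro rfl; exact hne12 h.symm
    have n3' : v1 ≠ u := by rintro h3; rw [← h3] at h; exact hne12 (q1.trans h.symm)
    by_contra hne'
    rw [hvi1, if_neg (Ne.symm hne'), if_neg n2', if_neg n3'] at h'
    by_cases h3 : x2 = u
    · rw [if_pos h3, ← h3, hx2] at h'
      exact absurd h' (by decide)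
    · rw [if_neg h3] at h'
      exact h3 (huniq _ _ hx2 (by simpa using h') h)
  have hvv1 : vi z1 v1 = 1 := by
    have n2' : x2 ≠ v1 := by rintro h; exact hne12 (h ▸ q1)
    have n3' : v2 ≠ v1 := hχ' v1
    rw [hvi1, if_pos (rfl : v1 = v1), if_neg n2', if_neg n3']
    by_cases h3 : x1 = v1
    · rw [if_pos h3, ← h3, hx1]; decide
    · rw [if_neg h3]
      rcases z2 (vi z v1) with h | h
      · rw [h]; decide
      · exact absurd (huniq _ _ hx1 h q1) h3
  have hvv2 : vi z1 v2 = 1 := by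
    have n2' : x1 ≠ v2 := by rintro h; exact hne12 (h ▸ q2.symm)
    have n3' : v1 ≠ v2 := (hχ' v1).symm
    rw [hvi1, if_pos (rfl : v2 = v2), if_neg n2', if_neg n3']
    by_cases h3 : x2 = v2
    · rw [if_pos h3, ← h3, hx2]; decide
    · rw [if_neg h3]
      rcases z2 (vi z v2) with h | h
      · rw [h]; decide
      · exact absurd (huniq _ _ hx2 h q2) h3
  have hg1 : gd z1 v1 := ⟨hvv1, hvv2, hz11, hz12⟩
  have hg2 : gd z1 v2 := gsym _ _ hg1
  have hva : ∀ u, vi z u = 1 → act u := by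
    intro u hu
    by_contra h
    simp only [hvi, hact z u h, hε u h] at hu
    exact absurd hu (by decide)
  apply m2 z1
  · have hsub : VS z1 ⊆ insert v1 (insert v2 (((VS z).erase x1).erase x2)) := by
      intro u hu
      simp only [hVS, Finset.mem_filter, Finset.mem_univ, true_and] at hu
      simp only [Finset.mem_insert, Finset.mem_erase, hVS, Finset.mem_filter, Finset.mem_univ,
        true_and]
      by_cases h1 : eqv n1 n2 o x1 u
      · exact Or.inl (hon1 u h1 hu)
      · by_cases h2 : eqv n1 n2 o x2 u
        · exact Or.inr (Or.inl (hon2 u h2 hu))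
        · refine Or.inr (Or.inr ⟨?_, ?_, ?_⟩)
          · rintro rfl; exact h2 (eqv.refl _ _ _ _)
          · rintro rfl; exact h1 (eqv.refl _ _ _ _)
          · rw [← (hoff u h1 h2).1]; exact hu
    have c1 := Finset.card_le_card hsub
    have c2 := Finset.card_insert_le v1 (insert v2 (((VS z).erase x1).erase x2))
    have c3 := Finset.card_insert_le v2 (((VS z).erase x1).erase x2)
    have mx1 : x1 ∈ VS z := by simp [hVS, hx1]
    have mx2 : x2 ∈ (VS z).erase x1 := by simp [hVS, hx2, hne.symm]
    have c4 := Finset.card_erase_add_one mx1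
    have c5 := Finset.card_erase_add_one mx2
    omega
  · apply Finset.card_lt_card
    refine ⟨?_, ?_⟩
    · intro u hu
      simp only [hBS, Finset.mem_filter, Finset.mem_univ, true_and] at hu ⊢
      obtain ⟨hu1, hu2⟩ := hu
      have h1 : ¬ eqv n1 n2 o x1 u := by
        intro h; rw [hon1 u h hu1] at hu2; exact hu2 hg1
      have h2 : ¬ eqv n1 n2 o x2 u := by
        intro h; rw [hon2 u h hu1] at hu2; exact hu2 hg2
      obtain ⟨o1, o2⟩ := hoff u h1 h2
      refine ⟨by rw [← o1]; exact hu1, ?_⟩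
      intro hg
      apply hu2
      obtain ⟨g1, g2, g3, g4⟩ := id hg
      have hg' := gsym _ _ hg
      have h1' : ¬ eqv n1 n2 o x1 (χ u) := by
        intro h; rw [← huniq _ _ hx1 g2 h] at hg'; exact hb1 hg'
      have h2' : ¬ eqv n1 n2 o x2 (χ u) := by
        intro h; rw [← huniq _ _ hx2 g2 h] at hg'; exact hb2 hg'
      obtain ⟨o1', o2'⟩ := hoff (χ u) h1' h2'
      exact ⟨hu1, by rw [o1']; exact g2, by rw [o2 (hva _ g1)]; exact g3,
        by rw [o2' (hva _ g2)]; exact g4⟩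
    · intro hs
      have := hs (show x1 ∈ BS z by simp only [hBS, Finset.mem_filter, Finset.mem_univ, true_and]; exact ⟨hx1, hb1⟩)
      simp only [hBS, Finset.mem_filter, Finset.mem_univ, true_and] at this
      have e := hon1 x1 (eqv.refl _ _ _ _) this.1
      rw [e] at this
      exact this.2 hg1
end

end NLS
end

section
namespace NLS

structure Cx (T E : Type) where
  F : E → Bool → T × Fin 3
  ed : T → Fin 3 → E
  side : T → Fin 3 → Bool
  NB : T → Fin 3 → Prop
  sm : E → ZMod 2
  o : T × Fin 3 → ZMod 2
  hF : ∀ e s, ed (F e s).1 (F e s).2 = e ∧ side (F e s).1 (F e s).2 = s ∧ NB (F e s).1 (F e s).2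
  hB : ∀ t c, NB t c → F (ed t c) (side t c) = (t, c)
  ho : ∀ t c, ¬ NB t c → o (t, c+1) = 0 ∧ o (t, c+2) = 0

namespace Cx
variable {T E : Type} [Fintype T] [Fintype E] [DecidableEq T] [DecidableEq E] (X : Cx T E)
set_option linter.unusedSectionVars false

def slot (e : E) (s b : Bool) : T × Fin 3 := ((X.F e s).1, (X.F e s).2 + (if b then 2 else 1))

theorem slotsum {R : Type} [CommRing R] (g : T × Fin 3 → R)
    (hg : ∀ t c, ¬ X.NB t c → g (t, c+1) = 0 ∧ g (t, c+2) = 0) (Φ : E → Bool → Bool → R) :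
    ∑ e, ∑ s, ∑ b, g (X.slot e s b) * Φ e s b = ∑ p : T × Fin 3, g p *
      (Φ (X.ed p.1 (p.2+2)) (X.side p.1 (p.2+2)) false +
       Φ (X.ed p.1 (p.2+1)) (X.side p.1 (p.2+1)) true) := by
  set G : T × Fin 3 → R := fun p => g (p.1, p.2+1) * Φ (X.ed p.1 p.2) (X.side p.1 p.2) false +
    g (p.1, p.2+2) * Φ (X.ed p.1 p.2) (X.side p.1 p.2) true with hG
  have e1 : ∑ p : T × Fin 3, g p *
      (Φ (X.ed p.1 (p.2+2)) (X.side p.1 (p.2+2)) false +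
       Φ (X.ed p.1 (p.2+1)) (X.side p.1 (p.2+1)) true) = ∑ p, G p := by
    rw [Fintype.sum_prod_type, Fintype.sum_prod_type]
    refine Finset.sum_congr rfl fun t _ => ?_
    simp only [hG, Fin.sum_univ_three]
    simp only [show (0:Fin 3)+1 = 1 from rfl, show (0:Fin 3)+2 = 2 from rfl,
      show (1:Fin 3)+1 = 2 from rfl, show (1:Fin 3)+2 = 0 from rfl,
      show (2:Fin 3)+1 = 0 from rfl, show (2:Fin 3)+2 = 1 from rfl]
    ring
  rw [e1]
  have e2 : ∑ p, G p = ∑ q : E × Bool, G (X.F q.1 q.2) := by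
    symm
    refine Finset.sum_of_injOn (fun q : E × Bool => X.F q.1 q.2) ?_ ?_ ?_ ?_
    · rintro ⟨e, s⟩ _ ⟨e', s'⟩ _ h
      have h : X.F e s = X.F e' s' := h
      have a := X.hF e s
      rw [h] at a
      have b := X.hF e' s'
      rw [← a.1, ← a.2.1, b.1, b.2.1]
    · intro q _; exact Finset.mem_coe.2 (Finset.mem_univ _)
    · rintro ⟨t, c⟩ _ h
      have : ¬ X.NB t c := by
        intro hn
        apply h
        exact ⟨(X.ed t c, X.side t c), Finset.mem_coe.2 (Finset.mem_univ _), X.hB t c hn⟩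
      simp only [hG, hg t c this, zero_mul, add_zero]
    · intro q _; rfl
  rw [e2, Fintype.sum_prod_type]
  refine Finset.sum_congr rfl fun e _ => Finset.sum_congr rfl fun s _ => ?_
  have := X.hF e s
  simp only [hG, this.1, this.2.1, Fintype.sum_bool, slot]
  simp [add_comm]

def κ (e : E) : ZMod 2 := X.o (X.slot e false false) + X.o (X.slot e true false)

def node (e : E) (b : Bool) : E × Bool := if X.κ e = 0 then (e, b) else (e, false)
def n1 (p : T × Fin 3) : E × Bool := X.node (X.ed p.1 (p.2+1)) true
def n2 (p : T × Fin 3) : E × Bool := X.node (X.ed p.1 (p.2+2)) false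

abbrev D (z : T × Fin 3 → ZMod 2) (v : E × Bool) : ZMod 2 := Dn X.n1 X.n2 X.o z v

def oy (y : T × Fin 3 → ZMod 2) (p : T × Fin 3) : ZMod 2 := X.o p * y p

theorem hoy (y : T × Fin 3 → ZMod 2) (t : T) (c : Fin 3) (h : ¬ X.NB t c) :
    X.oy y (t, c+1) = 0 ∧ X.oy y (t, c+2) = 0 := by
  simp [oy, X.ho t c h]

theorem D_eq (y : T × Fin 3 → ZMod 2) (e : E) (b : Bool) : X.D y (e, b) =
    if X.κ e = 0 then X.oy y (X.slot e false b) + X.oy y (X.slot e true b) else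
    if b then 0 else X.oy y (X.slot e false false) + X.oy y (X.slot e true false) +
      (X.oy y (X.slot e false true) + X.oy y (X.slot e true true)) := by
  have := X.slotsum (X.oy y) (X.hoy y) (fun e' _ b' => if X.node e' b' = (e, b) then 1 else 0)
  have e0 : X.D y (e, b) = ∑ p, X.oy y p * ((if X.node (X.ed p.1 (p.2+2)) false = (e, b) then 1 else 0) +
      (if X.node (X.ed p.1 (p.2+1)) true = (e, b) then 1 else 0)) := by
    simp only [D, Dn, n1, n2, oy]
    exact Finset.sum_congr rfl fun p _ => by rw [add_comm (ite _ _ _)]; congr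
  rw [e0, ← this, Finset.sum_eq_single e]
  · simp only [Fintype.sum_bool, node]
    by_cases h : X.κ e = 0
    · cases b <;> simp [h, add_comm]
    · cases b <;> simp [h]; ring
  · intro e' _ hne
    refine Finset.sum_eq_zero fun s _ => Finset.sum_eq_zero fun b' _ => ?_
    rw [if_neg, mul_zero]
    simp only [node]; split_ifs <;> simp [hne]
  · simp

def lv (v : E × Bool) : T × Fin 3 :=
  if X.κ v.1 = 0 ∨ v.2 = true then X.slot v.1 false v.2
  else if X.o (X.slot v.1 false false) = 1 then X.slot v.1 false false else X.slot v.1 true false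

def act (v : E × Bool) : Prop :=
  if X.κ v.1 = 0 then X.o (X.slot v.1 false v.2) = 1 else v.2 = false

def ε (v : E × Bool) : ZMod 2 :=
  if X.κ v.1 = 0 then X.o (X.slot v.1 false v.2) * (1 + X.sm v.1)
  else if v.2 then 0 else
    X.sm v.1 * (X.o (X.slot v.1 false false) + X.o (X.slot v.1 false true))

theorem n_slot (e : E) (s b : Bool) : X.n1 (X.slot e s b) = X.node e b ∨
    X.n2 (X.slot e s b) = X.node e b := by
  have h := X.hF e s
  have e1 : ∀ c : Fin 3, c + 2 + 1 = c := by decide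
  have e2 : ∀ c : Fin 3, c + 1 + 2 = c := by decide
  cases b
  · right
    simp only [n2, slot, Bool.false_eq_true, if_false, e2, h.1]
  · left
    simp only [n1, slot, if_true, e1, h.1]

def su (y : T × Fin 3 → ZMod 2) (e : E) : ZMod 2 :=
  X.oy y (X.slot e false false) + X.oy y (X.slot e false true)

theorem z2e (a b : ZMod 2) : a + b = 0 ↔ a = b := by revert a b; decide

theorem pure1 (o00 o10 o01 o11 y00 y10 y01 y11 m : ZMod 2) (h1 : o00 + o10 = 1)
    (h2 : o01 + o11 = 1) (h3 : o00 * y00 + o10 * y10 + (o01 * y01 + o11 * y11) = 0) :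
    ((o00 * y00).val : ℤ) + (o10 * y10).val - (o01 * y01).val - (o11 * y11).val = 0 ∧
    0 = m * (o00 + o01) * (if o00 = 1 then y00 else y10) + m * (o00 * y00 + o01 * y01) := by
  rcases z2 o00 with rfl | rfl <;> rcases z2 o10 with rfl | rfl <;>
  rcases z2 o01 with rfl | rfl <;> rcases z2 o11 with rfl | rfl <;>
  first
  | exact absurd h1 (by decide)
  | exact absurd h2 (by decide)
  | (clear h1 h2; revert y00 y10 y01 y11 m; decide)

theorem Fr (hκ : ∀ e, X.o (X.slot e false true) + X.o (X.slot e true true) = X.κ e)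
    (y : T × Fin 3 → ZMod 2) (hy : ∀ v, X.D y v = 0) :
    ∑ v, X.ε v * y (X.lv v) = ∑ e, X.sm e * X.su y e := by
  have S := X.slotsum (fun p => ((X.oy y p).val : ℤ)) (fun t c h => by simp [X.hoy y t c h])
    (fun _ _ b => if b then -1 else 1)
  have S0 : ∀ (f : T × Fin 3 → ℤ), ∑ p, f p * ((if false = true then (-1:ℤ) else 1) + (if true = true then (-1:ℤ) else 1)) = 0 := by
    intro f; simp
  rw [S0] at S
  simp only [Fintype.sum_bool, if_true, Bool.false_eq_true, if_false] at S
  have hd : ∀ e, ∃ d : ℤ, ((X.oy y (X.slot e false false)).val : ℤ) + (X.oy y (X.slot e true false)).val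
      - (X.oy y (X.slot e false true)).val - (X.oy y (X.slot e true true)).val = 2 * d ∧
      (d : ZMod 2) = ∑ b, X.ε (e, b) * y (X.lv (e, b)) + X.sm e * X.su y e := by
    intro e
    have k1 := hκ e
    have d0 := hy (e, false)
    have d1 := hy (e, true)
    rw [D_eq] at d0 d1
    by_cases h : X.κ e = 0
    · rw [if_pos h] at d0 d1
      have d0' := (z2e _ _).1 d0
      have d1' := (z2e _ _).1 d1
      refine ⟨(X.oy y (X.slot e false false)).val - (X.oy y (X.slot e false true)).val, ?_, ?_⟩
      · rw [d0', d1']; ring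
      · simp only [Fintype.sum_bool, ε, lv, h, if_true, true_or, su, Int.cast_sub, Int.cast_natCast,
          ZMod.natCast_zmod_val]
        simp only [oy]
        have q := z2s (X.o (X.slot e false false) * y (X.slot e false false))
        have q1 := z2s (X.o (X.slot e false true) * y (X.slot e false true))
        linear_combination - (X.sm e) * q - (1 + X.sm e) * q1
    · have h1 : X.κ e = 1 := (z2 _).resolve_left h
      rw [if_neg h] at d0
      simp only [Bool.false_eq_true, if_false] at d0
      have := pure1 _ _ _ _ _ _ _ _ (X.sm e) h1 (k1.trans h1) d0
      refine ⟨0, ?_, ?_⟩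
      · simp only [oy]; rw [mul_zero]; exact this.1
      · simp only [Fintype.sum_bool, ε, lv, h, if_false, false_or, su, oy, if_true,
          Bool.false_eq_true, apply_ite y, zero_mul, zero_add, Int.cast_zero]
        exact this.2
  choose d hd1 hd2 using hd
  have e1 : ∑ e, d e = 0 := by
    have : ∑ e, 2 * d e = 0 := by
      rw [← S]
      refine Finset.sum_congr rfl fun e _ => ?_
      rw [← hd1 e]; ring
    rw [← Finset.mul_sum] at this
    omega
  have e2 : ((∑ e, d e : ℤ) : ZMod 2) = 0 := by rw [e1]; simp
  rw [Int.cast_sum, Finset.sum_congr rfl (fun e _ => hd2 e), Finset.sum_add_distrib,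
    ← Fintype.sum_prod_type'] at e2
  have e3 := z2s (∑ e, X.sm e * X.su y e)
  have e4 : ∑ v, X.ε v * y (X.lv v) = ∑ x : E × Bool, X.ε (x.1, x.2) * y (X.lv (x.1, x.2)) := rfl
  rw [e4]
  linear_combination e2 - e3

end Cx
end NLS
end

section
namespace NLS
namespace Cx
variable {T E : Type} [Fintype T] [Fintype E] [DecidableEq T] [DecidableEq E] (X : Cx T E)
set_option linter.unusedSectionVars false

def Pot : Prop := ∀ y : T × Fin 3 → ZMod 2, (∀ t c, ¬ X.NB t c → y (t, c+1) = 0 ∧ y (t, c+2) = 0) →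
  (∀ e, y (X.slot e false false) + y (X.slot e false true) =
    y (X.slot e true false) + y (X.slot e true true)) →
  ∑ e, X.sm e * (y (X.slot e false false) + y (X.slot e false true)) = 1 →
  ∃ Ψ : T × Fin 3 → ZMod 2, (∀ e, Ψ (X.F e true) = Ψ (X.F e false) + X.sm e) ∧
    ∀ t, (∀ a, y (t, a) = 0) → ∀ c c', Ψ (t, c) = Ψ (t, c')

theorem bal (y : T × Fin 3 → ZMod 2) (hy : ∀ v, X.D y v = 0) (e : E) :
    X.oy y (X.slot e false false) + X.oy y (X.slot e false true) =
    X.oy y (X.slot e true false) + X.oy y (X.slot e true true) := by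
  have d0 := hy (e, false)
  have d1 := hy (e, true)
  rw [D_eq] at d0 d1
  by_cases h : X.κ e = 0
  · rw [if_pos h] at d0 d1
    rw [(z2e _ _).1 d0, (z2e _ _).1 d1]
  · rw [if_neg h] at d0
    simp only [Bool.false_eq_true, if_false] at d0
    rw [← z2e, ← d0]; ring

theorem share0 (hpot : X.Pot) (y1 y2 : T × Fin 3 → ZMod 2) (h1 : ∀ v, X.D y1 v = 0)
    (h2 : ∀ v, X.D y2 v = 0) (s1 : ∑ e, X.sm e * X.su y1 e = 1)
    (s2 : ∑ e, X.sm e * X.su y2 e = 1) :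
    ∃ e s b s' b', X.oy y1 (X.slot e s b) = 1 ∧ X.oy y2 (X.slot e s' b') = 1 := by
  by_contra hcon
  push Not at hcon
  obtain ⟨Ψ, hΨ, hc⟩ := hpot (X.oy y2) (X.hoy y2) (X.bal y2 h2) s2
  have S := X.slotsum (X.oy y1) (X.hoy y1) (fun e s _ => Ψ (X.F e s))
  have R : ∑ p : T × Fin 3, X.oy y1 p * (Ψ (X.F (X.ed p.1 (p.2+2)) (X.side p.1 (p.2+2))) +
       Ψ (X.F (X.ed p.1 (p.2+1)) (X.side p.1 (p.2+1)))) = 0 := by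
    refine Finset.sum_eq_zero ?_
    rintro ⟨t, c⟩ _
    rcases z2 (X.oy y1 (t, c)) with h | h
    · rw [h, zero_mul]
    have e12 : ∀ c : Fin 3, c + 1 + 2 = c := by decide
    have e21 : ∀ c : Fin 3, c + 2 + 1 = c := by decide
    have e11 : ∀ c : Fin 3, c + 1 + 1 = c + 2 := by decide
    have e22 : ∀ c : Fin 3, c + 2 + 2 = c + 1 := by decide
    have n1 : X.NB t (c+1) := by
      by_contra hn
      have := (X.hoy y1 t (c+1) hn).2
      rw [e12, h] at this; exact absurd this (by decide)
    have n2 : X.NB t (c+2) := by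
      by_contra hn
      have := (X.hoy y1 t (c+2) hn).1
      rw [e21, h] at this; exact absurd this (by decide)
    have f1 := X.hB t _ n1
    have f2 := X.hB t _ n2
    simp only [f1, f2]
    have c1 := hcon (X.ed t (c+1)) (X.side t (c+1)) true (X.side t (c+1)) false
    have c2 := hcon (X.ed t (c+2)) (X.side t (c+2)) false (X.side t (c+2)) true
    simp only [slot, f1, f2, if_true, Bool.false_eq_true, if_false, e12, e21, e11, e22] at c1 c2
    have c3 := hcon (X.ed t (c+1)) (X.side t (c+1)) true (X.side t (c+1)) true
    simp only [slot, f1, f2, if_true, Bool.false_eq_true, if_false, e12, e21, e11, e22] at c3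
    have d1 := (z2 _).resolve_right (c1 h)
    have d2 := (z2 _).resolve_right (c2 h)
    have d3 := (z2 _).resolve_right (c3 h)
    have : ∀ a, X.oy y2 (t, a) = 0 := by
      intro a
      have : ∀ a c : Fin 3, a = c ∨ a = c + 1 ∨ a = c + 2 := by decide
      rcases this a c with rfl | rfl | rfl <;> assumption
    rw [hc t this (c+2) (c+1), z2s, mul_zero]
  have L : ∑ e, ∑ s, ∑ b, X.oy y1 (X.slot e s b) * Ψ (X.F e s) = 1 := by
    rw [← s1]
    refine Finset.sum_congr rfl fun e _ => ?_
    simp only [Fintype.sum_bool, hΨ e, su]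
    have := X.bal y1 h1 e
    have q := z2s ((X.oy y1 (X.slot e false false) + X.oy y1 (X.slot e false true)) * Ψ (X.F e false))
    linear_combination - (Ψ (X.F e false) + X.sm e) * this + q
  rw [L, R] at S
  exact absurd S (by decide)

theorem pure2 (o00 o10 o01 o11 y00 y10 y01 y11 x00 x10 x01 x11 : ZMod 2) (h1 : o00 + o10 = 1)
    (h2 : o01 + o11 = 1) (h3 : o00 * y00 + o10 * y10 + (o01 * y01 + o11 * y11) = 0)
    (h4 : o00 * x00 + o10 * x10 + (o01 * x01 + o11 * x11) = 0)
    (a0 : x00 * y00 = 0) (a1 : x10 * y10 = 0) (a2 : x01 * y01 = 0) (a3 : x11 * y11 = 0)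
    (hy : o00 * y00 = 1 ∨ o10 * y10 = 1 ∨ o01 * y01 = 1 ∨ o11 * y11 = 1)
    (hx : o00 * x00 = 1 ∨ o10 * x10 = 1 ∨ o01 * x01 = 1 ∨ o11 * x11 = 1) : False := by
  have q : ∀ y y' x x' : ZMod 2, y + y' = 0 → x + x' = 0 → x * y = 0 → x' * y' = 0 →
    y = 1 ∨ y' = 1 → x = 1 ∨ x' = 1 → False := by decide
  rcases z2 o00 with rfl | rfl <;> rcases z2 o10 with rfl | rfl <;>
  rcases z2 o01 with rfl | rfl <;> rcases z2 o11 with rfl | rfl <;>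
  first
  | exact absurd h1 (by decide)
  | exact absurd h2 (by decide)
  | (clear h1 h2
     simp only [zero_mul, one_mul, zero_add, add_zero, zero_ne_one, false_or, or_false] at h3 h4 hx hy
     first
     | exact q _ _ _ _ h3 h4 a0 a2 hy hx
     | exact q _ _ _ _ h3 h4 a0 a3 hy hx
     | exact q _ _ _ _ h3 h4 a1 a2 hy hx
     | exact q _ _ _ _ h3 h4 a1 a3 hy hx)

theorem hcross (hκ : ∀ e, X.o (X.slot e false true) + X.o (X.slot e true true) = X.κ e)
    (hpot : X.Pot) (y1 y2 : T × Fin 3 → ZMod 2) (h1 : ∀ v, X.D y1 v = 0)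
    (h2 : ∀ v, X.D y2 v = 0) (hd : ∀ c, y1 c * y2 c = 0)
    (s1 : ∑ v, X.ε v * y1 (X.lv v) = 1) (s2 : ∑ v, X.ε v * y2 (X.lv v) = 1) :
    ∃ v, X.act v ∧ X.act (v.1, !v.2) ∧ y1 (X.lv v) = 1 ∧ y2 (X.lv (v.1, !v.2)) = 1 := by
  rw [X.Fr hκ y1 h1] at s1
  rw [X.Fr hκ y2 h2] at s2
  obtain ⟨e, s, b, s', b', g1, g2⟩ := X.share0 hpot y1 y2 h1 h2 s1 s2
  have mul1 : ∀ a b : ZMod 2, a * b = 1 → a = 1 ∧ b = 1 := by decide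
  by_cases h : X.κ e = 0
  · have k1 : ∀ y, (∀ v, X.D y v = 0) → ∀ s b, X.oy y (X.slot e s b) = X.oy y (X.slot e false b) := by
      intro y hy s b
      have := hy (e, b)
      rw [D_eq, if_pos h] at this
      cases s
      · rfl
      · exact ((z2e _ _).1 this).symm
    rw [k1 y1 h1] at g1
    rw [k1 y2 h2] at g2
    obtain ⟨o1, z1⟩ := mul1 _ _ g1
    obtain ⟨o2, z2'⟩ := mul1 _ _ g2
    have hb : b' = !b := by
      by_contra hne
      have bb : ∀ b b' : Bool, ¬ b' = !b → b' = b := by decide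
      have : b' = b := bb b b' hne
      subst this
      have := hd (X.slot e false b')
      rw [z1, z2'] at this
      exact absurd this (by decide)
    subst hb
    refine ⟨(e, b), ?_, ?_, ?_, ?_⟩
    · simp only [act, if_pos h]; exact o1
    · simp only [act, if_pos h]; exact o2
    · simp only [lv, h, true_or, if_true]; exact z1
    · simp only [lv, h, true_or, if_true]; exact z2'
  · exfalso
    have hk1 : X.κ e = 1 := (z2 _).resolve_left h
    have k1 := hκ e
    have d0 := h1 (e, false)
    have d1 := h2 (e, false)
    rw [D_eq, if_neg h] at d0 d1
    simp only [Bool.false_eq_true, if_false] at d0 d1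
    refine pure2 _ _ _ _ _ _ _ _ _ _ _ _ hk1 (k1.trans hk1) d1 d0 (hd _) (hd _) (hd _) (hd _) ?_ ?_
    · simp only [oy] at g2
      cases s' <;> cases b' <;> tauto
    · simp only [oy] at g1
      cases s <;> cases b <;> tauto

def J (o z : ZMod 2) : ℤ := if o = 0 then 0 else if z = 0 then 1 else -1

theorem pureA (a b m z00 z10 z01 z11 : ZMod 2)
    (h1 : a * z00 + a * z10 + a * (1 + m) = 1 → b * z01 + b * z11 + b * (1 + m) = 1 ∧ z00 = 0 ∧ z01 = 0)
    (h2 : b * z01 + b * z11 + b * (1 + m) = 1 → a * z00 + a * z10 + a * (1 + m) = 1 ∧ z01 = 0 ∧ z00 = 0) :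
    (m = 0 → J a z00 + J a z10 = J b z01 + J b z11 ∧ 0 ≤ J a z00 + J a z10) ∧
    (m = 1 → J a z00 - J a z10 = J b z01 - J b z11) := by
  rcases z2 a with rfl | rfl <;> rcases z2 b with rfl | rfl <;> rcases z2 m with rfl | rfl <;>
  rcases z2 z00 with rfl | rfl <;> rcases z2 z10 with rfl | rfl <;>
  revert z01 z11 <;> decide

theorem pureB (o00 o10 o01 o11 z00 z10 z01 z11 m : ZMod 2) (h1 : o00 + o10 = 1)
    (h2 : o01 + o11 = 1)
    (h3 : o00 * z00 + o10 * z10 + (o01 * z01 + o11 * z11) + m * (o00 + o01) = 0) :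
    (m = 0 → J o00 z00 + J o10 z10 = J o01 z01 + J o11 z11) ∧
    (m = 1 → J o00 z00 - J o10 z10 = J o01 z01 - J o11 z11) := by
  rcases z2 o00 with rfl | rfl <;> rcases z2 o10 with rfl | rfl <;>
  rcases z2 o01 with rfl | rfl <;> rcases z2 o11 with rfl | rfl <;>
  first
  | exact absurd h1 (by decide)
  | exact absurd h2 (by decide)
  | (clear h1 h2; revert z00 z10 z01 z11 m; decide)

theorem core2 (hκ : ∀ e, X.o (X.slot e false true) + X.o (X.slot e true true) = X.κ e)
    (hpot : X.Pot)
    (hpar : ∑ e, X.sm e * (X.o (X.slot e false false) + X.o (X.slot e false true)) = 0) :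
    ∃ j : T × Fin 3 → ℤ, (∀ p, X.o p = 0 → j p = 0) ∧ (∀ p, X.o p = 1 → j p = 1 ∨ j p = -1) ∧
    (∀ e, X.sm e = 0 →
      j (X.slot e false false) + j (X.slot e true false) =
        j (X.slot e false true) + j (X.slot e true true) ∧
      (0 ≤ j (X.slot e false false) + j (X.slot e true false) ∨ X.κ e = 1)) ∧
    (∀ e, X.sm e = 1 →
      j (X.slot e false false) - j (X.slot e true false) =
        j (X.slot e false true) - j (X.slot e true true)) := by
  have o0 : ∀ e b, X.κ e = 0 → X.o (X.slot e true b) = X.o (X.slot e false b) := by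
    intro e b h
    cases b
    · exact ((z2e _ _).1 h).symm
    · exact ((z2e _ _).1 ((hκ e).trans h)).symm
  have oy1 : ∀ p, X.oy 1 p = X.o p := fun p => by simp [oy]
  have hbal : ∀ v, X.D 1 v = 0 := by
    rintro ⟨e, b⟩
    rw [D_eq]
    simp only [oy1]
    split_ifs with h hb
    · rw [o0 e b h, z2s]
    · rfl
    · rw [hκ e]; exact z2s (X.κ e)
  obtain ⟨z, hz⟩ := core1 X.n1 X.n2 X.o X.ε (fun v => (v.1, !v.2)) (by simp) (by
      rintro ⟨e, b⟩ h
      simp at h) X.lv X.act (by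
      rintro ⟨e, b⟩ ha
      by_cases h : X.κ e = 0
      · simp only [act, if_pos h] at ha
        simp only [lv, h, true_or, if_true]
        refine ⟨ha, ?_⟩
        have := X.n_slot e false b
        simpa only [node, if_pos h] using this
      · simp only [act, if_neg h] at ha
        subst ha
        simp only [lv, h, false_or, Bool.false_eq_true, if_false]
        have hn : X.node e false = (e, false) := by simp [node]
        split_ifs with h1
        · exact ⟨h1, hn ▸ X.n_slot e false false⟩
        · refine ⟨?_, hn ▸ X.n_slot e true false⟩
          have hk : X.κ e = 1 := (z2 _).resolve_left h
          rw [κ, (z2 _).resolve_right h1, zero_add] at hk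
          exact hk) (by
      rintro z ⟨e, b⟩ ha
      have := X.D_eq z e b
      rw [D] at this
      rw [this]
      by_cases h : X.κ e = 0
      · simp only [act, if_pos h] at ha
        have ha := (z2 _).resolve_right ha
        rw [if_pos h]
        simp only [oy, o0 e b h, ha]; simp
      · simp only [act, if_neg h] at ha
        simp only [Bool.not_eq_false] at ha
        rw [if_neg h, if_pos ha]) (by
      rintro ⟨e, b⟩ ha
      by_cases h : X.κ e = 0
      · simp only [act, if_pos h] at ha
        have ha := (z2 _).resolve_right ha
        simp only [ε, if_pos h, ha, zero_mul]
      · simp only [act, if_neg h] at ha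
        simp only [Bool.not_eq_false] at ha
        simp only [ε, if_neg h, if_pos ha]) hbal (by
      have := X.Fr hκ 1 hbal
      simp only [Pi.one_apply, mul_one] at this
      rw [this]
      simp only [su, oy1]
      exact hpar) (fun y1 y2 h1 h2 hd s1 s2 => X.hcross hκ hpot y1 y2 h1 h2 hd s1 s2)
  have hz : ∀ v : E × Bool, X.D z v + X.ε v = 1 → X.D z (v.1, !v.2) + X.ε (v.1, !v.2) = 1 ∧
    z (X.lv v) = 0 ∧ z (X.lv (v.1, !v.2)) = 0 := hz
  have key : ∀ e, (X.sm e = 0 → J (X.o (X.slot e false false)) (z (X.slot e false false)) +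
        J (X.o (X.slot e true false)) (z (X.slot e true false)) =
        J (X.o (X.slot e false true)) (z (X.slot e false true)) +
        J (X.o (X.slot e true true)) (z (X.slot e true true)) ∧
      (0 ≤ J (X.o (X.slot e false false)) (z (X.slot e false false)) +
        J (X.o (X.slot e true false)) (z (X.slot e true false)) ∨ X.κ e = 1)) ∧
    (X.sm e = 1 → J (X.o (X.slot e false false)) (z (X.slot e false false)) -
        J (X.o (X.slot e true false)) (z (X.slot e true false)) =
        J (X.o (X.slot e false true)) (z (X.slot e false true)) -
        J (X.o (X.slot e true true)) (z (X.slot e true true))) := by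
    intro e
    have z0 := hz (e, false)
    have z1 := hz (e, true)
    simp only [D_eq, Bool.not_true, Bool.not_false] at z0 z1
    by_cases h : X.κ e = 0
    · simp only [if_pos h, ε, lv, h, true_or, if_true, oy, o0 e _ h] at z0 z1 ⊢
      have := pureA _ _ _ _ _ _ _ z0 z1
      exact ⟨fun hm => ⟨(this.1 hm).1, Or.inl (this.1 hm).2⟩, this.2⟩
    · have hk : X.κ e = 1 := (z2 _).resolve_left h
      simp only [if_neg h, ε, Bool.false_eq_true, if_false, if_true, oy] at z0
      have z0 := (z2 _).resolve_right (fun hh => absurd (z0 hh).1 (by decide))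
      have := pureB _ _ _ _ _ _ _ _ _ hk ((hκ e).trans hk) z0
      exact ⟨fun hm => ⟨this.1 hm, Or.inr hk⟩, this.2⟩
  refine ⟨fun p => J (X.o p) (z p), ?_, ?_, fun e => (key e).1, fun e => (key e).2⟩
  · intro p h; simp [J, h]
  · intro p h; simp only [J, h]; rcases z2 (z p) with h | h <;> simp [h]

end Cx
end NLS
end

section
namespace NLS

theorem f21 (s : Fin 3) : s + 2 + 1 = s := by revert s; decide
theorem f12 (s : Fin 3) : s + 1 + 2 = s := by revert s; decide

def sd (p : Tri × Fin 3) : Bool := !p.1.2.1 || (decide (p.2 = 0) && decide (p.1.2.2.2 = 0))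
def nbd (p : Tri × Fin 3) : Prop := ¬ (p.1.2.1 = true ∧ p.2 = 1 ∧ p.1.2.2.1 = p.1.2.2.2)
def opp (n : ℕ) : Tri × Fin 3 → Tri × Fin 3
  | ((s, b, i, k), c) => if b = true ∧ c = 0 ∧ k = 0 then ((s+2, true, n-1, i), 2)
    else if b = true ∧ c = 2 ∧ i + 1 = n then ((s+1, true, k, 0), 0) else (nb (s, b, i, k) c, c)

theorem opp_spec (n : ℕ) (p : Tri × Fin 3) (h : tmem n p.1) (hb : nbd p) :
    tmem n (opp n p).1 ∧ nbd (opp n p) ∧ sd (opp n p) = !sd p ∧ opp n (opp n p) = p := by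
  obtain ⟨⟨s, b, i, k⟩, c⟩ := p
  have e1 : s + 2 + 1 = s := f21 s
  have e2 : s + 1 + 2 = s := f12 s
  cases b
  · obtain ⟨h1, h2⟩ := h
    rcases fin3 c with rfl | rfl | rfl
    · simp [opp, nb, tmem, nbd, sd]; omega
    · simp [opp, nb, tmem, nbd, sd]; omega
    · obtain ⟨j, rfl⟩ : ∃ j, i = j + 1 := ⟨i - 1, by omega⟩
      simp [opp, nb, tmem, nbd, sd]; omega
  · obtain ⟨h1, h2⟩ := h
    rcases fin3 c with rfl | rfl | rfl
    · by_cases hk : k = 0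
      · subst hk
        have : n - 1 + 1 = n := by omega
        simp [opp, tmem, nbd, sd, this, e1]; omega
      · obtain ⟨j, rfl⟩ : ∃ j, k = j + 1 := ⟨k - 1, by omega⟩
        simp [opp, nb, tmem, nbd, sd]; omega
    · simp [nbd] at hb
      simp [opp, nb, tmem, nbd, sd]; omega
    · by_cases hk : i + 1 = n
      · subst hk
        simp [opp, tmem, nbd, sd, e2]; omega
      · simp [opp, nb, tmem, nbd, sd, hk]; omega

abbrev TT (n : ℕ) := {t : Tri // tmem n t}
abbrev EE (n : ℕ) := {p : Tri × Fin 3 // tmem n p.1 ∧ nbd p ∧ sd p = true}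

instance (n : ℕ) : Finite (TT n) := by
  have : Set.Finite {t : Tri | tmem n t} := by
    refine Set.Finite.subset (Finset.finite_toSet (Finset.univ ×ˢ Finset.univ ×ˢ Finset.range n ×ˢ Finset.range n :
      Finset Tri)) ?_
    rintro ⟨s, b, i, k⟩ h
    cases b <;> (obtain ⟨h1, h2⟩ := h; simp; omega)
  exact this.to_subtype

instance (n : ℕ) : Finite (EE n) :=
  Finite.of_injective (fun e : EE n => ((⟨e.1.1, e.2.1⟩ : TT n), e.1.2)) (by
    rintro ⟨⟨t, c⟩, h⟩ ⟨⟨t', c'⟩, h'⟩ hh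
    simp at hh
    simp [hh])

noncomputable instance (n : ℕ) : Fintype (TT n) := Fintype.ofFinite _
noncomputable instance (n : ℕ) : Fintype (EE n) := Fintype.ofFinite _

def mkf (n : ℕ) (p : Tri × Fin 3) (h : tmem n p.1) : TT n × Fin 3 := (⟨p.1, h⟩, p.2)

def FF (n : ℕ) (e : EE n) : Bool → TT n × Fin 3
  | true => mkf n e.1 e.2.1
  | false => mkf n (opp n e.1) (opp_spec n e.1 e.2.1 e.2.2.1).1

open Classical in
noncomputable def eed (n : ℕ) (hn : 0 < n) (t : TT n) (c : Fin 3) : EE n :=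
  if h : nbd (t.1, c) then
    if hs : sd (t.1, c) = true then ⟨(t.1, c), t.2, h, hs⟩
    else ⟨opp n (t.1, c), (opp_spec n (t.1, c) t.2 h).1, (opp_spec n (t.1, c) t.2 h).2.1, by
      rw [(opp_spec n (t.1, c) t.2 h).2.2.1]; simpa using hs⟩
  else ⟨((0, true, 0, 0), 0), ⟨le_rfl, hn⟩, by simp [nbd], by simp [sd]⟩

theorem eed_pos (n : ℕ) (hn : 0 < n) (t : TT n) (c : Fin 3) (h : nbd (t.1, c))
    (hs : sd (t.1, c) = true) : (eed n hn t c).1 = (t.1, c) := by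
  rw [eed, dif_pos h, dif_pos hs]

theorem eed_neg (n : ℕ) (hn : 0 < n) (t : TT n) (c : Fin 3) (h : nbd (t.1, c))
    (hs : sd (t.1, c) = false) : (eed n hn t c).1 = opp n (t.1, c) := by
  rw [eed, dif_pos h, dif_neg (by rw [hs]; decide)]

theorem FF_true (n : ℕ) (e : EE n) (p : Tri × Fin 3) (h : tmem n p.1) (he : e.1 = p) :
    FF n e true = mkf n p h := by
  subst he; rfl

theorem FF_false (n : ℕ) (e : EE n) (p : Tri × Fin 3) (h : tmem n p.1) (he : opp n e.1 = p) :
    FF n e false = mkf n p h := by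
  subst he; rfl

noncomputable def cx (n : ℕ) (hn : 0 < n) (o : Tri → Fin 3 → ZMod 2)
    (hbord : ∀ s i, i < n → o (s, true, i, i) 2 = 0 ∧ o (s, true, i, i) 0 = 0) : Cx (TT n) (EE n) where
  F := FF n
  ed := eed n hn
  side t c := sd (t.1, c)
  NB t c := nbd (t.1, c)
  sm e := if e.1.1.2.1 = true then 1 else 0
  o p := o p.1.1 p.2
  hF := by
    intro e s
    obtain ⟨⟨t, c⟩, h1, h2, h3⟩ := e
    have sp := opp_spec n (t, c) h1 h2
    cases s
    · have h4 : sd (opp n (t, c)) = false := by rw [sp.2.2.1, h3]; rfl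
      refine ⟨?_, ?_, ?_⟩
      · exact Subtype.ext ((eed_neg n hn _ _ sp.2.1 h4).trans sp.2.2.2)
      · exact h4
      · exact sp.2.1
    · exact ⟨Subtype.ext (eed_pos n hn _ _ h2 h3), h3, h2⟩
  hB := by
    rintro ⟨t, ht⟩ c h
    have sp := opp_spec n (t, c) ht h
    rcases hs : sd (t, c)
    · rw [FF_false n _ (t, c) ht]
      · rfl
      · rw [eed_neg n hn _ _ h hs]; exact sp.2.2.2
    · rw [FF_true n _ (t, c) ht]
      · rfl
      · rw [eed_pos n hn _ _ h hs]
  ho := by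
    rintro ⟨⟨s, b, i, k⟩, ht⟩ c h
    simp only [nbd, not_not] at h
    obtain ⟨rfl, rfl, rfl⟩ := h
    exact hbord s i ht.2

theorem sumE (n : ℕ) (g : Tri × Fin 3 → ZMod 2) :
    ∑ e : EE n, (if e.1.1.2.1 = true then 1 else 0) * g (opp n e.1) =
    ∑ s : Fin 3, ∑ k ∈ Finset.range n, g ((s, true, n-1, k), 2) := by
  simp only [← Fin.sum_univ_eq_sum_range]
  rw [← Fintype.sum_prod_type']
  symm
  refine Finset.sum_of_injOn (fun q : Fin 3 × Fin n =>
    (⟨((q.1 + 1, true, q.2.1, 0), 0), ⟨⟨Nat.zero_le _, q.2.2⟩, by simp [nbd], by simp [sd]⟩⟩ : EE n)) ?_ ?_ ?_ ?_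
  · rintro ⟨s, k⟩ _ ⟨s', k'⟩ _ h
    simp at h
    exact Prod.ext h.1 (Fin.ext h.2)
  · intro q _; exact Finset.mem_coe.2 (Finset.mem_univ _)
  · rintro ⟨⟨⟨s, b, i, k⟩, c⟩, h⟩ _ h'
    cases b
    · simp
    · exfalso
      apply h'
      obtain ⟨h1, h2, h3⟩ := h
      simp [sd] at h3
      obtain ⟨rfl, rfl⟩ := h3
      refine ⟨(s+2, ⟨i, h1.2⟩), Finset.mem_coe.2 (Finset.mem_univ _), ?_⟩
      have e1 : s + 2 + 1 = s := f21 s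
      simp [e1]
  · rintro ⟨s, k⟩ _
    have e1 : s + 1 + 2 = s := f12 s
    simp [opp, e1]

end NLS
end

section
namespace NLS

open Classical in
noncomputable def ex {A : Type} [Zero A] (n : ℕ) (y : TT n × Fin 3 → A) (t : Tri) (c : Fin 3) : A :=
  if h : tmem n t then y (⟨t, h⟩, c) else 0

theorem ex_eq {A : Type} [Zero A] (n : ℕ) (y : TT n × Fin 3 → A) (t : TT n) (c : Fin 3) :
    y (t, c) = ex n y t.1 c := by
  rw [ex, dif_pos t.2]

def fl (n : ℕ) (e : EE n) : Bool → Tri × Fin 3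
  | true => e.1
  | false => opp n e.1

theorem ex_slot {A : Type} [Zero A] (n : ℕ) (hn : 0 < n) (o) (hbord) (y : TT n × Fin 3 → A)
    (e : EE n) (s b : Bool) : y ((cx n hn o hbord).slot e s b) =
      ex n y (fl n e s).1 ((fl n e s).2 + if b then 2 else 1) := by
  rw [Cx.slot, ex_eq n y]
  cases s <;> rfl

theorem o_slot (n : ℕ) (hn : 0 < n) (o) (hbord)
    (e : EE n) (s b : Bool) : (cx n hn o hbord).o ((cx n hn o hbord).slot e s b) =
      o (fl n e s).1 ((fl n e s).2 + if b then 2 else 1) := by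
  cases s <;> rfl

def de (n : ℕ) (s : Fin 3) (i k : ℕ) (c : Fin 3) (h : k < i) (h' : i < n) : EE n :=
  ⟨((s, false, i, k), c), ⟨h, h'⟩, by simp [nbd], by simp [sd]⟩

def se (n : ℕ) (s : Fin 3) (k : ℕ) (h' : k < n) : EE n :=
  ⟨((s+1, true, k, 0), 0), ⟨Nat.zero_le _, h'⟩, by simp [nbd], by simp [sd]⟩

theorem fl_de (n : ℕ) (s : Fin 3) (i k : ℕ) (c : Fin 3) (h : k < i) (h' : i < n) :
    fl n (de n s i k c h h') false = (nb (s, false, i, k) c, c) := by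
  simp [fl, de, opp]

theorem fl_se (n : ℕ) (s : Fin 3) (k : ℕ) (h' : k < n) :
    fl n (se n s k h') false = ((s, true, n-1, k), 2) := by
  simp [fl, se, opp, f12 s]

theorem EE_cases (n : ℕ) (e : EE n) : (∃ s i k c h h', e = de n s i k c h h') ∨
    ∃ s k h, e = se n s k h := by
  obtain ⟨⟨⟨s, b, i, k⟩, c⟩, h1, h2, h3⟩ := e
  cases b
  · exact Or.inl ⟨s, i, k, c, h1.1, h1.2, rfl⟩
  · simp [sd] at h3
    obtain ⟨rfl, rfl⟩ := h3
    refine Or.inr ⟨s+2, i, h1.2, ?_⟩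
    simp only [se, f21]

theorem pot_inst (n : ℕ) (hn : 0 < n) (o) (hbord) : (cx n hn o hbord).Pot := by
  intro y hB hE hS
  set Y := ex n y with hY
  simp only [ex_slot n hn o hbord, ← hY] at hE hS
  have hS' : ∑ e : EE n, (if e.1.1.2.1 = true then 1 else 0) *
      (fun p : Tri × Fin 3 => Y p.1 (p.2+1) + Y p.1 (p.2+2)) (opp n e.1) = 1 := hS
  rw [sumE n (fun p : Tri × Fin 3 => Y p.1 (p.2+1) + Y p.1 (p.2+2))] at hS'
  clear hS
  set u : Tri → Fin 3 → ZMod 2 := fun t c => Y t (c+1) + Y t (c+2) with hu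
  have u0 : ∀ t, u t 0 + u t 1 + u t 2 = 0 := by
    intro t
    have : u t 0 + u t 1 + u t 2 = (Y t 0 + Y t 0) + (Y t 1 + Y t 1) + (Y t 2 + Y t 2) := by
      simp only [hu]
      simp only [show (0:Fin 3)+1 = 1 from rfl, show (0:Fin 3)+2 = 2 from rfl,
        show (1:Fin 3)+1 = 2 from rfl, show (1:Fin 3)+2 = 0 from rfl,
        show (2:Fin 3)+1 = 0 from rfl, show (2:Fin 3)+2 = 1 from rfl]
      ring
    rw [this]; simp [z2s]
  have ub : ∀ s i, i < n → u (s, true, i, i) 1 = 0 := by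
    intro s i hi
    have ht : tmem n (s, true, i, i) := ⟨le_rfl, hi⟩
    have := hB ⟨(s, true, i, i), ht⟩ 1 (by simp [cx, nbd])
    rw [ex_eq n y, ex_eq n y] at this
    simp only [hu, hY]
    rw [this.1, this.2]; rfl
  have ud : ∀ s i k c, k < i → i < n → u (nb (s, false, i, k) c) c = u (s, false, i, k) c := by
    intro s i k c h h'
    have := hE (de n s i k c h h')
    rw [fl_de] at this
    exact this
  have us : ∀ s k, k < n → u (s, true, n-1, k) 2 = u (s+1, true, k, 0) 0 := by
    intro s k h
    have := hE (se n s k h)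
    rw [fl_se] at this
    exact this
  have hS : ∑ s : Fin 3, ∑ k ∈ Finset.range n, u (s, true, n-1, k) 2 = 1 := hS'
  clear hS' hE hB
  set x : Fin 3 → ℕ → ℕ → ZMod 2 := fun s i k => u (s, true, i, k) 0 with hx
  set q : Fin 3 → ℕ → ℕ → ZMod 2 := fun s i k => u (s, true, i-1, k) 2 with hq
  set z : Fin 3 → ℕ → ℕ → ZMod 2 := fun s i k => u (s, true, i, k) 1 with hz
  have hup : ∀ s i k, k ≤ i → i < n → x s i k + q s (i+1) k = z s i k := by
    intro s i k _ _
    simp only [hx, hq, hz, Nat.add_sub_cancel]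
    rw [← Cx.z2e, ← u0 (s, true, i, k)]; ring
  have hdn : ∀ s i k, k < i → i < n → q s i k + x s i (k+1) = z s i k := by
    intro s i k h h'
    have e0 := ud s i k 0 h h'
    have e1 := ud s i k 1 h h'
    have e2 := ud s i k 2 h h'
    simp [nb] at e0 e1 e2
    simp only [hx, hq, hz]
    rw [e0, e1, e2, ← Cx.z2e, ← u0 (s, false, i, k)]; ring
  set ψ : Fin 3 → ℕ → ℕ → ZMod 2 := fun s => pot (x s) (q s) with hψ
  have px : ∀ s i k, k ≤ i → i < n → ψ s (i+1) k = ψ s i k + x s i k := fun s =>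
    pot_x n (x s) (q s) (z s) (hup s) (hdn s)
  have pz : ∀ s i k, k ≤ i → i < n → ψ s (i+1) (k+1) = ψ s i k + z s i k := fun s =>
    pot_z n (x s) (q s) (z s) (hup s) (hdn s)
  have pq : ∀ s i k, ψ s i (k+1) = ψ s i k + q s i k := fun s i k => pot_q _ _ _ _
  have pd : ∀ s i, i ≤ n → ψ s i i = 0 := by
    intro s i
    induction i with
    | zero => intro _; simp [hψ, pot]
    | succ i ih =>
      intro h
      rw [pz s i i le_rfl h, ih (by omega)]
      simp only [hz, ub s i h, add_zero]
  have ps : ∀ s k, k ≤ n → ψ s n k = ψ s n 0 + ψ (s+1) k 0 := by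
    intro s k
    induction k with
    | zero => intro _; simp [hψ, pot]
    | succ k ih =>
      intro h
      rw [pq, ih (by omega), px (s+1) k 0 (by omega) h, add_assoc]
      congr 2
      exact us s k h
  have p1 : ∀ s, ψ (s+1) n 0 = ψ s n 0 := by
    intro s
    have := ps s n le_rfl
    rw [pd s n le_rfl] at this
    exact ((Cx.z2e _ _).1 this.symm).symm
  have pS : ∀ s, ∑ k ∈ Finset.range n, u (s, true, n-1, k) 2 = ψ s n 0 := by
    intro s
    have : ∀ m, m ≤ n → ψ s n m = ψ s n 0 + ∑ k ∈ Finset.range m, u (s, true, n-1, k) 2 := by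
      intro m
      induction m with
      | zero => intro _; simp
      | succ m ih =>
        intro h
        rw [pq, ih (by omega), Finset.sum_range_succ, add_assoc]
    have := this n le_rfl
    rw [pd s n le_rfl] at this
    exact ((Cx.z2e _ _).1 this.symm).symm
  have pone : ∀ s, ψ s n 0 = 1 := by
    simp only [pS, Fin.sum_univ_three] at hS
    have a := p1 0
    have b := p1 1
    simp only [show (0:Fin 3)+1 = 1 from rfl, show (1:Fin 3)+1 = 2 from rfl] at a b
    rw [b, a, z2s, zero_add] at hS
    intro s
    rcases fin3 s with rfl | rfl | rfl
    · exact hS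
    · rw [a, hS]
    · rw [b, a, hS]
  set Ψ : Tri → Fin 3 → ZMod 2 := fun t c =>
    match t with
    | (s, true, i, k) => if c = 2 then ψ s (i+1) k else ψ s i k
    | (s, false, i, k) => if c = 0 then ψ s i (k+1) else ψ s i k with hΨ
  refine ⟨fun p => Ψ p.1.1 p.2, ?_, ?_⟩
  · intro e
    have key : Ψ (fl n e true).1 (fl n e true).2 = Ψ (fl n e false).1 (fl n e false).2 +
        (if e.1.1.2.1 = true then 1 else 0) := by
      rcases EE_cases n e with ⟨s, i, k, c, h, h', rfl⟩ | ⟨s, k, h, rfl⟩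
      · rw [fl_de]
        rcases fin3 c with rfl | rfl | rfl
        · simp [fl, de, nb, hΨ]
        · simp [fl, de, nb, hΨ]
        · have : i - 1 + 1 = i := by omega
          simp [fl, de, nb, hΨ, this]
      · rw [fl_se]
        have : n - 1 + 1 = n := by omega
        simp [fl, se, hΨ, this]
        rw [ps s k h.le, pone]
        have := z2s (1 : ZMod 2)
        linear_combination - this
    exact key
  · rintro ⟨⟨s, b, i, k⟩, ht⟩ h0
    have h1 : ∀ a, Y (s, b, i, k) a = 0 := by
      intro a
      rw [hY, ← ex_eq n y ⟨(s, b, i, k), ht⟩]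
      exact h0 a
    have h2 : ∀ a, u (s, b, i, k) a = 0 := by
      intro a
      simp only [hu, h1, add_zero]
    have h3 : ∃ v, ∀ c, Ψ (s, b, i, k) c = v := by
      cases b
      · refine ⟨ψ s i k, fun c => ?_⟩
        simp only [hΨ]
        split_ifs
        · have := ud s i k 2 ht.1 ht.2
          simp [nb] at this
          rw [pq]
          simp only [hq, this, h2, add_zero]
        · rfl
      · refine ⟨ψ s i k, fun c => ?_⟩
        simp only [hΨ]
        split_ifs
        · rw [px s i k ht.1 ht.2]
          simp only [hx, h2, add_zero]
        · rfl
    obtain ⟨v, hv⟩ := h3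
    intro c c'
    exact (hv c).trans (hv c').symm

theorem core3 (n : ℕ) (hn : 0 < n) (o : Tri → Fin 3 → ZMod 2)
    (hbord : ∀ s i, i < n → o (s, true, i, i) 2 = 0 ∧ o (s, true, i, i) 0 = 0)
    (hint : ∀ s i k c, k < i → i < n →
      o (nb (s, false, i, k) c) (c+1) + o (s, false, i, k) (c+1) =
      o (nb (s, false, i, k) c) (c+2) + o (s, false, i, k) (c+2))
    (hseam : ∀ s k, k < n → o (s, true, n-1, k) 0 + o (s+1, true, k, 0) 1 =
      o (s, true, n-1, k) 1 + o (s+1, true, k, 0) 2)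
    (hpar : ∑ s : Fin 3, ∑ k ∈ Finset.range n, (o (s, true, n-1, k) 0 + o (s, true, n-1, k) 1) = 0) :
    ∃ j : Tri → Fin 3 → ℤ,
      (∀ t c, tmem n t → o t c = 0 → j t c = 0) ∧
      (∀ t c, tmem n t → o t c = 1 → j t c = 1 ∨ j t c = -1) ∧
      (∀ s i k c, k < i → i < n →
        j (nb (s, false, i, k) c) (c+1) + j (s, false, i, k) (c+1) =
        j (nb (s, false, i, k) c) (c+2) + j (s, false, i, k) (c+2) ∧
        (0 ≤ j (nb (s, false, i, k) c) (c+1) + j (s, false, i, k) (c+1) ∨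
          o (nb (s, false, i, k) c) (c+1) + o (s, false, i, k) (c+1) = 1)) ∧
      (∀ s k, k < n → j (s, true, n-1, k) 0 - j (s+1, true, k, 0) 1 =
        j (s, true, n-1, k) 1 - j (s+1, true, k, 0) 2) := by
  set X := cx n hn o hbord with hX
  have hκ : ∀ e, X.o (X.slot e false true) + X.o (X.slot e true true) = X.κ e := by
    intro e
    rw [Cx.κ]
    simp only [hX, o_slot]
    rcases EE_cases n e with ⟨s, i, k, c, h, h', rfl⟩ | ⟨s, k, h, rfl⟩
    · rw [fl_de]; exact (hint s i k c h h').symm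
    · rw [fl_se]; exact (hseam s k h).symm
  have hp : ∑ e, X.sm e * (X.o (X.slot e false false) + X.o (X.slot e false true)) = 0 := by
    simp only [hX, o_slot]
    rw [← hpar]
    exact sumE n (fun p => o p.1 (p.2+1) + o p.1 (p.2+2))
  obtain ⟨j, j0, j1, je, js⟩ := X.core2 hκ (pot_inst n hn o hbord) hp
  simp only [Cx.κ] at je
  simp only [hX, o_slot n hn o hbord] at je js
  simp only [ex_slot n hn o hbord j] at je js
  refine ⟨ex n j, ?_, ?_, ?_, ?_⟩
  · intro t c ht h
    rw [← ex_eq n j ⟨t, ht⟩]; exact j0 _ h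
  · intro t c ht h
    rw [← ex_eq n j ⟨t, ht⟩]; exact j1 _ h
  · intro s i k c h h'
    have := je (de n s i k c h h') rfl
    rw [fl_de] at this
    exact this
  · intro s k h
    have := js (se n s k h) rfl
    rw [fl_se] at this
    exact this

end NLS
end

section
namespace NLS

def ww (H : Fin 3 → ℕ → ℕ → ℤ) : Tri → Fin 3 → ℤ
  | (s, true, i, k), c => rh c (H s) (2*i+1) (2*k)
  | (s, false, i, k), c => if c = 0 then rh 0 (H s) (2*i) (2*k) else
      if c = 1 then rh 1 (H s) (2*i) (2*k+1) else rh 2 (H s) (2*i+1) (2*k+1)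

theorem na1 (a : ℕ) : a + 1 + 1 = a + 2 := rfl
theorem na2 (a : ℕ) : a + 2 + 1 = a + 3 := rfl
theorem na3 (a : ℕ) : a + 3 + 1 = a + 4 := rfl

theorem rh_nn (n : ℕ) (H : ℕ → ℕ → ℤ) (h : IsHive n H) (c : Fin 3) (i k : ℕ) (hk : k < i) (hi : i < n) :
    0 ≤ rh c H i k := by
  rcases fin3 c with rfl | rfl | rfl
  · have := h.s2 i k hk hi
    simp [rh]; linarith
  · have := h.s1 i k hk hi
    simp [rh]; linarith
  · obtain ⟨j, rfl⟩ : ∃ j, i = j + 1 := ⟨i - 1, by omega⟩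
    have := h.s3 j k (by omega) hi
    simp [rh]; linarith

theorem ww_nn (n : ℕ) (H : Fin 3 → ℕ → ℕ → ℤ) (h : ∀ s, IsHive (2*n) (H s)) (t : Tri) (c : Fin 3)
    (ht : tmem n t) : 0 ≤ ww H t c := by
  obtain ⟨s, b, i, k⟩ := t
  cases b <;> obtain ⟨h1, h2⟩ := ht
  · simp only [ww]
    split_ifs
    · exact rh_nn _ _ (h s) _ _ _ (by omega) (by omega)
    · exact rh_nn _ _ (h s) _ _ _ (by omega) (by omega)
    · exact rh_nn _ _ (h s) _ _ _ (by omega) (by omega)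
  · exact rh_nn _ _ (h s) _ _ _ (by omega) (by omega)

theorem zc (a b : ℤ) (h : a % 2 = b % 2) : (a : ZMod 2) = (b : ZMod 2) :=
  (ZMod.intCast_eq_intCast_iff' a b 2).2 h

theorem zc0 (a : ℤ) : (a : ZMod 2) = 0 ↔ ∃ m, a = 2 * m := by
  rw [ZMod.intCast_zmod_eq_zero_iff_dvd]; rfl

theorem zc1 (a : ℤ) (h : (a : ZMod 2) = 1) : ∃ m, a = 2 * m + 1 := by
  rcases Int.even_or_odd' a with ⟨m, e | e⟩
  · rw [(zc0 a).2 ⟨m, e⟩] at h; exact absurd h (by decide)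
  · exact ⟨m, e⟩

theorem P5par (N : ℕ) (hN : 0 < N) (L : Fin 3 → ℕ → ℤ) (he : Even (∑ s, ∑ i ∈ Finset.range N, L s i))
    (H : Fin 3 → ℕ → ℕ → ℤ) (h : IsMH (2*N) (fun s i => L s (i/2)) H) :
    ∃ j : Tri → Fin 3 → ℤ,
      (∀ t c, tmem N t → ∃ m, ww H t c = j t c + 2 * m ∧ 0 ≤ m ∧ 0 ≤ j t c + m) ∧
      (∀ s i, i < N → j (s, true, i, i) 2 = 0 ∧ j (s, true, i, i) 0 = 0) ∧
      (∀ s i k c, k < i → i < N →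
        j (nb (s, false, i, k) c) (c+1) + j (s, false, i, k) (c+1) =
        j (nb (s, false, i, k) c) (c+2) + j (s, false, i, k) (c+2) ∧
        -1 ≤ j (nb (s, false, i, k) c) (c+1) + j (s, false, i, k) (c+1)) ∧
      (∀ s k, k < N → j (s, true, N-1, k) 0 - j (s+1, true, k, 0) 1 =
        j (s, true, N-1, k) 1 - j (s+1, true, k, 0) 2) := by
  have bd : ∀ s i, i ≤ N → H s (2*i) (2*i) = 2 * ∑ j ∈ Finset.range i, L s j := by
    intro s i hi
    rw [h.bd s (2*i) (by omega)]
    have := sum_div_range (L s) 2 (by norm_num) i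
    exact_mod_cast this
  have bd' : ∀ s i, i < N → 2 * H s (2*i+1) (2*i+1) = H s (2*i) (2*i) + H s (2*i+2) (2*i+2) := by
    intro s i hi
    rw [h.bd s (2*i) (by omega), h.bd s (2*i+1) (by omega), h.bd s (2*i+2) (by omega),
      Finset.sum_range_succ, Finset.sum_range_succ, Finset.sum_range_succ]
    have e1 : 2*i/2 = i := by omega
    have e2 : (2*i+1)/2 = i := by omega
    simp only [e1, e2]; ring
  have wn := ww_nn N H h.hive
  have hb0 : ∀ s i, i < N → ww H (s, true, i, i) 2 = 0 ∧ ww H (s, true, i, i) 0 = 0 := by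
    intro s i hi
    have a := wn (s, true, i, i) 2 ⟨le_rfl, hi⟩
    have b := wn (s, true, i, i) 0 ⟨le_rfl, hi⟩
    have c := bd' s i hi
    simp [ww, rh] at a b c ⊢
    have e1 : 2*i+1+1 = 2*i+2 := rfl
    rw [e1] at *
    constructor <;> omega
  have hb : ∀ s i, i < N → ((ww H (s, true, i, i) 2 : ℤ) : ZMod 2) = 0 ∧
      ((ww H (s, true, i, i) 0 : ℤ) : ZMod 2) = 0 := by
    intro s i hi
    rw [(hb0 s i hi).1, (hb0 s i hi).2]; simp
  obtain ⟨j, j0, j1, jd, js⟩ := core3 N hN (fun t c => ((ww H t c : ℤ) : ZMod 2)) hb (by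
    intro s i k c hk hi
    obtain ⟨i, rfl⟩ : ∃ i', i = i' + 1 := ⟨i - 1, by omega⟩
    simp only [← Int.cast_add]
    suffices (ww H (nb (s, false, i+1, k) c) (c+1) + ww H (s, false, i+1, k) (c+1)) % 2 =
      (ww H (nb (s, false, i+1, k) c) (c+2) + ww H (s, false, i+1, k) (c+2)) % 2 from
      zc _ _ this
    rcases fin3 c with rfl | rfl | rfl
    · simp [nb, ww, rh, mul_add]
      simp only [na1, na2, na3]
      omega
    · simp [nb, ww, rh, mul_add]
      simp only [na1, na2, na3]
      omega
    · simp [nb, ww, rh, mul_add]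
      simp only [na1, na2, na3]
      omega) (by
    intro s k hk
    obtain ⟨n, rfl⟩ : ∃ n, N = n + 1 := ⟨N - 1, by omega⟩
    simp only [← Int.cast_add]
    suffices (ww H (s, true, n, k) 0 + ww H (s+1, true, k, 0) 1) % 2 =
      (ww H (s, true, n, k) 1 + ww H (s+1, true, k, 0) 2) % 2 from
      zc _ _ this
    have a := h.seam s (2*k) (by omega)
    have b := h.seam s (2*k+1) (by omega)
    have c := h.seam s (2*k+2) (by omega)
    simp only [mul_add, mul_one] at a b c
    simp [ww, rh]
    have e1 : 2*n+1+1 = 2*n+2 := rfl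
    have e2 : 2*k+1+1 = 2*k+2 := rfl
    rw [e1, e2] at *
    omega) (by
    obtain ⟨n, rfl⟩ : ∃ n, N = n + 1 := ⟨N - 1, by omega⟩
    simp only [← Int.cast_add, ← Int.cast_sum, Nat.add_sub_cancel]
    rw [zc0]
    have key : ∀ s m, (∑ k ∈ Finset.range m, (ww H (s, true, n, k) 0 + ww H (s, true, n, k) 1)) % 2 =
        (H s (2*n+2) 0 - H s (2*n+2) (2*m)) % 2 := by
      intro s m
      induction m with
      | zero => simp
      | succ m ih =>
        rw [Finset.sum_range_succ]
        simp [ww, rh, mul_add] at ih ⊢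
        simp only [na1] at ih ⊢
        omega
    have e : ∀ s, H s (2*n+2) (2*(n+1)) = 2 * ∑ j ∈ Finset.range (n+1), L s j := fun s => bd s (n+1) le_rfl
    have sm : ∀ s, H s (2*n+2) (2*(n+1)) = H s (2*n+2) 0 + H (s+1) (2*n+2) 0 := fun s =>
      h.seam s (2*(n+1)) le_rfl
    obtain ⟨q, hq⟩ := he
    simp only [Fin.sum_univ_three] at hq ⊢
    have k0 := key 0 (n+1)
    have k1 := key 1 (n+1)
    have k2 := key 2 (n+1)
    have a0 := sm 0
    have a1 := sm 1
    have a2 := sm 2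
    rw [e] at a0 a1 a2
    simp only [show (0:Fin 3)+1 = 1 from rfl, show (1:Fin 3)+1 = 2 from rfl,
      show (2:Fin 3)+1 = 0 from rfl] at a0 a1 a2
    rw [e] at k0 k1 k2
    refine (Int.dvd_iff_emod_eq_zero).2 ?_
    omega)
  have jw : ∀ t c, tmem N t → ∃ m, ww H t c = j t c + 2 * m ∧ 0 ≤ m ∧ 0 ≤ j t c + m := by
    intro t c ht
    have w0 := wn t c ht
    rcases z2 ((ww H t c : ℤ) : ZMod 2) with hz | hz
    · rw [j0 t c ht hz]
      obtain ⟨m, hm⟩ := (zc0 _).1 hz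
      exact ⟨m, by omega, by omega, by omega⟩
    · obtain ⟨m, hm⟩ := zc1 _ hz
      rcases j1 t c ht hz with e | e <;> rw [e]
      · exact ⟨m, by omega, by omega, by omega⟩
      · exact ⟨m+1, by omega, by omega, by omega⟩
  refine ⟨j, jw, ?_, ?_, js⟩
  · intro s i hi
    exact ⟨j0 _ _ ⟨le_rfl, hi⟩ (hb s i hi).1, j0 _ _ ⟨le_rfl, hi⟩ (hb s i hi).2⟩
  · intro s i k c hk hi
    obtain ⟨a, b⟩ := jd s i k c hk hi
    refine ⟨a, ?_⟩
    rcases b with b | b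
    · omega
    · have t1 : tmem N (s, false, i, k) := ⟨hk, hi⟩
      have t2 : tmem N (nb (s, false, i, k) c) := by
        rcases fin3 c with rfl | rfl | rfl <;> simp [nb, tmem] <;> omega
      rcases z2 ((ww H (s, false, i, k) (c+1) : ℤ) : ZMod 2) with hz | hz
      · simp only [hz, add_zero] at b
        have q1 := j0 _ _ t1 hz
        have q2 := j1 _ _ t2 b
        omega
      · simp only [hz] at b
        have b' : ((ww H (nb (s, false, i, k) c) (c+1) : ℤ) : ZMod 2) = 0 := by
          linear_combination b
        have q1 := j1 _ _ t1 hz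
        have q2 := j0 _ _ t2 b'
        omega

end NLS
end

section
namespace NLS

theorem P5thm (N : ℕ) (L : Fin 3 → ℕ → ℤ) (he : Even (∑ s, ∑ i ∈ Finset.range N, L s i))
    (hM : MH (2*N) (fun s i => L s (i/2))) : MH N L := by
  obtain ⟨H, h⟩ := hM
  rcases Nat.eq_zero_or_pos N with rfl | hN
  · refine ⟨fun _ _ _ => 0, ⟨fun s => ⟨?_, ?_, ?_⟩, ?_, ?_, ?_⟩⟩
    · intro i k _ h; omega
    · intro i k _ h; omega
    · intro i k _ h; omega
    · intros; simp
    · intro s i hi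
      obtain rfl : i = 0 := by omega
      simp
    · intro s i h; omega
  obtain ⟨j, jw, jb, jd, js⟩ := P5par N hN L he H h
  set x : Fin 3 → ℕ → ℕ → ℤ := fun s i k => j (s, true, i, k) 1 - j (s, true, i, k) 2 with hx
  set q : Fin 3 → ℕ → ℕ → ℤ := fun s i k => j (s, true, i-1, k) 0 - j (s, true, i-1, k) 1 with hq
  set z : Fin 3 → ℕ → ℕ → ℤ := fun s i k => j (s, true, i, k) 0 - j (s, true, i, k) 2 with hz
  have d0 : ∀ s i k, k < i → i < N → x s i (k+1) = j (s, false, i, k) 2 - j (s, false, i, k) 1 ∧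
      -1 ≤ j (s, true, i, k+1) 1 + j (s, false, i, k) 1 := by
    intro s i k h1 h2
    have := jd s i k 0 h1 h2
    simp [nb] at this
    simp only [hx]
    omega
  have d1 : ∀ s i k, k < i → i < N → z s i k = j (s, false, i, k) 2 - j (s, false, i, k) 0 ∧
      -1 ≤ j (s, true, i, k) 2 + j (s, false, i, k) 2 := by
    intro s i k h1 h2
    have := jd s i k 1 h1 h2
    simp [nb, show (1:Fin 3) + 1 = 2 from rfl, show (1:Fin 3) + 2 = 0 from rfl] at this
    simp only [hz]
    omega
  have d2 : ∀ s i k, k < i → i < N → q s i k = j (s, false, i, k) 1 - j (s, false, i, k) 0 ∧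
      -1 ≤ j (s, true, i-1, k) 0 + j (s, false, i, k) 0 := by
    intro s i k h1 h2
    have := jd s i k 2 h1 h2
    simp [nb, show (2:Fin 3) + 1 = 0 from rfl, show (2:Fin 3) + 2 = 1 from rfl] at this
    simp only [hq]
    omega
  have hup : ∀ s i k, k ≤ i → i < N → x s i k + q s (i+1) k = z s i k := by
    intro s i k _ _
    simp only [hx, hq, hz, Nat.add_sub_cancel]
    ring
  have hdn : ∀ s i k, k < i → i < N → q s i k + x s i (k+1) = z s i k := by
    intro s i k h1 h2
    rw [(d0 s i k h1 h2).1, (d1 s i k h1 h2).1, (d2 s i k h1 h2).1]; ring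
  set δ : Fin 3 → ℕ → ℕ → ℤ := fun s => pot (x s) (q s) with hδ
  have px : ∀ s i k, k ≤ i → i < N → δ s (i+1) k = δ s i k + x s i k := fun s =>
    pot_x N (x s) (q s) (z s) (hup s) (hdn s)
  have pz : ∀ s i k, k ≤ i → i < N → δ s (i+1) (k+1) = δ s i k + z s i k := fun s =>
    pot_z N (x s) (q s) (z s) (hup s) (hdn s)
  have pq : ∀ s i k, δ s i (k+1) = δ s i k + q s i k := fun s i k => pot_q _ _ _ _
  have pd : ∀ s i, i ≤ N → δ s i i = 0 := by
    intro s i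
    induction i with
    | zero => intro _; simp [hδ, pot]
    | succ i ih =>
      intro h
      rw [pz s i i le_rfl h, ih (by omega)]
      simp only [hz, jb s i h, sub_self, add_zero]
  have ps : ∀ s k, k ≤ N → δ s N k = δ s N 0 + δ (s+1) k 0 := by
    intro s k
    induction k with
    | zero => intro _; simp [hδ, pot]
    | succ k ih =>
      intro h
      have := js s k h
      rw [pq, ih (by omega), px (s+1) k 0 (by omega) h, add_assoc]
      congr 2
      simp only [hq, hx]
      omega
  have wU : ∀ s i k, k ≤ i → i < N → ∀ c, ∃ m, rh c (H s) (2*i+1) (2*k) = j (s, true, i, k) c + 2 * m ∧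
      0 ≤ m ∧ 0 ≤ j (s, true, i, k) c + m := fun s i k h1 h2 c => jw (s, true, i, k) c ⟨h1, h2⟩
  have ev : ∀ s i k, k ≤ i → i ≤ N → ∃ m, H s (2*i) (2*k) + δ s i k = 2 * m := by
    intro s i
    induction i with
    | zero =>
      intro k hk _
      obtain rfl : k = 0 := by omega
      have := h.bd s 0 (by omega)
      have h0 := pd s 0 (by omega)
      simp at this
      exact ⟨0, by simp [this, h0]⟩
    | succ i ih =>
      have stp : ∀ k, k ≤ i → i < N → ∃ m, H s (2*(i+1)) (2*k) + δ s (i+1) k = 2 * m := by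
        intro k hk hi
        obtain ⟨m, hm⟩ := ih k hk hi.le
        obtain ⟨m1, h1, _⟩ := wU s i k hk hi 1
        obtain ⟨m2, h2, _⟩ := wU s i k hk hi 2
        rw [px s i k hk hi]
        simp only [hx]
        simp [rh] at h1 h2
        simp only [mul_add, mul_one] at *
        simp only [na1] at *
        refine ⟨m + H s (2*i+1) (2*k) - H s (2*i) (2*k) - m1 - j (s, true, i, k) 2 - m2, ?_⟩
        omega
      intro k hk hi
      rcases Nat.lt_or_eq_of_le hk with hk | rfl
      · exact stp k (by omega) hi
      · refine ⟨∑ j ∈ Finset.range (i+1), L s j, ?_⟩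
        rw [pd s _ hi, add_zero, h.bd s _ (by omega)]
        have := sum_div_range (L s) 2 (by norm_num) (i+1)
        exact_mod_cast this
  have ev' : ∀ s i k, ∃ m, k ≤ i → i ≤ N → H s (2*i) (2*k) + δ s i k = 2 * m := by
    intro s i k
    by_cases hh : k ≤ i ∧ i ≤ N
    · obtain ⟨m, hm⟩ := ev s i k hh.1 hh.2
      exact ⟨m, fun _ _ => hm⟩
    · exact ⟨0, fun a b => absurd ⟨a, b⟩ hh⟩
  choose G hG using ev'
  refine ⟨G, ⟨fun s => ⟨?_, ?_, ?_⟩, ?_, ?_, ?_⟩⟩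
  · intro i k hk hi
    have g1 := hG s i (k+1) (by omega) (by omega)
    have g2 := hG s (i+1) k (by omega) (by omega)
    have g3 := hG s (i+1) (k+1) (by omega) (by omega)
    have g4 := hG s i k (by omega) (by omega)
    have a1 := (d1 s i k hk hi)
    have a2 := (d2 s i k hk hi).1
    have p1 := pq s (i+1) k
    have p2 := pq s i k
    obtain ⟨mU, u1, u2, _⟩ := wU s i k hk.le hi 1
    obtain ⟨mD, v1, v2, _⟩ := jw (s, false, i, k) 1 ⟨hk, hi⟩
    have e1 := rh_nn _ _ (h.hive s) 1 (2*i) (2*k) (by omega) (by omega)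
    have e2 := rh_nn _ _ (h.hive s) 1 (2*i+1) (2*k+1) (by omega) (by omega)
    simp [ww, rh] at u1 v1 e1 e2
    simp only [hq, hz, Nat.add_sub_cancel] at p1 a1
    simp only [mul_add, mul_one] at *
    simp only [na1, na2, na3] at *
    omega
  · intro i k hk hi
    have g1 := hG s i (k+1) (by omega) (by omega)
    have g2 := hG s (i+1) (k+2) (by omega) (by omega)
    have g3 := hG s (i+1) (k+1) (by omega) (by omega)
    have g4 := hG s i k (by omega) (by omega)
    have a1 := (d0 s i k hk hi)
    have a2 := (d2 s i k hk hi).1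
    have p1 := pq s (i+1) (k+1)
    have p2 := pq s i k
    obtain ⟨mU, u1, u2, _⟩ := wU s i (k+1) hk hi 0
    obtain ⟨mD, v1, v2, _⟩ := jw (s, false, i, k) 0 ⟨hk, hi⟩
    have e1 := rh_nn _ _ (h.hive s) 0 (2*i) (2*k+1) (by omega) (by omega)
    have e2 := rh_nn _ _ (h.hive s) 0 (2*i+1) (2*k+1) (by omega) (by omega)
    simp [ww, rh] at u1 v1 e1 e2
    simp only [hq, hx, Nat.add_sub_cancel] at p1 a1
    simp only [mul_add, mul_one] at *
    simp only [na1, na2, na3] at *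
    have f2 : 2 * k + 2 * 2 = 2 * k + 4 := rfl
    have f3 : 2 * k + 2 + 2 = 2 * k + 4 := rfl
    have f4 : 2 * k + 1 + 2 = 2 * k + 3 := rfl
    have f5 : 2 * k + 2 + 1 = 2 * k + 3 := rfl
    have f6 : 2 * k + 1 + 1 = 2 * k + 2 := rfl
    simp only [f2, f3, f4, f5, f6] at g1 g2 g3 g4 a1 a2 p1 p2 u1 v1 e1 e2 u2 v2
    omega
  · intro i k hk hi
    have g1 := hG s (i+1) k (by omega) (by omega)
    have g2 := hG s (i+1) (k+1) (by omega) (by omega)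
    have g3 := hG s i k (by omega) (by omega)
    have g4 := hG s (i+2) (k+1) (by omega) (by omega)
    have a1 := (d2 s (i+1) k (by omega) hi)
    have a2 := (d0 s (i+1) k (by omega) hi).1
    have p1 := px s i k hk (by omega)
    have p2 := px s (i+1) (k+1) (by omega) hi
    obtain ⟨mU, u1, u2, _⟩ := wU s i k hk (by omega) 2
    obtain ⟨mD, v1, v2, _⟩ := jw (s, false, i+1, k) 2 ⟨by omega, hi⟩
    have e1 := rh_nn _ _ (h.hive s) 2 (2*(i+1)) (2*k) (by omega) (by omega)
    have e2 := rh_nn _ _ (h.hive s) 2 (2*(i+1)) (2*k+1) (by omega) (by omega)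
    simp [ww, rh] at u1 v1 e1 e2
    have f1 : 2*(i+1)-1 = 2*i+1 := by omega
    rw [f1] at e1 e2
    simp only [hq, Nat.add_sub_cancel] at a1
    rw [a2] at p2
    simp only [hx] at p1
    simp only [mul_add, mul_one] at *
    simp only [na1, na2, na3] at *
    have f2 : 2 * i + 2 * 2 = 2 * i + 4 := rfl
    simp only [f2] at *
    omega
  · intro s k hk
    have g1 := hG s N k hk le_rfl
    have g2 := hG s N 0 (by omega) le_rfl
    have g3 := hG (s+1) k 0 (by omega) hk
    have a := h.seam s (2*k) (by omega)
    have b := ps s k hk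
    simp only [mul_zero] at *
    omega
  · intro s i hi
    have g1 := hG s i i le_rfl hi
    have a := h.bd s (2*i) (by omega)
    have b := sum_div_range (L s) 2 (by norm_num) i
    rw [pd s i hi, a] at g1
    have b' : ∑ j ∈ Finset.range (2*i), L s (j/2) = 2 * ∑ j ∈ Finset.range i, L s j := by exact_mod_cast b
    rw [b'] at g1
    omega
  · intro s i hi
    have g1 := hG s i 0 (by omega) hi.le
    have g2 := hG s (i+1) 0 (by omega) hi
    have p := px s i 0 (by omega) hi
    obtain ⟨m1, u1, u2, u3⟩ := wU s i 0 (by omega) hi 1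
    obtain ⟨m2, v1, v2, v3⟩ := wU s i 0 (by omega) hi 2
    have a1 := h.ab s (2*i) (by omega)
    have a2 := h.ab s (2*i+1) (by omega)
    simp [rh] at u1 v1
    simp only [hx] at p
    simp only [mul_add, mul_one, mul_zero] at *
    simp only [na1] at *
    omega

end NLS
end

/-- **Corollary (NL-saturation for `n ≤ 5`).** For `(λ,μ,ν) ∈ (Par_n)³` with
`1 ≤ n ≤ 5`, `N_{λ,μ,ν} ≠ 0` iff `|λ|+|μ|+|ν|` is even and some multiple
`N_{tλ,tμ,tν}` is nonzero. -/
theorem stmt4 (n : ℕ) (h1 : 1 ≤ n) (h5 : n ≤ 5) (lam mu nu : ℕ → ℕ)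
    (hl : MemParN n lam) (hm : MemParN n mu) (hv : MemParN n nu) :
    NL lam mu nu ≠ 0 ↔
      Even (sizeP lam + sizeP mu + sizeP nu) ∧
      ∃ t : ℕ, 0 < t ∧
        NL (fun i => t * lam i) (fun i => t * mu i) (fun i => t * nu i) ≠ 0 :=
  NLS.assemble NLS.P4thm NLS.P5thm n lam mu nu hl hm hv
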